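/- For all sufficiently small ε > 0, if p : E → S_ε \ X is a covering map with E path-connected and simply connected (a universal cover), then E is (n−1)-connected: π_k(E) is trivial for every k with 1 ≤ k ≤ n−1. -/

import Mathlib

section PartA1
open Complex Metric Filter Topology

lemma hasSum_cg {f g : ℕ → ℂ} {a : ℂ} (h : HasSum g a) (hfg : ∀ n, f n = g n) : HasSum f a := by
  rwa [funext hfg]

lemma hasSum_cg' {F : Type*} [NormedAddCommGroup F] {f g : ℕ → F} {a : F} (h : HasSum g a)
    (hfg : ∀ n, f n = g n) : HasSum f a := by
  rwa [funext hfg]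

section Superposition
variable {E : Type*} [NormedAddCommGroup E] [NormedSpace ℂ E]
variable {K : Type*} [TopologicalSpace K] [CompactSpace K]

/-- The power series of the superposition operator. -/
noncomputable def supSeries (p : FormalMultilinearSeries ℂ E ℂ) :
    FormalMultilinearSeries ℂ C(K, E) C(K, ℂ) := fun n =>
  MultilinearMap.mkContinuous
    { toFun := fun φ => ⟨fun w => p n (fun i => φ i w), by fun_prop⟩
      map_update_add' := by
        intro _ m i x y
        ext w
        have key : ∀ z : C(K, E), (fun j => (Function.update m i z) j w)
            = Function.update (fun j => m j w) i (z w) := by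
          intro z
          ext j
          by_cases h : j = i
          · subst h; simp
          · simp [h]
        simp only [ContinuousMap.coe_mk, ContinuousMap.add_apply, key]
        exact (p n).map_update_add _ _ _ _
      map_update_smul' := by
        intro _ m i c x
        ext w
        have key : ∀ z : C(K, E), (fun j => (Function.update m i z) j w)
            = Function.update (fun j => m j w) i (z w) := by
          intro z
          ext j
          by_cases h : j = i
          · subst h; simp
          · simp [h]
        simp only [ContinuousMap.coe_mk, ContinuousMap.smul_apply, key]
        exact (p n).map_update_smul _ _ _ _ } ‖p n‖ (by
      intro φ
      rw [ContinuousMap.norm_le _ (by positivity)]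
      intro w
      refine ((p n).le_opNorm _).trans ?_
      gcongr with i
      exact (φ i).norm_coe_le_norm w)

lemma supSeries_apply (p : FormalMultilinearSeries ℂ E ℂ) (n : ℕ) (φ : Fin n → C(K, E)) (w : K) :
    supSeries p n φ w = p n (fun i => φ i w) := rfl

lemma norm_supSeries_le (p : FormalMultilinearSeries ℂ E ℂ) (n : ℕ) :
    ‖(supSeries p n : ContinuousMultilinearMap ℂ (fun _ : Fin n => C(K, E)) C(K, ℂ))‖ ≤ ‖p n‖ :=
  MultilinearMap.mkContinuous_norm_le _ (norm_nonneg _) _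

lemma exists_superposition {g : E → ℂ} (hg : AnalyticAt ℂ g 0) :
    ∃ r > 0, ∃ N : C(K, E) → C(K, ℂ), ∀ φ, ‖φ‖ < r →
      AnalyticAt ℂ N φ ∧ ∀ w, N φ w = g (φ w) := by
  obtain ⟨p, R, hp⟩ := hg
  have hrad : p.radius ≤ (supSeries (K := K) p).radius := by
    apply FormalMultilinearSeries.radius_le_of_le
    intro n
    exact norm_supSeries_le p n
  obtain ⟨r, hr0, hrR⟩ := ENNReal.lt_iff_exists_nnreal_btwn.1 hp.r_pos
  have hr0' : (0:ℝ) < r := by exact_mod_cast hr0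
  refine ⟨r, hr0', (supSeries p).sum, fun φ hφ => ?_⟩
  have hpos : 0 < (supSeries (K := K) p).radius := hp.r_pos.trans_le (hp.r_le.trans hrad)
  have hB := (supSeries (K := K) p).hasFPowerSeriesOnBall hpos
  have hφ' : φ ∈ Metric.eball (0 : C(K, E)) (supSeries (K := K) p).radius := by
    rw [Metric.mem_eball, edist_zero_right]
    calc ‖φ‖ₑ < r := by
            rw [enorm_eq_nnnorm]; exact_mod_cast hφ
      _ ≤ R := hrR.le
      _ ≤ _ := hp.r_le.trans hrad
  refine ⟨hB.analyticAt_of_mem hφ', fun w => ?_⟩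
  have h1 := hB.hasSum hφ'
  have h2 := (ContinuousMap.evalCLM ℂ (M := ℂ) w).hasSum h1
  have hw : φ w ∈ Metric.eball (0 : E) R := by
    rw [Metric.mem_eball, edist_zero_right]
    calc ‖φ w‖ₑ < r := by
            rw [enorm_eq_nnnorm]; exact_mod_cast (φ.norm_coe_le_norm w).trans_lt hφ
      _ ≤ R := hrR.le
  have h3 := hp.hasSum hw
  rw [zero_add] at h2 h3
  exact h2.unique h3

end Superposition

section Shift

/-- bounded sequences -/
def BS : Type := BoundedContinuousFunction ℕ ℂ

noncomputable instance : NormedAddCommGroup BS :=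
  inferInstanceAs (NormedAddCommGroup (BoundedContinuousFunction ℕ ℂ))

noncomputable instance : NormedSpace ℂ BS :=
  inferInstanceAs (NormedSpace ℂ (BoundedContinuousFunction ℕ ℂ))

instance : CompleteSpace BS := inferInstanceAs (CompleteSpace (BoundedContinuousFunction ℕ ℂ))

noncomputable instance : CoeFun BS (fun _ => ℕ → ℂ) := ⟨fun b => (show BoundedContinuousFunction ℕ ℂ from b)⟩

lemma BS.norm_coe_le (b : BS) (n : ℕ) : ‖b n‖ ≤ ‖b‖ :=
  BoundedContinuousFunction.norm_coe_le_norm (show BoundedContinuousFunction ℕ ℂ from b) n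

lemma BS.norm_le {b : BS} {C : ℝ} (hC : 0 ≤ C) (h : ∀ n, ‖b n‖ ≤ C) : ‖b‖ ≤ C :=
  (BoundedContinuousFunction.norm_le (f := (show BoundedContinuousFunction ℕ ℂ from b)) hC).2 h

lemma BS.ext' {a b : BS} (h : ∀ n, a n = b n) : a = b :=
  BoundedContinuousFunction.ext (f := (show BoundedContinuousFunction ℕ ℂ from a)) h

noncomputable def BS.mk (s : ℕ → ℂ) (C : ℝ) (h : ∀ n, ‖s n‖ ≤ C) : BS :=
  BoundedContinuousFunction.ofNormedAddCommGroupDiscrete s C h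

lemma BS.mk_apply (s : ℕ → ℂ) (C : ℝ) (h : ∀ n, ‖s n‖ ≤ C) (n : ℕ) : BS.mk s C h n = s n := rfl

lemma BS.add_apply' (a b : BS) (n : ℕ) : (a + b) n = a n + b n := rfl
lemma BS.sub_apply' (a b : BS) (n : ℕ) : (a - b) n = a n - b n := rfl
lemma BS.smul_apply' (c : ℂ) (b : BS) (n : ℕ) : (c • b) n = c * b n := rfl

/-- backward shift -/
noncomputable def bsB : BS →L[ℂ] BS :=
  LinearMap.mkContinuous
    { toFun := fun b => BS.mk (fun n => b (n + 1)) ‖b‖ (fun n => b.norm_coe_le _)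
      map_add' := fun _ _ => rfl
      map_smul' := fun _ _ => rfl } 1 (by
        intro b
        rw [one_mul]
        exact BS.norm_le (norm_nonneg _) fun n => b.norm_coe_le _)

lemma bsB_apply (b : BS) (n : ℕ) : bsB b n = b (n + 1) := rfl

lemma bsB_norm : ‖bsB‖ ≤ 1 := LinearMap.mkContinuous_norm_le _ zero_le_one _

/-- forward shift -/
noncomputable def bsS : BS →L[ℂ] BS :=
  LinearMap.mkContinuous
    { toFun := fun b => BS.mk (fun n => Nat.casesOn n 0 (fun m => b m)) ‖b‖ (by
          intro n
          cases n with
          | zero => simp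
          | succ n => exact b.norm_coe_le _)
      map_add' := by
        intro a b
        apply BS.ext'
        intro n
        rw [BS.add_apply']
        cases n with
        | zero => exact (zero_add (0:ℂ)).symm
        | succ n => rfl
      map_smul' := by
        intro a b
        apply BS.ext'
        intro n
        rw [RingHom.id_apply, BS.smul_apply']
        cases n with
        | zero => exact (mul_zero a).symm
        | succ n => rfl } 1 (by
        intro b
        rw [one_mul]
        refine BS.norm_le (norm_nonneg _) fun n => ?_
        cases n with
        | zero => exact (norm_zero (E := ℂ)).le.trans (norm_nonneg _)
        | succ n => exact b.norm_coe_le _)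

lemma bsS_zero (b : BS) : bsS b 0 = 0 := rfl
lemma bsS_succ (b : BS) (n : ℕ) : bsS b (n + 1) = b n := rfl
lemma bsS_norm : ‖bsS‖ ≤ 1 := LinearMap.mkContinuous_norm_le _ zero_le_one _

lemma bsB_pow_apply (d : ℕ) (b : BS) (n : ℕ) : (bsB ^ d) b n = b (n + d) := by
  induction d generalizing b with
  | zero => simp
  | succ d ih =>
    rw [pow_succ]
    change (bsB ^ d) (bsB b) n = _
    rw [ih, bsB_apply, add_assoc]

lemma bsS_pow_apply_lt (d : ℕ) (b : BS) (n : ℕ) (h : n < d) : (bsS ^ d) b n = 0 := by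
  induction d generalizing n with
  | zero => omega
  | succ d ih =>
    rw [pow_succ']
    change bsS ((bsS ^ d) b) n = _
    cases n with
    | zero => rfl
    | succ n => rw [bsS_succ, ih _ (by omega)]

lemma bsS_pow_apply_ge (d : ℕ) (b : BS) (n : ℕ) : (bsS ^ d) b (n + d) = b n := by
  induction d with
  | zero => simp
  | succ d ih =>
    rw [pow_succ']
    change bsS ((bsS ^ d) b) (n + d + 1) = _
    rw [bsS_succ, ih]

/-- coordinate 0 -/
noncomputable def bsC (n : ℕ) : BS →L[ℂ] ℂ :=
  LinearMap.mkContinuous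
    { toFun := fun b => b n
      map_add' := fun _ _ => rfl
      map_smul' := fun _ _ => rfl } 1 (by intro b; rw [one_mul]; exact b.norm_coe_le n)

lemma bsC_apply (n : ℕ) (b : BS) : bsC n b = b n := rfl

/-- evaluation of the generating function -/
noncomputable def bsEv (z : ℂ) : BS →L[ℂ] ℂ := (bsC 0).comp (Ring.inverse (1 - z • bsB))

lemma bs_norm_smul {z : ℂ} (hz : ‖z‖ < 1) : ‖z • bsB‖ < 1 := by
  rw [norm_smul]
  nlinarith [bsB_norm, norm_nonneg z, norm_nonneg bsB]

lemma bsEv_hasSum {z : ℂ} (hz : ‖z‖ < 1) (b : BS) : HasSum (fun n => z ^ n * b n) (bsEv z b) := by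
  have h1 : HasSum (fun n : ℕ => (z • bsB) ^ n) (Ring.inverse (1 - z • bsB)) := by
    have := (summable_geometric_of_norm_lt_one (x := z • bsB) (bs_norm_smul hz)).hasSum
    have h := NormedRing.inverse_one_sub (R := BS →L[ℂ] BS) (z • bsB) (bs_norm_smul hz)
    rw [h]
    exact this
  have h2 := h1.mapL ((ContinuousLinearMap.apply ℂ BS b))
  have h3 := h2.mapL (bsC 0)
  refine hasSum_cg h3 fun n => ?_
  simp only [ContinuousLinearMap.apply_apply, smul_pow, map_smul,
    bsC_apply, bsB_pow_apply, zero_add, smul_eq_mul]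

lemma bsEv_analytic : AnalyticAt ℂ bsEv 0 := by
  have h1 : AnalyticAt ℂ (fun z : ℂ => Ring.inverse (1 - z • bsB)) 0 := by
    have h2 := analyticAt_inverse (𝕜 := ℂ) (A := BS →L[ℂ] BS) 1
    refine AnalyticAt.fun_comp (g := Ring.inverse) ?_ ?_
    · have h3 : (1 - (0:ℂ) • bsB) = 1 := by rw [zero_smul, sub_zero]
      rw [h3]; exact h2
    · fun_prop
  exact (ContinuousLinearMap.compL ℂ BS BS ℂ (bsC 0)).analyticAt _ |>.comp h1

lemma bsEv_S {z : ℂ} (hz : ‖z‖ < 1) (b : BS) : bsEv z (bsS b) = z * bsEv z b := by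
  have h1 := bsEv_hasSum hz (bsS b)
  have h2 := (bsEv_hasSum hz b).mul_left z
  rw [← hasSum_nat_add_iff' 1] at h1
  simp only [bsS_succ, Finset.range_one, Finset.sum_singleton, pow_zero, bsS_zero, mul_zero,
    sub_zero] at h1
  refine h1.unique ?_
  refine hasSum_cg h2 fun n => ?_
  ring

lemma bsEv_S_pow {z : ℂ} (hz : ‖z‖ < 1) (n : ℕ) (b : BS) :
    bsEv z ((bsS ^ n) b) = z ^ n * bsEv z b := by
  induction n with
  | zero => simp
  | succ n ih =>
    rw [pow_succ']
    change bsEv z (bsS ((bsS ^ n) b)) = _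
    rw [bsEv_S hz, ih]; ring

/-- the circle of radius 2 -/
abbrev Circ2 := sphere (0 : ℂ) 2

lemma circ2_mem (θ : ℝ) : circleMap 0 2 θ ∈ sphere (0 : ℂ) 2 := circleMap_mem_sphere _ (by norm_num) _

lemma circ2_norm (θ : ℝ) : ‖circleMap 0 2 θ‖ = 2 := by
  simp

lemma circ2_cont (φ : C(Circ2, ℂ)) : Continuous fun θ : ℝ => φ ⟨circleMap 0 2 θ, circ2_mem θ⟩ :=
  φ.continuous.comp ((continuous_circleMap 0 2).subtype_mk _)

lemma circ2_cont' (φ : C(Circ2, ℂ)) (n : ℕ) : Continuous fun θ : ℝ =>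
    ((circleMap 0 2 θ)⁻¹ ^ n * φ ⟨circleMap 0 2 θ, circ2_mem θ⟩) := by
  refine Continuous.mul ?_ (circ2_cont φ)
  refine Continuous.pow ?_ n
  refine (continuous_circleMap 0 2).inv₀ ?_
  intro θ h
  have := circ2_norm θ
  rw [h] at this
  norm_num at this

/-- Taylor coefficients through the circle of radius 2. -/
noncomputable def coef (n : ℕ) : C(Circ2, ℂ) →L[ℂ] ℂ :=
  LinearMap.mkContinuous
    { toFun := fun φ => (2 * Real.pi : ℂ)⁻¹ * ∫ θ in (0:ℝ)..2 * Real.pi,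
        ((circleMap 0 2 θ)⁻¹ ^ n * φ ⟨circleMap 0 2 θ, circ2_mem θ⟩)
      map_add' := by
        intro φ ψ
        rw [← mul_add, ← intervalIntegral.integral_add]
        · simp [mul_add]
        · exact (circ2_cont' φ n).intervalIntegrable _ _
        · exact (circ2_cont' ψ n).intervalIntegrable _ _
      map_smul' := by
        intro c φ
        simp only [ContinuousMap.smul_apply, smul_eq_mul, RingHom.id_apply]
        simp only [mul_left_comm _ c]
        rw [intervalIntegral.integral_const_mul]
        ring } ((1 / 2) ^ n) (by
      intro φ
      have h := intervalIntegral.norm_integral_le_of_norm_le_const (a := 0) (b := 2 * Real.pi)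
        (f := fun θ => ((circleMap 0 2 θ)⁻¹ ^ n * φ ⟨circleMap 0 2 θ, circ2_mem θ⟩))
        (C := (1 / 2) ^ n * ‖φ‖) (by
          intro θ _
          rw [norm_mul, norm_pow, norm_inv, circ2_norm]
          have := φ.norm_coe_le_norm ⟨circleMap 0 2 θ, circ2_mem θ⟩
          have h2 : (0:ℝ) ≤ (2⁻¹) ^ n := by positivity
          rw [one_div]
          gcongr)
      simp only [LinearMap.coe_mk, AddHom.coe_mk]
      rw [norm_mul, norm_inv]
      have hpi := Real.pi_pos
      rw [sub_zero, abs_of_pos (by positivity)] at h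
      have h3 : ‖(2 * Real.pi : ℂ)‖ = 2 * Real.pi := by
        rw [norm_mul, Complex.norm_real, Real.norm_of_nonneg hpi.le]; simp
      rw [h3, inv_mul_le_iff₀ (by positivity)]
      linarith)

lemma coef_norm (n : ℕ) : ‖coef n‖ ≤ (1 / 2) ^ n :=
  LinearMap.mkContinuous_norm_le _ (by positivity) _

lemma coef_eq (n : ℕ) (φ : C(Circ2, ℂ)) (F : ℂ → ℂ) (hF : ∀ w : Circ2, φ w = F w) :
    coef n φ = (2 * Real.pi * I : ℂ)⁻¹ * ∮ w in C(0, 2), (w ^ (n + 1))⁻¹ * F w := by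
  change (2 * Real.pi : ℂ)⁻¹ * ∫ θ in (0:ℝ)..2 * Real.pi,
        ((circleMap 0 2 θ)⁻¹ ^ n * φ ⟨circleMap 0 2 θ, circ2_mem θ⟩) = _
  unfold circleIntegral
  have : ∀ θ : ℝ, deriv (circleMap 0 2) θ • (((circleMap 0 2 θ) ^ (n + 1))⁻¹ * F (circleMap 0 2 θ))
      = I * ((circleMap 0 2 θ)⁻¹ ^ n * φ ⟨circleMap 0 2 θ, circ2_mem θ⟩) := by
    intro θ
    have h0 : circleMap 0 2 θ ≠ 0 := by
      intro h
      have := circ2_norm θ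
      rw [h] at this
      norm_num at this
    rw [deriv_circleMap, hF, smul_eq_mul, pow_succ, mul_inv, inv_pow]
    field_simp
  simp only [this]
  rw [intervalIntegral.integral_const_mul]
  have : I ≠ 0 := I_ne_zero
  have := Real.pi_ne_zero
  field_simp

lemma coef_pow (n d : ℕ) (φ : C(Circ2, ℂ)) (hF : ∀ w : Circ2, φ w = (w : ℂ) ^ d) :
    coef n φ = if n = d then 1 else 0 := by
  rw [coef_eq n φ (fun w => w ^ d) hF]
  have h1 : (∮ w in C(0, 2), (w ^ (n + 1))⁻¹ * w ^ d) = ∮ w in C(0, 2), (w - 0) ^ ((d : ℤ) - (n + 1)) := by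
    apply circleIntegral.integral_congr (by norm_num)
    intro w hw
    have hw0 : w ≠ 0 := by
      rintro rfl
      simp at hw
    simp only [sub_zero]
    rw [zpow_sub₀ hw0, zpow_natCast, div_eq_inv_mul]
    norm_cast
  rw [h1]
  split_ifs with h
  · subst h
    have : ∀ w : ℂ, (w - 0) ^ ((n : ℤ) - (n + 1)) = (w - 0)⁻¹ := by
      intro w
      rw [show (n : ℤ) - (n + 1) = -1 by ring, zpow_neg_one]
    simp only [this]
    rw [circleIntegral.integral_sub_center_inv _ (by norm_num)]
    have := Real.pi_ne_zero
    have : I ≠ 0 := I_ne_zero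
    field_simp
  · rw [circleIntegral.integral_sub_zpow_of_ne, mul_zero]
    omega

lemma coef_hasSum (φ : C(Circ2, ℂ)) (F : ℂ → ℂ) (hF : ∀ w : Circ2, φ w = F w)
    (hd : DifferentiableOn ℂ F (closedBall 0 2)) {z : ℂ} (hz : ‖z‖ < 2) :
    HasSum (fun n => coef n φ * z ^ n) (F z) := by
  have h1 := DifferentiableOn.hasFPowerSeriesOnBall (R := 2) (by simpa using hd) (by norm_num)
  have h2 := h1.hasSum (y := z) (by
    rw [Metric.mem_eball, edist_zero_right, enorm_eq_nnnorm]
    exact_mod_cast hz)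
  rw [zero_add] at h2
  refine hasSum_cg h2 fun n => ?_
  rw [cauchyPowerSeries_apply, coef_eq n φ F hF, smul_eq_mul, mul_assoc]
  congr 1
  rw [mul_comm, ← smul_eq_mul, ← circleIntegral.integral_smul]
  apply circleIntegral.integral_congr (by norm_num)
  intro w hw
  simp only [sub_zero, smul_eq_mul]
  rw [div_pow, pow_succ, mul_inv]
  ring

/-- multiplication operator -/
noncomputable def opM : C(Circ2, ℂ) →L[ℂ] (BS →L[ℂ] BS) := ∑' n, (coef n).smulRight (bsS ^ n)

lemma bsS_pow_norm (n : ℕ) : ‖bsS ^ n‖ ≤ 1 := by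
  induction n with
  | zero => rw [pow_zero]; exact ContinuousLinearMap.norm_id_le
  | succ n ih =>
    rw [pow_succ]
    exact (norm_mul_le _ _).trans (mul_le_one₀ ih (norm_nonneg _) bsS_norm)

lemma bsB_pow_norm (n : ℕ) : ‖bsB ^ n‖ ≤ 1 := by
  induction n with
  | zero => rw [pow_zero]; exact ContinuousLinearMap.norm_id_le
  | succ n ih =>
    rw [pow_succ]
    exact (norm_mul_le _ _).trans (mul_le_one₀ ih (norm_nonneg _) bsB_norm)

lemma opM_bound (n : ℕ) : ‖((coef n).smulRight (bsS ^ n) : C(Circ2, ℂ) →L[ℂ] (BS →L[ℂ] BS))‖ ≤ (1 / 2 : ℝ) ^ n := by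
  rw [ContinuousLinearMap.norm_smulRight_apply]
  calc _ ≤ (1/2:ℝ)^n * 1 := by
          gcongr
          · exact coef_norm n
          · exact bsS_pow_norm n
    _ = _ := mul_one _

lemma opM_norm : ‖opM‖ ≤ 2 :=
  tsum_of_norm_bounded (E := C(Circ2, ℂ) →L[ℂ] (BS →L[ℂ] BS)) hasSum_geometric_two opM_bound

lemma opM_hasSum (φ : C(Circ2, ℂ)) : HasSum (fun n => coef n φ • bsS ^ n) (opM φ) := by
  have h := (Summable.of_norm_bounded (E := C(Circ2, ℂ) →L[ℂ] (BS →L[ℂ] BS)) summable_geometric_two opM_bound).hasSum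
  exact h.mapL (ContinuousLinearMap.apply ℂ _ φ)

lemma opM_pow (d : ℕ) (φ : C(Circ2, ℂ)) (hF : ∀ w : Circ2, φ w = (w : ℂ) ^ d) :
    opM φ = bsS ^ d := by
  refine (opM_hasSum φ).unique ?_
  have := hasSum_ite_eq d (bsS ^ d)
  refine hasSum_cg' this fun n => ?_
  rw [coef_pow n d φ hF]
  split_ifs with h <;> simp [h]

lemma opM_ev (φ : C(Circ2, ℂ)) (F : ℂ → ℂ) (hF : ∀ w : Circ2, φ w = F w)
    (hd : DifferentiableOn ℂ F (closedBall 0 2)) {z : ℂ} (hz : ‖z‖ < 1) (b : BS) :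
    bsEv z (opM φ b) = F z * bsEv z b := by
  have h1 := ((opM_hasSum φ).mapL (ContinuousLinearMap.apply ℂ BS b)).mapL (bsEv z)
  have h2 := (coef_hasSum φ F hF hd (hz.trans (by norm_num))).mul_right (bsEv z b)
  refine h1.unique ?_
  refine hasSum_cg h2 fun n => ?_
  simp only [ContinuousLinearMap.apply_apply, map_smul,
    bsEv_S_pow hz, smul_eq_mul]
  ring

/-- The sequence `1, 0, 0, …`. -/
noncomputable def bsOne : BS := BS.mk (fun n => if n = 0 then 1 else 0) 1 (by intro n; split_ifs <;> simp)

lemma bsEv_one {z : ℂ} (hz : ‖z‖ < 1) : bsEv z bsOne = 1 := by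
  refine (bsEv_hasSum hz bsOne).unique ?_
  have := hasSum_ite_eq 0 (1 : ℂ)
  refine hasSum_cg this fun n => ?_
  change z ^ n * (if n = 0 then 1 else 0) = _
  split_ifs with h <;> simp [h]

lemma bsOne_norm : ‖bsOne‖ ≤ 1 := by
  refine BS.norm_le zero_le_one ?_
  intro n
  change ‖if n = 0 then (1:ℂ) else 0‖ ≤ 1
  split_ifs <;> simp

end Shift

end PartA1

section PartA2
open Complex Metric Filter Topology

section WD
variable {E : Type*} [NormedAddCommGroup E] [NormedSpace ℂ E]

lemma analyticAt_clm_apply' {F₁ F₂ : Type*} [NormedAddCommGroup F₁] [NormedSpace ℂ F₁]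
    [NormedAddCommGroup F₂] [NormedSpace ℂ F₂] {T : E → F₁ →L[ℂ] F₂} {b : E → F₁} {x : E}
    (hT : AnalyticAt ℂ T x) (hb : AnalyticAt ℂ b x) : AnalyticAt ℂ (fun y => T y (b y)) x :=
  AnalyticAt.comp (g := fun p : (F₁ →L[ℂ] F₂) × F₁ => p.1 p.2) (f := fun y => (T y, b y))
    ((ContinuousLinearMap.id ℂ (F₁ →L[ℂ] F₂)).analyticAt_bilinear (T x, b x)) (hT.prod hb)

/-- constants as a linear map -/
noncomputable def constL : E →L[ℂ] C(Circ2, E × ℂ) :=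
  LinearMap.mkContinuous
    { toFun := fun z => ⟨fun _ => (z, 0), by fun_prop⟩
      map_add' := by intro a b; ext <;> simp
      map_smul' := by intro a b; ext <;> simp } 1 (by
        intro z
        rw [one_mul, ContinuousMap.norm_le _ (norm_nonneg _)]
        intro w
        simp)

noncomputable def circL (t : ℂ) : C(Circ2, E × ℂ) := ⟨fun w => (0, t * w), by fun_prop⟩

lemma curry_analytic {g : E × ℂ → ℂ} (hg : AnalyticAt ℂ g 0) :
    ∃ r > 0, ∀ t : ℂ, ‖t‖ < r → ∃ c : E → C(Circ2, ℂ), AnalyticAt ℂ c 0 ∧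
      (∀ᶠ z in 𝓝 (0:E), (∀ w : Circ2, c z w = g (z, t * w)) ∧
        DifferentiableOn ℂ (fun w => g (z, t * w)) (closedBall 0 2)) ∧
      (∀ w : Circ2, c 0 w = g (0, t * w)) := by
  obtain ⟨r, hr, N, hN⟩ := exists_superposition (K := Circ2) hg
  obtain ⟨r2, hr2, hball⟩ := Metric.eventually_nhds_iff.1 hg.eventually_analyticAt
  refine ⟨min (r / 4) (r2 / 4), by positivity, fun t ht => ?_⟩
  have ht1 : ‖t‖ < r / 4 := ht.trans_le (min_le_left _ _)
  have ht2 : ‖t‖ < r2 / 4 := ht.trans_le (min_le_right _ _)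
  have hcirc : ‖(circL t : C(Circ2, E × ℂ))‖ < r := by
    have : ‖(circL t : C(Circ2, E × ℂ))‖ ≤ 2 * ‖t‖ := by
      rw [ContinuousMap.norm_le _ (by positivity)]
      intro w
      have hw : ‖(w : ℂ)‖ = 2 := by simp
      change ‖((0 : E), t * (w : ℂ))‖ ≤ _
      rw [Prod.norm_mk, norm_zero, norm_mul, hw, max_eq_right (by positivity)]
      linarith
    linarith [norm_nonneg t]
  have key : ∀ z : E, ‖circL t + constL z‖ < r → ∀ w : Circ2,
      N (circL t + constL z) w = g (z, t * w) := by
    intro z hz w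
    rw [(hN _ hz).2 w]
    congr 1
    change ((0 : E), t * (w : ℂ)) + (z, 0) = _
    simp
  refine ⟨fun z => N (circL t + constL z), ?_, ?_, ?_⟩
  · refine AnalyticAt.fun_comp (g := N) ?_ ?_
    · rw [map_zero, add_zero]
      exact (hN _ hcirc).1
    · exact analyticAt_const.add ((constL (E := E)).analyticAt 0)
  · have h1 : ∀ᶠ z in 𝓝 (0:E), ‖circL t + constL z‖ < r := by
      have : Continuous fun z : E => ‖circL t + constL z‖ := by fun_prop
      apply this.continuousAt.eventually_lt continuousAt_const
      simpa using hcirc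
    have h2 : ∀ᶠ z in 𝓝 (0:E), ‖z‖ < r2 := by
      have := Metric.ball_mem_nhds (0:E) hr2
      filter_upwards [this] with z hz
      simpa using hz
    filter_upwards [h1, h2] with z hz hz2
    refine ⟨key z hz, ?_⟩
    intro w hw
    have hw' : ‖w‖ ≤ 2 := by simpa using hw
    apply DifferentiableAt.differentiableWithinAt
    have h3 : AnalyticAt ℂ g (z, t * w) := by
      apply hball
      rw [dist_zero_right, Prod.norm_mk, norm_mul]
      refine max_lt hz2 ?_
      nlinarith [norm_nonneg t, norm_nonneg w]
    exact DifferentiableAt.comp (g := g) w h3.differentiableAt (by fun_prop)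
  · intro w
    exact key 0 (by simpa using hcirc) w

lemma wd_low (d : ℕ) (b : BS) {z : ℂ} (hz : ‖z‖ < 1) :
    bsEv z (b - (bsS ^ d) ((bsB ^ d) b)) = ∑ j : Fin d, b j * z ^ (j : ℕ) := by
  have h1 := bsEv_hasSum hz (b - (bsS ^ d) ((bsB ^ d) b))
  rw [Fin.sum_univ_eq_sum_range (fun j => b j * z ^ j)]
  refine h1.unique ?_
  have h2 : ∀ n ∉ Finset.range d, z ^ n * (b - (bsS ^ d) ((bsB ^ d) b)) n = 0 := by
    intro n hn
    obtain ⟨m, rfl⟩ : ∃ m, n = m + d := ⟨n - d, by simp at hn; omega⟩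
    rw [BS.sub_apply', bsS_pow_apply_ge, bsB_pow_apply, sub_self, mul_zero]
  have h3 := hasSum_sum_of_ne_finset_zero (L := .unconditional ℕ) h2
  convert h3 using 1
  apply Finset.sum_congr rfl
  intro n hn
  rw [BS.sub_apply', bsS_pow_apply_lt _ _ _ (by simpa using hn)]
  ring

lemma bs_pow_one (d : ℕ) (b : BS) : ‖(bsS ^ d) b‖ ≤ ‖b‖ := by
  have := (bsS ^ d).le_opNorm b
  have h2 := bsS_pow_norm d
  nlinarith [norm_nonneg b]

theorem weierstrass_division (G : E × ℂ → ℂ) (hG : AnalyticAt ℂ G 0)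
    (hG0 : ¬ ∀ᶠ z in 𝓝 (0:ℂ), G (0, z) = 0) :
    ∃ d : ℕ, ∀ h : E × ℂ → ℂ, AnalyticAt ℂ h 0 →
      ∃ q : E × ℂ → ℂ, AnalyticAt ℂ q 0 ∧ ∃ r : Fin d → E → ℂ, (∀ j, AnalyticAt ℂ (r j) 0) ∧
        (∀ᶠ x in 𝓝 (0 : E × ℂ), h x = q x * G x + ∑ j, r j x.1 * x.2 ^ (j : ℕ)) ∧
        ((h = fun x => x.2 ^ d) → q 0 ≠ 0) := by
  have hG1 : AnalyticAt ℂ (fun z : ℂ => G (0, z)) 0 :=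
    AnalyticAt.fun_comp (g := G) hG (by fun_prop)
  obtain ⟨d, u, hu, hu0, hGu⟩ := (hG1.exists_eventuallyEq_pow_smul_nonzero_iff).2 hG0
  refine ⟨d, fun h hh => ?_⟩
  obtain ⟨r1, hr1, H1⟩ := curry_analytic hG
  obtain ⟨r2, hr2, H2⟩ := curry_analytic hh
  -- closeness of u
  have hclose : ∀ᶠ z in 𝓝 (0:ℂ), ‖u z / u 0 - 1‖ < 1 / (16 * 2 ^ d) ∧ G (0, z) = z ^ d * u z := by
    have h1 : Tendsto (fun z => ‖u z / u 0 - 1‖) (𝓝 0) (𝓝 0) := by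
      have : ContinuousAt (fun z => ‖u z / u 0 - 1‖) 0 :=
        ((hu.continuousAt.div_const _).sub continuousAt_const).norm
      simpa [ContinuousAt, div_self hu0] using this
    filter_upwards [h1.eventually_lt_const (show (0:ℝ) < 1 / (16 * 2 ^ d) by positivity), hGu]
      with z hz hz2
    refine ⟨hz, ?_⟩
    simpa using hz2
  obtain ⟨r3, hr3, H3⟩ := Metric.eventually_nhds_iff.1 hclose
  obtain ⟨t, ht0, ht⟩ : ∃ t : ℝ, 0 < t ∧ t < min r1 (min r2 (r3 / 2)) :=
    exists_between (by positivity)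
  have htn : ‖(t : ℂ)‖ = t := by rw [Complex.norm_real, Real.norm_of_nonneg ht0.le]
  have htc : (t : ℂ) ≠ 0 := by exact_mod_cast ht0.ne'
  obtain ⟨cG, hcG, hcGe, hcG0⟩ := H1 t (by rw [htn]; exact ht.trans_le (min_le_left _ _))
  obtain ⟨ch, hch, hche, hch0⟩ := H2 t (by
    rw [htn]; exact ht.trans_le ((min_le_right _ _).trans (min_le_left _ _)))
  have ht3 : 2 * t < r3 := by
    have := ht.trans_le ((min_le_right _ _).trans (min_le_right _ _))
    linarith
  set κ : ℂ := ((t : ℂ) ^ d * u 0)⁻¹ with hκ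
  have hκ0 : κ ≠ 0 := inv_ne_zero (mul_ne_zero (pow_ne_zero _ htc) hu0)
  let wd : C(Circ2, ℂ) := ⟨fun w => (w : ℂ) ^ d, by fun_prop⟩
  let M : E → (BS →L[ℂ] BS) := fun z => opM (κ • cG z)
  let P : BS →L[ℂ] BS := (bsS ^ d) * (bsB ^ d)
  let L : E → (BS →L[ℂ] BS) := fun z => M z * bsB ^ d + (1 - P)
  have hMan : AnalyticAt ℂ M 0 := (opM.analyticAt _).comp (hcG.const_smul (c := κ))
  have hLan : AnalyticAt ℂ L 0 := (hMan.mul analyticAt_const).add analyticAt_const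
  let T : BS →L[ℂ] BS := (M 0 - bsS ^ d) * bsB ^ d
  have hL0 : L 0 = 1 - (-T) := by
    simp only [L, T, P, sub_mul]
    abel
  have hT : ‖T‖ ≤ 1 / 4 := by
    have h1 : M 0 - bsS ^ d = opM (κ • cG 0 - wd) := by
      rw [map_sub, opM_pow d wd (fun w => rfl)]
    have h2 : ‖κ • cG 0 - wd‖ ≤ 1 / 16 := by
      rw [ContinuousMap.norm_le _ (by norm_num)]
      intro w
      have hw : ‖(w : ℂ)‖ = 2 := by simp
      obtain ⟨h3, h4⟩ := H3 (y := t * w) (by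
        rw [dist_zero_right, norm_mul, htn, hw]; linarith)
      have h5 : (κ • cG 0 - wd) w = (w:ℂ) ^ d * (u (t * w) / u 0 - 1) := by
        change κ * cG 0 w - (w : ℂ) ^ d = _
        rw [hcG0, h4, hκ, mul_pow]
        field_simp
      rw [h5, norm_mul, norm_pow, hw]
      calc (2:ℝ) ^ d * ‖u (t * w) / u 0 - 1‖ ≤ 2 ^ d * (1 / (16 * 2 ^ d)) := by gcongr
        _ = 1 / 16 := by field_simp
    calc ‖T‖ ≤ ‖M 0 - bsS ^ d‖ * ‖bsB ^ d‖ := norm_mul_le _ _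
      _ ≤ (2 * (1 / 16)) * 1 := by
          gcongr
          · rw [h1]
            exact (opM.le_opNorm _).trans (by gcongr; exact opM_norm)
          · exact bsB_pow_norm d
      _ ≤ 1 / 4 := by norm_num
  have hT1 : ‖-T‖ < 1 := by rw [norm_neg]; linarith
  have hLunit : IsUnit (L 0) := by
    rw [hL0]; exact isUnit_one_sub_of_norm_lt_one hT1
  let b : E → BS := fun z => Ring.inverse (L z) (opM (ch z) bsOne)
  have hinvan : AnalyticAt ℂ (fun z => Ring.inverse (L z)) 0 := by
    refine AnalyticAt.fun_comp (g := Ring.inverse) ?_ hLan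
    have := analyticAt_inverse (𝕜 := ℂ) (A := BS →L[ℂ] BS) hLunit.unit
    simpa using this
  have hban : AnalyticAt ℂ b 0 :=
    analyticAt_clm_apply' hinvan (analyticAt_clm_apply' ((opM.analyticAt _).comp hch) analyticAt_const)
  have hLunit' : ∀ᶠ z in 𝓝 (0:E), IsUnit (L z) := by
    have : ∀ᶠ y in 𝓝 (L 0), IsUnit y := Units.isOpen.mem_nhds hLunit
    exact hLan.continuousAt.eventually this
  have hLb : ∀ z, IsUnit (L z) → L z (b z) = opM (ch z) bsOne := by
    intro z hz
    have := Ring.mul_inverse_cancel _ hz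
    change (L z * Ring.inverse (L z)) (opM (ch z) bsOne) = _
    rw [this]; rfl
  refine ⟨fun x => κ * bsEv (x.2 / t) ((bsB ^ d) (b x.1)), ?_, fun j z => b z j / t ^ (j:ℕ), ?_, ?_, ?_⟩
  · refine analyticAt_const.mul ?_
    have hb1 : AnalyticAt ℂ (fun x : E × ℂ => b x.1) 0 :=
      AnalyticAt.fun_comp (g := b) hban (analyticAt_fst (𝕜 := ℂ) (p := (0 : E × ℂ)))
    have hb2 : AnalyticAt ℂ (fun x : E × ℂ => bsEv (x.2 / t)) 0 := by
      refine AnalyticAt.fun_comp (g := bsEv) ?_ ?_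
      · simpa using bsEv_analytic
      · exact (analyticAt_snd (𝕜 := ℂ) (p := (0 : E × ℂ))).div analyticAt_const htc
    exact analyticAt_clm_apply' hb2 (((bsB ^ d).analyticAt _).comp hb1)
  · intro j
    exact (((bsC j).analyticAt _).comp hban).div analyticAt_const (pow_ne_zero _ htc)
  · have e1 : ∀ᶠ x : E × ℂ in 𝓝 0, IsUnit (L x.1) ∧ ((∀ w : Circ2, cG x.1 w = G (x.1, t * w)) ∧
        DifferentiableOn ℂ (fun w => G (x.1, t * w)) (closedBall 0 2)) ∧
        ((∀ w : Circ2, ch x.1 w = h (x.1, t * w)) ∧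
        DifferentiableOn ℂ (fun w => h (x.1, t * w)) (closedBall 0 2)) := by
      have : Tendsto (fun x : E × ℂ => x.1) (𝓝 0) (𝓝 0) := continuous_fst.tendsto' _ _ rfl
      exact this.eventually (hLunit'.and (hcGe.and hche))
    have e2 : ∀ᶠ x : E × ℂ in 𝓝 0, ‖x.2 / t‖ < 1 := by
      have : Continuous fun x : E × ℂ => ‖x.2 / t‖ := by fun_prop
      apply this.continuousAt.eventually_lt continuousAt_const
      simp
    filter_upwards [e1, e2] with x ⟨hx1, ⟨hx2, hx3⟩, hx4, hx5⟩ hz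
    have hxt : (t : ℂ) * (x.2 / t) = x.2 := by field_simp
    have h1 := opM_ev (ch x.1) (fun w => h (x.1, t * w)) hx4 hx5 hz bsOne
    have h2 := opM_ev (κ • cG x.1) (fun w => κ * G (x.1, t * w))
      (by intro w; rw [← hx2]; rfl) (hx3.const_mul κ) hz ((bsB ^ d) (b x.1))
    have h3 := wd_low d (b x.1) hz
    simp only [hxt, bsEv_one hz, mul_one] at h1 h2
    rw [← hLb _ hx1] at h1
    have h4 : L x.1 (b x.1) = M x.1 ((bsB ^ d) (b x.1)) + (b x.1 - (bsS ^ d) ((bsB ^ d) (b x.1))) := rfl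
    rw [h4, map_add, h3, h2] at h1
    rw [← Prod.mk.eta (p := x), ← h1]
    simp only
    congr 1
    · ring
    · apply Finset.sum_congr rfl
      intro j _
      rw [div_pow]; ring
  · intro hhd
    simp only [Prod.snd_zero, zero_div, Prod.fst_zero]
    refine mul_ne_zero hκ0 ?_
    have h1 : opM (ch 0) bsOne = (t : ℂ) ^ d • (bsS ^ d) bsOne := by
      have : ch 0 = (t : ℂ) ^ d • wd := by
        ext w
        rw [hch0, hhd]
        change (t * (w : ℂ)) ^ d = (t : ℂ) ^ d * (w : ℂ) ^ d
        rw [mul_pow]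
      rw [this, map_smul, opM_pow d wd (fun w => rfl)]; rfl
    have h2 := hLb 0 hLunit
    rw [hL0, h1] at h2
    have h3 : b 0 = (t : ℂ) ^ d • (bsS ^ d) bsOne - T (b 0) := by
      rw [← h2]
      simp
    have h4 : ‖(bsS ^ d) bsOne‖ ≤ 1 := (bs_pow_one d bsOne).trans bsOne_norm
    have h5 : ‖T (b 0)‖ ≤ 1 / 4 * ‖b 0‖ := (T.le_opNorm _).trans (by gcongr)
    have h6 : ‖b 0‖ ≤ t ^ d + 1 / 4 * ‖b 0‖ := by
      calc ‖b 0‖ = ‖(t : ℂ) ^ d • (bsS ^ d) bsOne - T (b 0)‖ := by rw [← h3]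
        _ ≤ ‖(t : ℂ) ^ d • (bsS ^ d) bsOne‖ + ‖T (b 0)‖ := norm_sub_le _ _
        _ ≤ t ^ d + 1 / 4 * ‖b 0‖ := by
          gcongr
          rw [norm_smul, norm_pow, htn]
          exact mul_le_of_le_one_right (by positivity) h4
    have h7 : bsEv 0 ((bsB ^ d) (b 0)) = b 0 d := by
      have := bsEv_hasSum (z := 0) (by simp) ((bsB ^ d) (b 0))
      refine this.unique ?_
      have h8 := hasSum_ite_eq 0 (b 0 d)
      refine hasSum_cg h8 fun n => ?_
      split_ifs with hn
      · subst hn; rw [bsB_pow_apply, zero_add, pow_zero, one_mul]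
      · simp [hn]
    rw [h7]
    intro h8
    have h9 : b 0 d = t ^ d - (T (b 0)) d := by
      conv_lhs => rw [h3]
      rw [BS.sub_apply', BS.smul_apply']
      have := bsS_pow_apply_ge d bsOne 0
      rw [zero_add] at this
      rw [this]
      change (t : ℂ) ^ d * (if 0 = 0 then 1 else 0) - _ = _
      simp
    rw [h8] at h9
    have h10 : ‖(T (b 0)) d‖ = t ^ d := by
      rw [← sub_eq_zero.1 h9.symm, norm_pow, htn]
    have h11 := (T (b 0)).norm_coe_le d
    have h12 : 0 < t ^ d := by positivity
    linarith

end WD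

end PartA2

section PartA3
open Complex Metric Filter Topology Polynomial

section DerAlg
variable {K : Type*} [Field K]

/-- `D` restricts to a derivation of the subfield `F`. -/
structure IsDer (F : Subfield K) (D : K → K) : Prop where
  mem : ∀ x ∈ F, D x ∈ F
  add : ∀ x ∈ F, ∀ y ∈ F, D (x + y) = D x + D y
  mul : ∀ x ∈ F, ∀ y ∈ F, D (x * y) = x * D y + y * D x

namespace IsDer
variable {F : Subfield K} {D : K → K}

lemma zero (h : IsDer F D) : D 0 = 0 := by
  have := h.add 0 F.zero_mem 0 F.zero_mem
  simpa using this

lemma one (h : IsDer F D) : D 1 = 0 := by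
  have := h.mul 1 F.one_mem 1 F.one_mem
  simpa using this

lemma sum (h : IsDer F D) {α : Type*} (s : Finset α) (f : α → K) (hf : ∀ a ∈ s, f a ∈ F) :
    D (∑ a ∈ s, f a) = ∑ a ∈ s, D (f a) := by
  classical
  induction s using Finset.induction_on with
  | empty => simpa using h.zero
  | insert a s ha ih =>
    rw [Finset.sum_insert ha, Finset.sum_insert ha, h.add _ (hf a (by simp)) _
      (F.sum_mem fun b hb => hf b (by simp [hb])), ih fun b hb => hf b (by simp [hb])]

lemma pow (h : IsDer F D) {x : K} (hx : x ∈ F) (n : ℕ) : D (x ^ n) = n * x ^ (n - 1) * D x := by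
  induction n with
  | zero => simpa using h.one
  | succ n ih =>
    rw [pow_succ, h.mul _ (F.pow_mem hx n) _ hx, ih]
    cases n with
    | zero => simp
    | succ n => push_cast; ring

end IsDer

/-- extension from a subring to its field of fractions -/
lemma exists_isDer_closure (A : Subring K) (D₀ : K → K)
    (hmem : ∀ x ∈ A, D₀ x ∈ Subfield.closure (A : Set K))
    (hadd : ∀ x ∈ A, ∀ y ∈ A, D₀ (x + y) = D₀ x + D₀ y)
    (hmul : ∀ x ∈ A, ∀ y ∈ A, D₀ (x * y) = x * D₀ y + y * D₀ x) :
    ∃ D : K → K, IsDer (Subfield.closure (A : Set K)) D ∧ ∀ x ∈ A, D x = D₀ x := by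
  classical
  have hrep : ∀ x ∈ Subfield.closure (A : Set K), ∃ y ∈ A, ∃ z ∈ A, z ≠ 0 ∧ y = x * z := by
    intro x hx
    rw [Subfield.mem_closure_iff, Subring.closure_eq] at hx
    obtain ⟨y, hy, z, hz, rfl⟩ := hx
    by_cases h0 : z = 0
    · exact ⟨0, A.zero_mem, 1, A.one_mem, one_ne_zero, by simp [h0]⟩
    · exact ⟨y, hy, z, hz, h0, by field_simp⟩
  choose! Y hY Z hZ hZ0 hYZ using hrep
  set D : K → K := fun x => (Z x * D₀ (Y x) - Y x * D₀ (Z x)) / (Z x) ^ 2 with hD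
  -- characterization
  have char : ∀ x ∈ Subfield.closure (A : Set K), ∀ y ∈ A, ∀ z ∈ A, z ≠ 0 → y = x * z →
      D x = (z * D₀ y - y * D₀ z) / z ^ 2 := by
    intro x hx y hy z hz hz0 hyz
    have e1 : y * Z x = Y x * z := by rw [hyz, hYZ x hx]; ring
    have e2 := congrArg D₀ e1
    rw [hmul _ hy _ (hZ x hx), hmul _ (hY x hx) _ hz] at e2
    have hzx := hZ0 x hx
    have hyx := hYZ x hx
    rw [hD]
    simp only
    rw [div_eq_div_iff (pow_ne_zero _ hzx) (pow_ne_zero _ hz0)]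
    subst hyz
    generalize D₀ (Y x) = a at *
    generalize D₀ (x * z) = b at *
    generalize D₀ (Z x) = c at *
    generalize D₀ z = d at *
    rw [hyx] at e2 ⊢
    linear_combination (-(Z x) * z) * e2
  have hsub : ∀ x ∈ A, x ∈ Subfield.closure (A : Set K) := fun x hx => Subfield.subset_closure hx
  have hone : D₀ 1 = 0 := by
    have := hmul 1 A.one_mem 1 A.one_mem
    simpa using this
  refine ⟨D, ⟨?_, ?_, ?_⟩, ?_⟩
  · intro x hx
    have a1 := hsub _ (hZ x hx)
    have a2 := hsub _ (hY x hx)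
    exact div_mem (sub_mem (mul_mem a1 (hmem _ (hY x hx))) (mul_mem a2 (hmem _ (hZ x hx))))
      (pow_mem a1 2)
  · intro x hx y hy
    have zx := hZ x hx
    have zy := hZ y hy
    have yx := hY x hx
    have yy := hY y hy
    rw [char (x + y) (add_mem hx hy) (Y x * Z y + Y y * Z x)
      (add_mem (mul_mem yx zy) (mul_mem yy zx)) (Z x * Z y) (mul_mem zx zy)
      (mul_ne_zero (hZ0 x hx) (hZ0 y hy)) (by rw [hYZ x hx, hYZ y hy]; ring)]
    rw [hadd _ (mul_mem yx zy) _ (mul_mem yy zx), hmul _ yx _ zy, hmul _ yy _ zx, hmul _ zx _ zy]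
    have := hZ0 x hx
    have := hZ0 y hy
    simp only [hD]
    field_simp
    ring
  · intro x hx y hy
    have zx := hZ x hx
    have zy := hZ y hy
    have yx := hY x hx
    have yy := hY y hy
    rw [char (x * y) (mul_mem hx hy) (Y x * Y y)
      (mul_mem yx yy) (Z x * Z y) (mul_mem zx zy)
      (mul_ne_zero (hZ0 x hx) (hZ0 y hy)) (by rw [hYZ x hx, hYZ y hy]; ring)]
    rw [hmul _ yx _ yy, hmul _ zx _ zy]
    have h1 := hZ0 x hx
    have h2 := hZ0 y hy
    have e1 : x = Y x / Z x := by rw [eq_div_iff h1]; exact (hYZ x hx).symm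
    have e2 : y = Y y / Z y := by rw [eq_div_iff h2]; exact (hYZ y hy).symm
    simp only [hD]
    conv_rhs => rw [show x * ((Z y * D₀ (Y y) - Y y * D₀ (Z y)) / Z y ^ 2) +
      y * ((Z x * D₀ (Y x) - Y x * D₀ (Z x)) / Z x ^ 2) = Y x / Z x * ((Z y * D₀ (Y y) - Y y * D₀ (Z y)) / Z y ^ 2) +
      Y y / Z y * ((Z x * D₀ (Y x) - Y x * D₀ (Z x)) / Z x ^ 2) by rw [← e1, ← e2]]
    field_simp
    ring
  · intro x hx
    rw [char x (hsub x hx) x hx 1 A.one_mem one_ne_zero (by simp), hone]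
    simp

/-- extension to a simple algebraic extension -/
lemma exists_isDer_adjoin [CharZero K] (F : Subfield K) (D : K → K) (hD : IsDer F D) (y : K)
    (hy : IsIntegral F y) :
    ∃ D₂ : K → K, IsDer (IntermediateField.adjoin F {y}).toSubfield D₂ ∧ ∀ x ∈ F, D₂ x = D x := by
  classical
  let d : Derivation ℤ F F := Derivation.mk'
    (AddMonoidHom.toIntLinearMap
      { toFun := fun x : F => (⟨D x, hD.mem _ x.2⟩ : F)
        map_zero' := by ext; exact hD.zero
        map_add' := by intro a b; ext; exact hD.add _ a.2 _ b.2 })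
    (by
      intro a b
      ext
      exact hD.mul _ a.2 _ b.2)
  letI : Differential F := ⟨d⟩
  haveI : FiniteDimensional F (IntermediateField.adjoin F {y}) :=
    IntermediateField.adjoin.finiteDimensional hy
  haveI : CharZero F := inferInstance
  letI i2 : Differential (IntermediateField.adjoin F {y}) :=
    Differential.differentialFiniteDimensional F _
  haveI i3 : DifferentialAlgebra F (IntermediateField.adjoin F {y}) :=
    Differential.differentialAlgebraFiniteDimensional
  let d2 : Derivation ℤ (IntermediateField.adjoin F {y}) (IntermediateField.adjoin F {y}) :=
    Differential.deriv
  refine ⟨fun x => if hx : x ∈ IntermediateField.adjoin F {y} then (d2 ⟨x, hx⟩ : K) else 0,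
    ⟨?_, ?_, ?_⟩, ?_⟩
  · intro x hx
    have hx' : x ∈ IntermediateField.adjoin F {y} := hx
    simp only [hx', dif_pos]
    exact (d2 ⟨x, hx'⟩).2
  · intro x hx z hz
    have hx' : x ∈ IntermediateField.adjoin F {y} := hx
    have hz' : z ∈ IntermediateField.adjoin F {y} := hz
    have hxz : x + z ∈ IntermediateField.adjoin F {y} := add_mem hx' hz'
    simp only [hx', hz', hxz, dif_pos]
    have := d2.map_add ⟨x, hx'⟩ ⟨z, hz'⟩
    exact congrArg Subtype.val this
  · intro x hx z hz
    have hx' : x ∈ IntermediateField.adjoin F {y} := hx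
    have hz' : z ∈ IntermediateField.adjoin F {y} := hz
    have hxz : x * z ∈ IntermediateField.adjoin F {y} := mul_mem hx' hz'
    simp only [hx', hz', hxz, dif_pos]
    have := d2.leibniz ⟨x, hx'⟩ ⟨z, hz'⟩
    exact congrArg Subtype.val this
  · intro x hx
    have hx' : x ∈ IntermediateField.adjoin F {y} :=
      (IntermediateField.adjoin F {y}).algebraMap_mem ⟨x, hx⟩
    simp only [hx', dif_pos]
    have := DifferentialAlgebra.deriv_algebraMap (B := IntermediateField.adjoin F {y}) (⟨x, hx⟩ : F)
    exact congrArg Subtype.val this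

/-- constants descend to coefficients of minimal polynomials -/
lemma isDer_minpoly_coeff (F' F : Subfield K) (hFF : F' ≤ F) (D' D : K → K) (hD' : IsDer F' D')
    (hD : IsDer F D) (hDD : ∀ x ∈ F', D x = D' x) (x : K) (hx : x ∈ F) (hIntg : IsIntegral F' x)
    (hDx : D x = 0) (i : ℕ) : D' ((minpoly F' x).coeff i : K) = 0 := by
  classical
  set p := minpoly F' x with hp
  have hmonic : p.Monic := minpoly.monic hIntg
  have h0 : ∑ i ∈ Finset.range (p.natDegree + 1), ((p.coeff i : F') : K) * x ^ i = 0 := by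
    have := minpoly.aeval F' x
    rw [Polynomial.aeval_eq_sum_range] at this
    exact this
  have hc : ∀ i, ((p.coeff i : F') : K) ∈ F := fun i => hFF (p.coeff i).2
  have h1 := congrArg D h0
  rw [hD.zero, hD.sum _ _ (fun i _ => mul_mem (hc i) (pow_mem hx i))] at h1
  have h2 : ∀ i, D (((p.coeff i : F') : K) * x ^ i) = D' (p.coeff i : K) * x ^ i := by
    intro i
    rw [hD.mul _ (hc i) _ (pow_mem hx i), hD.pow hx, hDx, hDD _ (p.coeff i).2]
    ring
  simp only [h2] at h1
  rw [Finset.sum_range_succ, hmonic.coeff_natDegree] at h1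
  have h3 : D' ((1 : F') : K) = 0 := hD'.one
  rw [h3, zero_mul, add_zero] at h1
  let q : F'[X] := ∑ i ∈ Finset.range p.natDegree, Polynomial.monomial i (⟨D' (p.coeff i : K), hD'.mem _ (p.coeff i).2⟩ : F')
  have hq : Polynomial.aeval x q = 0 := by
    simp only [q, map_sum, Polynomial.aeval_monomial]
    exact h1
  have hq0 : q = 0 := by
    by_contra hne
    have hle := minpoly.degree_le_of_ne_zero F' x hne hq
    have hlt : q.degree < p.degree := by
      rw [Polynomial.degree_eq_natDegree hmonic.ne_zero]
      refine (Polynomial.degree_sum_le _ _).trans_lt ?_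
      rw [Finset.sup_lt_iff (by exact WithBot.bot_lt_coe _)]
      intro j hj
      refine (Polynomial.degree_monomial_le _ _).trans_lt ?_
      exact_mod_cast Finset.mem_range.1 hj
    exact absurd hle (not_le.2 hlt)
  by_cases hi : i < p.natDegree
  · have := congrArg (fun r => ((r.coeff i : F') : K)) hq0
    simpa [q, Polynomial.finsetSum_coeff, Polynomial.coeff_monomial, hi] using this
  · by_cases hi2 : i = p.natDegree
    · rw [hi2, hmonic.coeff_natDegree]; exact h3
    · rw [Polynomial.coeff_eq_zero_of_natDegree_lt (by omega)]
      exact hD'.zero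

lemma root_mem_range {k : Type*} [Field k] [IsAlgClosed k] (φ : k →+* K) (P : k[X]) (hP : P ≠ 0)
    (x : K) (hx : P.eval₂ φ x = 0) : ∃ c, x = φ c := by
  have hs := IsAlgClosed.splits P
  have h1 := hs.eq_prod_roots
  rw [h1, Polynomial.eval₂_mul, Polynomial.eval₂_C, Polynomial.eval₂_multiset_prod] at hx
  have h2 : φ P.leadingCoeff ≠ 0 := by
    rw [_root_.map_ne_zero]; exact Polynomial.leadingCoeff_ne_zero.2 hP
  have h3 := (mul_eq_zero.1 hx).resolve_left h2
  rw [Multiset.prod_eq_zero_iff, Multiset.map_map, Multiset.mem_map] at h3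
  obtain ⟨c, -, hc⟩ := h3
  simp only [Function.comp_apply, Polynomial.eval₂_sub, Polynomial.eval₂_X, Polynomial.eval₂_C] at hc
  exact ⟨c, sub_eq_zero.1 hc⟩

end DerAlg

end PartA3

section PartA4
open Complex Metric Filter Topology Polynomial

section Germs
variable {ι : Type} (𝒰 : Ultrafilter ι)

/-- germs along an ultrafilter -/
def GK : Type := Germ (𝒰 : Filter ι) ℂ

noncomputable instance : Field (GK 𝒰) := inferInstanceAs (Field (Germ (𝒰 : Filter ι) ℂ))

/-- the class of a function -/
noncomputable def gm : (ι → ℂ) →+* GK 𝒰 := Germ.coeRingHom (𝒰 : Filter ι)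

lemma gm_eq {u v : ι → ℂ} : gm 𝒰 u = gm 𝒰 v ↔ u =ᶠ[(𝒰 : Filter ι)] v := Germ.coe_eq

lemma gm_eq_zero {u : ι → ℂ} : gm 𝒰 u = 0 ↔ ∀ᶠ i in (𝒰 : Filter ι), u i = 0 := by
  rw [← map_zero (gm 𝒰), gm_eq]; rfl

/-- constants -/
noncomputable def gc : ℂ →+* GK 𝒰 := (gm 𝒰).comp (Pi.constRingHom ι ℂ)

instance : CharZero (GK 𝒰) := charZero_of_injective_ringHom (gc 𝒰).injective

variable {E : Type} [NormedAddCommGroup E] [NormedSpace ℂ E]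

/-- germs of analytic functions composed with `ζ` -/
noncomputable def Ag (ζ : ι → E) : Subring (GK 𝒰) where
  carrier := {x | ∃ g : E → ℂ, AnalyticAt ℂ g 0 ∧ x = gm 𝒰 (fun i => g (ζ i))}
  mul_mem' := by
    rintro _ _ ⟨g, hg, rfl⟩ ⟨h, hh, rfl⟩
    exact ⟨fun z => g z * h z, hg.mul hh, (map_mul (gm 𝒰) _ _).symm⟩
  add_mem' := by
    rintro _ _ ⟨g, hg, rfl⟩ ⟨h, hh, rfl⟩
    exact ⟨fun z => g z + h z, hg.add hh, (map_add (gm 𝒰) _ _).symm⟩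
  zero_mem' := ⟨fun _ => 0, analyticAt_const, (map_zero (gm 𝒰)).symm⟩
  one_mem' := ⟨fun _ => 1, analyticAt_const, (map_one (gm 𝒰)).symm⟩
  neg_mem' := by
    rintro _ ⟨g, hg, rfl⟩
    exact ⟨fun z => - g z, hg.neg, (map_neg (gm 𝒰) _).symm⟩

/-- the field of fractions -/
noncomputable def Fg (ζ : ι → E) : Subfield (GK 𝒰) := Subfield.closure (Ag 𝒰 ζ : Set (GK 𝒰))

lemma mem_Fg (ζ : ι → E) {g : E → ℂ} (hg : AnalyticAt ℂ g 0) : gm 𝒰 (fun i => g (ζ i)) ∈ Fg 𝒰 ζ :=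
  Subfield.subset_closure ⟨g, hg, rfl⟩

/-- formal directional derivative -/
noncomputable def Ed (ζ : ι → E) {s : ℕ} (b : Fin s → E) (a : Fin s → GK 𝒰) (g : E → ℂ) : GK 𝒰 :=
  ∑ k, gm 𝒰 (fun i => fderiv ℂ g (ζ i) (b k)) * a k

/-- analytic derivations -/
def AnDer (ζ : ι → E) (D : GK 𝒰 → GK 𝒰) : Prop :=
  IsDer (Fg 𝒰 ζ) D ∧ ∃ (s : ℕ) (b : Fin s → E) (a : Fin s → GK 𝒰), (∀ k, a k ∈ Fg 𝒰 ζ) ∧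
    ∀ g : E → ℂ, AnalyticAt ℂ g 0 → D (gm 𝒰 (fun i => g (ζ i))) = Ed 𝒰 ζ b a g

lemma fderiv_dir_analytic {g : E → ℂ} (hg : AnalyticAt ℂ g 0) (v : E) :
    AnalyticAt ℂ (fun z => fderiv ℂ g z v) 0 := by
  exact analyticAt_clm_apply' hg.fderiv analyticAt_const

variable {ζ : ι → E}

lemma ev_of_nhds (hζ : Tendsto ζ (𝒰 : Filter ι) (𝓝 0)) {p : E → Prop} (h : ∀ᶠ z in 𝓝 (0:E), p z) :
    ∀ᶠ i in (𝒰 : Filter ι), p (ζ i) := hζ.eventually h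

lemma Ed_congr (hζ : Tendsto ζ (𝒰 : Filter ι) (𝓝 0)) {s : ℕ} (b : Fin s → E) (a : Fin s → GK 𝒰)
    {g h : E → ℂ} (hgh : g =ᶠ[𝓝 0] h) : Ed 𝒰 ζ b a g = Ed 𝒰 ζ b a h := by
  unfold Ed
  refine Finset.sum_congr rfl fun k _ => ?_
  congr 1
  rw [gm_eq]
  filter_upwards [ev_of_nhds 𝒰 hζ (hgh.fderiv (𝕜 := ℂ))] with i hi
  rw [hi]

lemma Ed_add (hζ : Tendsto ζ (𝒰 : Filter ι) (𝓝 0)) {s : ℕ} (b : Fin s → E) (a : Fin s → GK 𝒰)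
    {g h : E → ℂ} (hg : AnalyticAt ℂ g 0) (hh : AnalyticAt ℂ h 0) :
    Ed 𝒰 ζ b a (fun z => g z + h z) = Ed 𝒰 ζ b a g + Ed 𝒰 ζ b a h := by
  unfold Ed
  rw [← Finset.sum_add_distrib]
  refine Finset.sum_congr rfl fun k _ => ?_
  rw [← add_mul, ← map_add]
  congr 1
  rw [gm_eq]
  filter_upwards [ev_of_nhds 𝒰 hζ hg.eventually_analyticAt,
    ev_of_nhds 𝒰 hζ hh.eventually_analyticAt] with i h1 h2
  rw [fderiv_fun_add h1.differentiableAt h2.differentiableAt]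
  rfl

lemma Ed_mul (hζ : Tendsto ζ (𝒰 : Filter ι) (𝓝 0)) {s : ℕ} (b : Fin s → E) (a : Fin s → GK 𝒰)
    {g h : E → ℂ} (hg : AnalyticAt ℂ g 0) (hh : AnalyticAt ℂ h 0) :
    Ed 𝒰 ζ b a (fun z => g z * h z) = gm 𝒰 (fun i => g (ζ i)) * Ed 𝒰 ζ b a h
      + gm 𝒰 (fun i => h (ζ i)) * Ed 𝒰 ζ b a g := by
  unfold Ed
  rw [Finset.mul_sum, Finset.mul_sum, ← Finset.sum_add_distrib]
  refine Finset.sum_congr rfl fun k _ => ?_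
  rw [← mul_assoc, ← mul_assoc, ← add_mul, ← map_mul, ← map_mul, ← map_add]
  congr 1
  rw [gm_eq]
  filter_upwards [ev_of_nhds 𝒰 hζ hg.eventually_analyticAt,
    ev_of_nhds 𝒰 hζ hh.eventually_analyticAt] with i h1 h2
  rw [fderiv_fun_mul h1.differentiableAt h2.differentiableAt]
  rfl

lemma Ed_sub (hζ : Tendsto ζ (𝒰 : Filter ι) (𝓝 0)) {s : ℕ} (b : Fin s → E) (a : Fin s → GK 𝒰)
    {g h : E → ℂ} (hg : AnalyticAt ℂ g 0) (hh : AnalyticAt ℂ h 0) :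
    Ed 𝒰 ζ b a (fun z => g z - h z) = Ed 𝒰 ζ b a g - Ed 𝒰 ζ b a h := by
  have := Ed_add 𝒰 hζ b a (hg.sub hh) hh
  simp only [Pi.sub_apply, sub_add_cancel] at this
  rw [eq_sub_iff_add_eq, this]
  rfl

/-- tangent vectors give analytic derivations -/
lemma exists_anDer (hζ : Tendsto ζ (𝒰 : Filter ι) (𝓝 0)) {s : ℕ} (b : Fin s → E) (a : Fin s → GK 𝒰)
    (ha : ∀ k, a k ∈ Fg 𝒰 ζ)
    (htan : ∀ g : E → ℂ, AnalyticAt ℂ g 0 → gm 𝒰 (fun i => g (ζ i)) = 0 → Ed 𝒰 ζ b a g = 0) :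
    ∃ D, AnDer 𝒰 ζ D ∧ ∀ g : E → ℂ, AnalyticAt ℂ g 0 →
      D (gm 𝒰 (fun i => g (ζ i))) = Ed 𝒰 ζ b a g := by
  classical
  have hch : ∀ x ∈ Ag 𝒰 ζ, ∃ g : E → ℂ, AnalyticAt ℂ g 0 ∧ x = gm 𝒰 (fun i => g (ζ i)) :=
    fun x hx => hx
  choose! g hg hxg using hch
  set D₀ : GK 𝒰 → GK 𝒰 := fun x => Ed 𝒰 ζ b a (g x) with hD₀
  have hwd : ∀ h : E → ℂ, AnalyticAt ℂ h 0 → D₀ (gm 𝒰 (fun i => h (ζ i))) = Ed 𝒰 ζ b a h := by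
    intro h hh
    have hx : gm 𝒰 (fun i => h (ζ i)) ∈ Ag 𝒰 ζ := ⟨h, hh, rfl⟩
    have h1 := htan (fun z => g (gm 𝒰 (fun i => h (ζ i))) z - h z) ((hg _ hx).sub hh) (by
      have := hxg _ hx
      change gm 𝒰 ((fun i => g (gm 𝒰 (fun i => h (ζ i))) (ζ i)) - (fun i => h (ζ i))) = 0
      rw [map_sub, ← this, sub_self])
    rw [Ed_sub 𝒰 hζ b a (hg _ hx) hh] at h1
    exact sub_eq_zero.1 h1
  obtain ⟨D, hD, hDD⟩ := exists_isDer_closure (Ag 𝒰 ζ) D₀ (by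
      intro x hx
      refine (Fg 𝒰 ζ).sum_mem fun k _ => (Fg 𝒰 ζ).mul_mem ?_ (ha k)
      exact mem_Fg 𝒰 ζ (fderiv_dir_analytic (hg x hx) (b k))) (by
      rintro x ⟨u, hu, rfl⟩ y ⟨v, hv, rfl⟩
      rw [hwd u hu, hwd v hv, ← Ed_add 𝒰 hζ b a hu hv, ← hwd _ (hu.fun_add hv), ← map_add]
      rfl) (by
      rintro x ⟨u, hu, rfl⟩ y ⟨v, hv, rfl⟩
      rw [hwd u hu, hwd v hv, ← Ed_mul 𝒰 hζ b a hu hv, ← hwd _ (hu.fun_mul hv), ← map_mul]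
      rfl)
  have hfin : ∀ g : E → ℂ, AnalyticAt ℂ g 0 →
      D (gm 𝒰 (fun i => g (ζ i))) = Ed 𝒰 ζ b a g := by
    intro u hu
    rw [hDD _ ⟨u, hu, rfl⟩, hwd u hu]
  exact ⟨D, ⟨hD, s, b, a, ha, hfin⟩, hfin⟩

/-- first case: no analytic relation -/
lemma const_case1 [FiniteDimensional ℂ E] (hζ : Tendsto ζ (𝒰 : Filter ι) (𝓝 0))
    (hP : ∀ g : E → ℂ, AnalyticAt ℂ g 0 → gm 𝒰 (fun i => g (ζ i)) = 0 → ∀ᶠ z in 𝓝 0, g z = 0)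
    (x : GK 𝒰) (hx : x ∈ Fg 𝒰 ζ) (hD : ∀ D, AnDer 𝒰 ζ D → D x = 0) : ∃ c, x = gc 𝒰 c := by
  have hx' := hx
  unfold Fg at hx'
  rw [Subfield.mem_closure_iff, Subring.closure_eq] at hx'
  obtain ⟨_, ⟨g, hg, rfl⟩, _, ⟨h, hh, rfl⟩, rfl⟩ := hx'
  by_cases h0 : gm 𝒰 (fun i => h (ζ i)) = 0
  · exact ⟨0, by rw [h0, div_zero, map_zero]⟩
  have key : ∀ v : E, ∀ᶠ z in 𝓝 (0:E), h z * fderiv ℂ g z v - g z * fderiv ℂ h z v = 0 := by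
    intro v
    obtain ⟨D, hDer, hDg⟩ := exists_anDer 𝒰 hζ (s := 1) (fun _ => v) (fun _ => 1)
      (fun _ => (Fg 𝒰 ζ).one_mem) (by
        intro u hu hu0
        have h1 := hP u hu hu0
        rw [Ed_congr 𝒰 hζ _ _ (h := fun _ => 0) h1]
        unfold Ed
        refine Finset.sum_eq_zero fun k _ => ?_
        have : gm 𝒰 (fun i => fderiv ℂ (fun _ : E => (0:ℂ)) (ζ i) v) = 0 := by
          rw [gm_eq_zero]; simp
        rw [this, zero_mul])
    have h1 := hD D hDer
    have h2 : (gm 𝒰 (fun i => g (ζ i)) / gm 𝒰 (fun i => h (ζ i))) * gm 𝒰 (fun i => h (ζ i))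
      = gm 𝒰 (fun i => g (ζ i)) := by field_simp
    have h3 := congrArg D h2
    rw [hDer.1.mul _ hx _ (mem_Fg 𝒰 ζ hh), h1, mul_zero, add_zero, hDg h hh, hDg g hg] at h3
    unfold Ed at h3
    simp only [Finset.univ_unique, Fin.default_eq_zero, Fin.isValue, mul_one,
      Finset.sum_singleton] at h3
    apply hP _ ((hh.mul (fderiv_dir_analytic hg v)).sub (hg.mul (fderiv_dir_analytic hh v)))
    have h4 : gm 𝒰 (fun i => h (ζ i)) * gm 𝒰 (fun i => fderiv ℂ g (ζ i) v)
        - gm 𝒰 (fun i => g (ζ i)) * gm 𝒰 (fun i => fderiv ℂ h (ζ i) v) = 0 := by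
      rw [← h3]; field_simp; ring
    rw [← map_mul, ← map_mul, ← map_sub] at h4
    exact h4
  have key2 : ∀ᶠ z in 𝓝 (0:E), ∀ v, h z * fderiv ℂ g z v - g z * fderiv ℂ h z v = 0 := by
    let B := Module.finBasis ℂ E
    have : ∀ᶠ z in 𝓝 (0:E), ∀ k, h z * fderiv ℂ g z (B k) - g z * fderiv ℂ h z (B k) = 0 :=
      Filter.eventually_all.2 fun k => key (B k)
    filter_upwards [this] with z hz v
    have : (h z • fderiv ℂ g z - g z • fderiv ℂ h z : E →L[ℂ] ℂ).toLinearMap = 0 := by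
      apply B.ext
      intro k
      exact hz k
    exact congrArg (fun T : E →ₗ[ℂ] ℂ => T v) this
  obtain ⟨R, hR, hball⟩ := Metric.eventually_nhds_iff_ball.1
    (key2.and (hg.eventually_analyticAt.and hh.eventually_analyticAt))
  have hne : ∃ w ∈ ball (0:E) R, h w ≠ 0 := by
    by_contra hcon
    push Not at hcon
    apply h0
    rw [gm_eq_zero]
    exact ev_of_nhds 𝒰 hζ (Filter.eventually_of_mem (ball_mem_nhds _ hR) hcon)
  obtain ⟨w, hw, hhw⟩ := hne
  have hcont : ∀ᶠ z in 𝓝 w, h z ≠ 0 := (hball w hw).2.2.continuousAt.eventually_ne hhw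
  obtain ⟨R2, hR2, hball2⟩ := Metric.eventually_nhds_iff_ball.1
    (hcont.and (isOpen_ball.mem_nhds hw : ∀ᶠ z in 𝓝 w, z ∈ ball (0:E) R))
  have hconst : ∀ z ∈ ball w R2, g z / h z = g w / h w := by
    intro z hz
    have hd : ∀ y ∈ ball w R2, HasFDerivAt (fun y => g y / h y) (0 : E →L[ℂ] ℂ) y := by
      intro y hy
      obtain ⟨hy0, hyR⟩ := hball2 y hy
      obtain ⟨e1, e2, e3⟩ := hball y hyR
      have h5 := e2.differentiableAt.hasFDerivAt.mul
        ((hasDerivAt_inv hy0).comp_hasFDerivAt y e3.differentiableAt.hasFDerivAt)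
      have h6 : HasFDerivAt (fun y => g y / h y) _ y := h5
      refine h6.congr_fderiv ?_
      refine ContinuousLinearMap.ext fun v => ?_
      have h7 := e1 v
      simp
      field_simp
      linear_combination h7
    exact (convex_ball w R2).is_const_of_fderivWithin_eq_zero (𝕜 := ℂ)
      (fun y hy => (hd y hy).differentiableAt.differentiableWithinAt)
      (fun y hy => by
        rw [fderivWithin_of_isOpen isOpen_ball hy, (hd y hy).fderiv]) hz (mem_ball_self hR2)
  set c := g w / h w
  have hzero : Set.EqOn (fun z => g z - c * h z) 0 (ball (0:E) R) := by
    refine AnalyticOnNhd.eqOn_zero_of_preconnected_of_eventuallyEq_zero (𝕜 := ℂ) (z₀ := w) ?_ ?_ hw ?_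
    · exact fun z hz => (hball z hz).2.1.sub (analyticAt_const.mul (hball z hz).2.2)
    · exact (convex_ball _ _).isPreconnected
    · filter_upwards [ball_mem_nhds w hR2] with z hz
      have h1 := hconst z hz
      have h2 := (hball2 z hz).1
      rw [div_eq_iff h2] at h1
      simp [h1]
  refine ⟨c, ?_⟩
  rw [div_eq_iff h0]
  change _ = gm 𝒰 (fun _ => c) * _
  rw [← map_mul, gm_eq]
  filter_upwards [ev_of_nhds 𝒰 hζ (ball_mem_nhds (0:E) hR)] with i hi
  exact sub_eq_zero.1 (hzero hi)

end Germs

end PartA4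

section PartA5
open Complex Metric Filter Topology Polynomial

section Case2
variable {ι : Type} (𝒰 : Ultrafilter ι)
variable {E : Type} [NormedAddCommGroup E] [NormedSpace ℂ E]

/-- the constants property -/
def ConstProp (ζ : ι → E) : Prop :=
  ∀ x ∈ Fg 𝒰 ζ, (∀ D, AnDer 𝒰 ζ D → D x = 0) → ∃ c, x = gc 𝒰 c

lemma const_of_algebraic (F' F : Subfield (GK 𝒰)) (hFF : F' ≤ F) (x : GK 𝒰)
    (hIntg : IsIntegral F' x)
    (hc : ∀ i : ℕ, ∃ c, ((minpoly F' x).coeff i : GK 𝒰) = gc 𝒰 c) : ∃ c, x = gc 𝒰 c := by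
  choose c hc using hc
  set p := minpoly F' x with hp
  have hmonic : p.Monic := minpoly.monic hIntg
  let P : ℂ[X] := ∑ i ∈ Finset.range (p.natDegree + 1), C (c i) * X ^ i
  have hP : P.coeff p.natDegree = 1 := by
    have h1 : gc 𝒰 (c p.natDegree) = gc 𝒰 1 := by
      rw [← hc, map_one]
      have : p.coeff p.natDegree = 1 := hmonic
      rw [this]; rfl
    have h2 := (gc 𝒰).injective h1
    simp only [P, Polynomial.finset_sum_coeff, Polynomial.coeff_C_mul, Polynomial.coeff_X_pow]
    rw [Finset.sum_eq_single p.natDegree]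
    · simp [h2]
    · intro b _ hb
      simp [hb.symm]
    · simp
  refine root_mem_range (gc 𝒰) P (by rintro h; rw [h] at hP; simp at hP) x ?_
  have h0 := minpoly.aeval F' x
  rw [Polynomial.aeval_eq_sum_range] at h0
  rw [← h0]
  simp only [P, Polynomial.eval₂_finset_sum, Polynomial.eval₂_mul, Polynomial.eval₂_C,
    Polynomial.eval₂_pow, Polynomial.eval₂_X]
  refine Finset.sum_congr rfl fun i _ => ?_
  rw [← hc i]
  rfl

lemma const_case2 (ζ : ι → E × ℂ) (hζ : Tendsto ζ (𝒰 : Filter ι) (𝓝 0))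
    (IH : ConstProp 𝒰 (fun i => (ζ i).1)) (G : E × ℂ → ℂ) (hG : AnalyticAt ℂ G 0)
    (hG0 : ¬ ∀ᶠ z in 𝓝 (0:ℂ), G (0, z) = 0) (hGζ : gm 𝒰 (fun i => G (ζ i)) = 0) :
    ConstProp 𝒰 ζ := by
  classical
  obtain ⟨d, hWD⟩ := weierstrass_division G hG hG0
  set ζ' : ι → E := fun i => (ζ i).1 with hζ'
  set y : GK 𝒰 := gm 𝒰 (fun i => (ζ i).2) with hy
  have hfst : AnalyticAt ℂ (fun z : E × ℂ => z.1) 0 := analyticAt_fst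
  have hsnd : AnalyticAt ℂ (fun z : E × ℂ => z.2) 0 := analyticAt_snd
  have hcomp : ∀ {r : E → ℂ}, AnalyticAt ℂ r 0 → AnalyticAt ℂ (fun z : E × ℂ => r z.1) 0 := by
    intro r hr
    exact AnalyticAt.comp' (g := r) (f := fun z : E × ℂ => z.1) hr hfst
  have hRan : ∀ {r : Fin d → E → ℂ}, (∀ j, AnalyticAt ℂ (r j) 0) →
      AnalyticAt ℂ (fun z : E × ℂ => ∑ j, r j z.1 * z.2 ^ (j:ℕ)) 0 := by
    intro r hr
    exact Finset.analyticAt_fun_sum _ fun j _ => (hcomp (hr j)).fun_mul (hsnd.fun_pow _)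
  have hRgm : ∀ (r : Fin d → E → ℂ),
      gm 𝒰 (fun i => ∑ j, r j (ζ i).1 * (ζ i).2 ^ (j:ℕ)) = ∑ j, gm 𝒰 (fun i => r j (ζ' i)) * y ^ (j:ℕ) := by
    intro r
    rw [hy]
    simp only [← map_pow, ← map_mul, ← map_sum]
    congr 1
    funext i
    simp [Finset.sum_apply, hζ']
  have hexp : ∀ h : E × ℂ → ℂ, ∀ (q : E × ℂ → ℂ) (r : Fin d → E → ℂ),
      (∀ᶠ x in 𝓝 0, h x = q x * G x + ∑ j, r j x.1 * x.2 ^ (j:ℕ)) →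
      gm 𝒰 (fun i => h (ζ i)) = ∑ j, gm 𝒰 (fun i => r j (ζ' i)) * y ^ (j:ℕ) := by
    intro h q r he
    rw [← hRgm]
    rw [gm_eq]
    filter_upwards [ev_of_nhds 𝒰 hζ he, (gm_eq_zero 𝒰).1 hGζ] with i h1 h2
    rw [h1, h2, mul_zero, zero_add]
  -- the distinguished polynomial
  obtain ⟨q0, hq0, r0, hr0, he0, hq00⟩ := hWD (fun x => x.2 ^ d) (hsnd.fun_pow d)
  have hq00 := hq00 rfl
  have hydeg : y ^ d = ∑ j, gm 𝒰 (fun i => r0 j (ζ' i)) * y ^ (j:ℕ) := by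
    rw [← hexp _ q0 r0 he0, hy, ← map_pow]; rfl
  have hIntg : IsIntegral (Fg 𝒰 ζ') y := by
    refine ⟨X ^ d - ∑ j : Fin d, C (⟨_, mem_Fg 𝒰 ζ' (hr0 j)⟩ : Fg 𝒰 ζ') * X ^ (j:ℕ),
      monic_X_pow_sub (degree_sum_fin_lt _), ?_⟩
    rw [Polynomial.eval₂_sub, Polynomial.eval₂_finset_sum]
    simp only [Polynomial.eval₂_mul, Polynomial.eval₂_C, Polynomial.eval₂_pow, Polynomial.eval₂_X]
    rw [hydeg]
    exact sub_self _
  have hle : Fg 𝒰 ζ' ≤ Fg 𝒰 ζ := by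
    refine Subfield.closure_le.2 ?_
    rintro _ ⟨g, hg, rfl⟩
    exact mem_Fg 𝒰 ζ (hcomp hg)
  have hyF : y ∈ Fg 𝒰 ζ := mem_Fg 𝒰 ζ hsnd
  have hF : (IntermediateField.adjoin (Fg 𝒰 ζ') {y}).toSubfield = Fg 𝒰 ζ := by
    apply le_antisymm
    · rw [IntermediateField.adjoin_toSubfield, Subfield.closure_le]
      rintro _ (⟨x, rfl⟩ | rfl)
      · exact hle x.2
      · exact hyF
    · refine Subfield.closure_le.2 ?_
      rintro _ ⟨g, hg, rfl⟩
      obtain ⟨q, -, r, hr, he, -⟩ := hWD g hg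
      change gm 𝒰 _ ∈ IntermediateField.adjoin (Fg 𝒰 ζ') {y}
      rw [hexp g q r he]
      refine sum_mem fun j _ => mul_mem ?_ (pow_mem ?_ _)
      · exact (IntermediateField.adjoin (Fg 𝒰 ζ') {y}).algebraMap_mem
          ⟨_, mem_Fg 𝒰 ζ' (hr j)⟩
      · exact IntermediateField.mem_adjoin_simple_self _ _
  -- extension of derivations
  have hext : ∀ D', AnDer 𝒰 ζ' D' → ∃ D₂, AnDer 𝒰 ζ D₂ ∧ ∀ x ∈ Fg 𝒰 ζ', D₂ x = D' x := by
    rintro D' ⟨hD', s, b, a, ha, hfin⟩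
    obtain ⟨D₂, hD₂, hext⟩ := exists_isDer_adjoin (Fg 𝒰 ζ') D' hD' y hIntg
    rw [hF] at hD₂
    refine ⟨D₂, ⟨hD₂, s + 1, Fin.cons (0, 1) (fun k => (b k, 0)), Fin.cons (D₂ y) a, ?_, ?_⟩, hext⟩
    · intro k
      refine Fin.cases ?_ (fun k => ?_) k
      · exact hD₂.mem _ hyF
      · exact hle (ha k)
    set b₂ : Fin (s+1) → E × ℂ := Fin.cons (0, 1) (fun k => (b k, 0)) with hb₂
    set a₂ : Fin (s+1) → GK 𝒰 := Fin.cons (D₂ y) a with ha₂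
    have gfst : ∀ {r : E → ℂ}, AnalyticAt ℂ r 0 →
        D₂ (gm 𝒰 (fun i => r (ζ i).1)) = Ed 𝒰 ζ b₂ a₂ (fun z => r z.1) := by
      intro r hr
      have h1 := hfin r hr
      rw [← hext _ (mem_Fg 𝒰 ζ' hr)] at h1
      refine h1.trans ?_
      have hev : ∀ w : E × ℂ, ∀ᶠ i in (𝒰 : Filter ι),
          fderiv ℂ (fun z : E × ℂ => r z.1) (ζ i) w = fderiv ℂ r (ζ' i) w.1 := by
        intro w
        have ht : Tendsto ζ' (𝒰 : Filter ι) (𝓝 0) := by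
          have := (continuous_fst.tendsto (0 : E × ℂ)).comp hζ
          exact this
        filter_upwards [ht.eventually hr.eventually_analyticAt] with i hi
        have h2 : HasFDerivAt (fun z : E × ℂ => r z.1)
            ((fderiv ℂ r (ζ' i)).comp (ContinuousLinearMap.fst ℂ E ℂ)) (ζ i) :=
          HasFDerivAt.comp (ζ i) (g := r) (f := fun z : E × ℂ => z.1)
            hi.differentiableAt.hasFDerivAt hasFDerivAt_fst
        rw [h2.fderiv]; rfl
      unfold Ed
      rw [Fin.sum_univ_succ]
      have h3 : gm 𝒰 (fun i => fderiv ℂ (fun z : E × ℂ => r z.1) (ζ i) (b₂ 0)) = 0 := by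
        rw [gm_eq_zero]
        filter_upwards [hev (b₂ 0)] with i hi
        rw [hi]
        simp [hb₂]
      rw [h3, zero_mul, zero_add]
      refine Finset.sum_congr rfl fun k _ => ?_
      congr 1
      rw [gm_eq]
      filter_upwards [hev (b₂ k.succ)] with i hi
      rw [hi]
      simp [hb₂]
    have gsnd : D₂ (gm 𝒰 (fun i => (ζ i).2)) = Ed 𝒰 ζ b₂ a₂ (fun z => z.2) := by
      have hfd : ∀ w v : E × ℂ, fderiv ℂ (fun z : E × ℂ => z.2) w v = v.2 := by
        intro w v
        rw [(hasFDerivAt_snd (𝕜 := ℂ) (p := w)).fderiv]; rfl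
      unfold Ed
      simp only [hfd]
      rw [Fin.sum_univ_succ]
      have h1 : gm 𝒰 (fun _ => (b₂ 0).2) = 1 := map_one (gm 𝒰)
      rw [h1, one_mul, Finset.sum_eq_zero, add_zero]
      · rfl
      · intro k _
        have : gm 𝒰 (fun _ => (b₂ k.succ).2) = 0 := map_zero (gm 𝒰)
        rw [this, zero_mul]
    have gadd : ∀ {g h : E × ℂ → ℂ}, AnalyticAt ℂ g 0 → AnalyticAt ℂ h 0 →
        D₂ (gm 𝒰 (fun i => g (ζ i))) = Ed 𝒰 ζ b₂ a₂ g → D₂ (gm 𝒰 (fun i => h (ζ i))) = Ed 𝒰 ζ b₂ a₂ h →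
        D₂ (gm 𝒰 (fun i => g (ζ i) + h (ζ i))) = Ed 𝒰 ζ b₂ a₂ (fun z => g z + h z) := by
      intro g h hg hh h1 h2
      rw [Ed_add 𝒰 hζ b₂ a₂ hg hh, ← h1, ← h2, ← hD₂.add _ (mem_Fg 𝒰 ζ hg) _ (mem_Fg 𝒰 ζ hh), ← map_add]
      rfl
    have gmul : ∀ {g h : E × ℂ → ℂ}, AnalyticAt ℂ g 0 → AnalyticAt ℂ h 0 →
        D₂ (gm 𝒰 (fun i => g (ζ i))) = Ed 𝒰 ζ b₂ a₂ g → D₂ (gm 𝒰 (fun i => h (ζ i))) = Ed 𝒰 ζ b₂ a₂ h →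
        D₂ (gm 𝒰 (fun i => g (ζ i) * h (ζ i))) = Ed 𝒰 ζ b₂ a₂ (fun z => g z * h z) := by
      intro g h hg hh h1 h2
      rw [Ed_mul 𝒰 hζ b₂ a₂ hg hh, ← h1, ← h2, ← hD₂.mul _ (mem_Fg 𝒰 ζ hg) _ (mem_Fg 𝒰 ζ hh), ← map_mul]
      rfl
    have gone : D₂ (gm 𝒰 (fun i => (1:ℂ))) = Ed 𝒰 ζ b₂ a₂ (fun _ => 1) := by
      have h1 := gfst (r := fun _ => 1) analyticAt_const
      exact h1
    have gpow : ∀ k : ℕ, D₂ (gm 𝒰 (fun i => (ζ i).2 ^ k)) = Ed 𝒰 ζ b₂ a₂ (fun z => z.2 ^ k) := by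
      intro k
      induction k with
      | zero => simpa using gone
      | succ k ih =>
        simp only [pow_succ]
        exact gmul (hsnd.fun_pow k) hsnd ih gsnd
    have gR : ∀ (r : Fin d → E → ℂ), (∀ j, AnalyticAt ℂ (r j) 0) → ∀ t : Finset (Fin d),
        D₂ (gm 𝒰 (fun i => ∑ j ∈ t, r j (ζ i).1 * (ζ i).2 ^ (j:ℕ))) =
        Ed 𝒰 ζ b₂ a₂ (fun z => ∑ j ∈ t, r j z.1 * z.2 ^ (j:ℕ)) := by
      intro r hr t
      induction t using Finset.induction_on with
      | empty => simpa using gfst (r := fun _ => 0) analyticAt_const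
      | insert j t hj ih =>
        simp only [Finset.sum_insert hj]
        refine gadd (h := fun z => ∑ j ∈ t, r j z.1 * z.2 ^ (j:ℕ)) ((hcomp (hr j)).fun_mul (hsnd.fun_pow _)) ?_
          (gmul (hcomp (hr j)) (hsnd.fun_pow _) (gfst (hr j)) (gpow _)) ih
        exact Finset.analyticAt_fun_sum _ fun j _ => (hcomp (hr j)).fun_mul (hsnd.fun_pow _)
    have hEdR : ∀ (q : E × ℂ → ℂ) (r : Fin d → E → ℂ) (h : E × ℂ → ℂ), AnalyticAt ℂ q 0 →
        (∀ j, AnalyticAt ℂ (r j) 0) →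
        (∀ᶠ x in 𝓝 0, h x = q x * G x + ∑ j, r j x.1 * x.2 ^ (j:ℕ)) →
        Ed 𝒰 ζ b₂ a₂ h = gm 𝒰 (fun i => q (ζ i)) * Ed 𝒰 ζ b₂ a₂ G
          + D₂ (gm 𝒰 (fun i => h (ζ i))) := by
      intro q r h hq hr he
      rw [Ed_congr 𝒰 hζ b₂ a₂ (h := fun x => q x * G x + ∑ j, r j x.1 * x.2 ^ (j:ℕ)) he,
        Ed_add 𝒰 hζ b₂ a₂ (g := fun x => q x * G x) (hq.fun_mul hG) (hRan hr),
        Ed_mul 𝒰 hζ b₂ a₂ hq hG, hGζ, zero_mul, add_zero, ← gR r hr, hRgm, hexp h q r he]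
    have hEdG : Ed 𝒰 ζ b₂ a₂ G = 0 := by
      have h1 := hEdR q0 r0 _ hq0 hr0 he0
      rw [gpow d] at h1
      have h2 : gm 𝒰 (fun i => q0 (ζ i)) * Ed 𝒰 ζ b₂ a₂ G = 0 := by
        simpa using h1
      refine (mul_eq_zero.1 h2).resolve_left ?_
      intro h3
      rw [gm_eq_zero] at h3
      have h4 := ev_of_nhds 𝒰 hζ (hq0.continuousAt.eventually_ne hq00)
      obtain ⟨i, hi⟩ := (h3.and h4).exists
      exact hi.2 hi.1
    intro g hg
    obtain ⟨q, hq, r, hr, he, -⟩ := hWD g hg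
    rw [hEdR q r g hq hr he, hEdG, mul_zero, zero_add]
  -- conclusion
  intro x hx hD
  have hxint : IsIntegral (Fg 𝒰 ζ') x := by
    have h1 := IntermediateField.isAlgebraic_adjoin_simple hIntg
    rw [← hF] at hx
    have h2 := (h1.isAlgebraic ⟨x, hx⟩).isIntegral
    exact (isIntegral_algebraMap_iff (algebraMap (IntermediateField.adjoin (Fg 𝒰 ζ') {y}) (GK 𝒰)).injective).2 h2
  refine const_of_algebraic 𝒰 (Fg 𝒰 ζ') (Fg 𝒰 ζ) hle x hxint fun i => ?_
  refine IH _ (SetLike.coe_mem _) fun D' hD' => ?_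
  obtain ⟨D₂, hD₂, hext⟩ := hext D' hD'
  exact isDer_minpoly_coeff (Fg 𝒰 ζ') (Fg 𝒰 ζ) hle D' D₂ hD'.1 hD₂.1 hext x hx hxint (hD D₂ hD₂) i

end Case2

end PartA5

section PartA6
open Complex Metric Filter Topology

section Const
variable {ι : Type} (𝒰 : Ultrafilter ι)

lemma ConstProp.transport {E E₂ : Type} [NormedAddCommGroup E] [NormedSpace ℂ E]
    [NormedAddCommGroup E₂] [NormedSpace ℂ E₂] (Φ : E ≃L[ℂ] E₂) (ζ : ι → E)
    (h : ConstProp 𝒰 (fun i => Φ (ζ i))) : ConstProp 𝒰 ζ := by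
  have hsymm : ∀ {g : E → ℂ}, AnalyticAt ℂ g 0 → AnalyticAt ℂ (fun z => g (Φ.symm z)) 0 := by
    intro g hg
    have h1 : AnalyticAt ℂ (fun z => Φ.symm z) (0 : E₂) :=
      (Φ.symm : E₂ →L[ℂ] E).analyticAt 0
    exact AnalyticAt.comp' (g := g) (f := fun z => Φ.symm z) (by simpa using hg) h1
  have hfor : ∀ {g : E₂ → ℂ}, AnalyticAt ℂ g 0 → AnalyticAt ℂ (fun z => g (Φ z)) 0 := by
    intro g hg
    have h1 : AnalyticAt ℂ (fun z => Φ z) (0 : E) := (Φ : E →L[ℂ] E₂).analyticAt 0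
    exact AnalyticAt.comp' (g := g) (f := fun z => Φ z) (by simpa using hg) h1
  have hA : Ag 𝒰 ζ = Ag 𝒰 (fun i => Φ (ζ i)) := by
    ext x
    constructor
    · rintro ⟨g, hg, rfl⟩
      exact ⟨fun z => g (Φ.symm z), hsymm hg, by simp⟩
    · rintro ⟨g, hg, rfl⟩
      exact ⟨fun z => g (Φ z), hfor hg, rfl⟩
  have hF : Fg 𝒰 ζ = Fg 𝒰 (fun i => Φ (ζ i)) := by unfold Fg; rw [hA]
  intro x hx hD
  rw [hF] at hx
  refine h x hx fun D hDer => hD D ?_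
  obtain ⟨hd, s, b, a, ha, hfin⟩ := hDer
  refine ⟨by rwa [hF], s, fun k => Φ.symm (b k), a, by rwa [hF], fun g hg => ?_⟩
  have h1 := hfin _ (hsymm hg)
  simp only [ContinuousLinearEquiv.symm_apply_apply] at h1
  rw [h1]
  unfold Ed
  refine Finset.sum_congr rfl fun k _ => ?_
  congr 2
  funext i
  have h2 := Φ.symm.comp_right_fderiv (f := g) (x := Φ (ζ i))
  have h3 : fderiv ℂ (fun z => g (Φ.symm z)) (Φ (ζ i)) = _ := h2
  rw [h3]
  simp

theorem constProp (m : ℕ) : ∀ (E : Type) [NormedAddCommGroup E] [NormedSpace ℂ E]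
    [FiniteDimensional ℂ E], Module.finrank ℂ E = m → ∀ ζ : ι → E,
    Tendsto ζ (𝒰 : Filter ι) (𝓝 0) → ConstProp 𝒰 ζ := by
  induction m with
  | zero =>
    intro E _ _ _ hE ζ hζ
    intro x hx hD
    refine const_case1 𝒰 hζ ?_ x hx hD
    intro g hg h0
    have : Subsingleton E := Module.finrank_zero_iff.1 hE
    obtain ⟨i, hi⟩ := ((gm_eq_zero 𝒰).1 h0).exists
    refine Filter.Eventually.of_forall fun z => ?_
    rw [Subsingleton.elim z (ζ i), hi]
  | succ m IH =>
    intro E _ _ _ hE ζ hζ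
    by_cases hP : ∀ g : E → ℂ, AnalyticAt ℂ g 0 → gm 𝒰 (fun i => g (ζ i)) = 0 →
        ∀ᶠ z in 𝓝 0, g z = 0
    · exact fun x hx hD => const_case1 𝒰 hζ hP x hx hD
    push Not at hP
    obtain ⟨G, hG, hGζ, hGne⟩ := hP
    have hv : ∃ v : E, ¬ ∀ᶠ t in 𝓝 (0:ℂ), G (t • v) = 0 := by
      by_contra hcon
      push Not at hcon
      apply hGne
      obtain ⟨R, hR, hball⟩ := Metric.eventually_nhds_iff_ball.1 hG.eventually_analyticAt
      refine Filter.eventually_of_mem (ball_mem_nhds _ hR) fun w hw => ?_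
      have hwR : ‖w‖ < R := by simpa using hw
      let U : Set ℂ := (fun t : ℂ => t • w) ⁻¹' ball (0:E) R
      have hUc : Convex ℝ U := by
        have := (convex_ball (0:E) R).is_linear_preimage (f := fun t : ℂ => t • w)
          ⟨fun a b => add_smul a b w, fun c a => by rw [smul_assoc]⟩
        exact this
      have hz : Set.EqOn (fun t : ℂ => G (t • w)) 0 U := by
        refine AnalyticOnNhd.eqOn_zero_of_preconnected_of_eventuallyEq_zero (𝕜 := ℂ) (z₀ := 0)
          ?_ hUc.isPreconnected ?_ (hcon w)
        · intro t ht
          have h1 : AnalyticAt ℂ (fun t : ℂ => t • w) t := analyticAt_id.smul analyticAt_const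
          exact AnalyticAt.comp' (g := G) (f := fun t : ℂ => t • w) (hball _ ht) h1
        · change (0:ℂ) • w ∈ ball (0:E) R
          simpa using hR
      have := hz (x := 1) (by change (1:ℂ) • w ∈ ball (0:E) R; simpa using hwR)
      simpa using this
    obtain ⟨v, hv⟩ := hv
    have hG0 : G 0 = 0 := by
      have h1 : Tendsto (fun i => G (ζ i)) (𝒰 : Filter ι) (𝓝 (G 0)) :=
        hG.continuousAt.tendsto.comp hζ
      have h2 : Tendsto (fun i => G (ζ i)) (𝒰 : Filter ι) (𝓝 0) :=
        tendsto_const_nhds.congr' (by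
          filter_upwards [(gm_eq_zero 𝒰).1 hGζ] with i hi
          exact hi.symm)
      exact tendsto_nhds_unique h1 h2
    have hv0 : v ≠ 0 := by
      rintro rfl
      apply hv
      simp [hG0]
    have hfr : Module.finrank ℂ E = Module.finrank ℂ ((Fin m → ℂ) × ℂ) := by
      rw [hE]; simp
    let L : E ≃L[ℂ] (Fin m → ℂ) × ℂ := ContinuousLinearEquiv.ofFinrankEq hfr
    obtain ⟨A, hA⟩ := SeparatingDual.exists_continuousLinearEquiv_apply_eq (R := ℂ)
      (x := L v) (y := ((0 : Fin m → ℂ), (1:ℂ))) (by simpa using hv0) (by simp)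
    let Φ : E ≃L[ℂ] (Fin m → ℂ) × ℂ := L.trans A
    have hΦ : Φ v = (0, 1) := hA
    have hΦs : ∀ t : ℂ, Φ.symm (0, t) = t • v := by
      intro t
      rw [ContinuousLinearEquiv.symm_apply_eq, map_smul, hΦ]
      ext <;> simp
    refine ConstProp.transport 𝒰 Φ ζ ?_
    have hΦζ : Tendsto (fun i => Φ (ζ i)) (𝒰 : Filter ι) (𝓝 0) := by
      have := (Φ.continuous.tendsto 0).comp hζ
      rw [map_zero] at this
      exact this
    refine const_case2 𝒰 (fun i => Φ (ζ i)) hΦζ ?_ (fun z => G (Φ.symm z)) ?_ ?_ ?_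
    · refine IH (Fin m → ℂ) (by simp) _ ?_
      have := (continuous_fst.tendsto (0 : (Fin m → ℂ) × ℂ)).comp hΦζ
      exact this
    · have h1 : AnalyticAt ℂ (fun z => Φ.symm z) (0 : (Fin m → ℂ) × ℂ) :=
        (Φ.symm : (Fin m → ℂ) × ℂ →L[ℂ] E).analyticAt 0
      exact AnalyticAt.comp' (g := G) (f := fun z => Φ.symm z) (by simpa using hG) h1
    · simpa only [hΦs] using hv
    · simpa using hGζ

end Const

theorem lemmaZ {E : Type} [NormedAddCommGroup E] [NormedSpace ℂ E] [FiniteDimensional ℂ E]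
    {κ : Type*} [Fintype κ] (h : E → ℂ) (p : κ → E → ℂ) (hh : AnalyticAt ℂ h 0)
    (hp : ∀ i, AnalyticAt ℂ (p i) 0) (h0 : h 0 = 0) :
    ∀ᶠ z in 𝓝 (0:E), (∀ i, p i z = 0) →
      fderiv ℂ h z ∈ Submodule.span ℂ (Set.range fun i => fderiv ℂ (p i) z) → h z = 0 := by
  classical
  by_contra hcon
  rw [Filter.not_eventually] at hcon
  let S : Set E := {z | ¬ ((∀ i, p i z = 0) →
      fderiv ℂ h z ∈ Submodule.span ℂ (Set.range fun i => fderiv ℂ (p i) z) → h z = 0)}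
  have hne : NeBot (𝓝 (0:E) ⊓ 𝓟 S) := Filter.frequently_iff_neBot.1 hcon
  let 𝒰 : Ultrafilter E := Ultrafilter.of (𝓝 (0:E) ⊓ 𝓟 S)
  have hle : (𝒰 : Filter E) ≤ 𝓝 (0:E) ⊓ 𝓟 S := Ultrafilter.of_le _
  have hζ : Tendsto (fun z : E => z) (𝒰 : Filter E) (𝓝 0) := hle.trans inf_le_left
  have hS : ∀ᶠ z in (𝒰 : Filter E), z ∈ S := by
    have : S ∈ 𝓝 (0:E) ⊓ 𝓟 S := mem_inf_of_right (mem_principal_self S)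
    exact hle this
  have hcoef : ∀ z : E, z ∈ S → ∃ c : κ → ℂ, ∑ i, c i • fderiv ℂ (p i) z = fderiv ℂ h z := by
    intro z hz
    have : fderiv ℂ h z ∈ Submodule.span ℂ (Set.range fun i => fderiv ℂ (p i) z) := by
      by_contra h1
      exact hz fun _ h2 => absurd h2 h1
    exact (Submodule.mem_span_range_iff_exists_fun ℂ).1 this
  choose! c hc using hcoef
  have hp0 : ∀ i, gm 𝒰 (fun z => p i z) = 0 := by
    intro i
    rw [gm_eq_zero]
    filter_upwards [hS] with z hz
    by_contra h1
    exact hz fun h2 => absurd (h2 i) h1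
  obtain ⟨c0, hc0⟩ := constProp 𝒰 _ E rfl (fun z => z) hζ (gm 𝒰 (fun z => h z))
    (mem_Fg 𝒰 (fun z => z) hh) (by
      rintro D ⟨hD, s, b, a, ha, hfin⟩
      rw [hfin h hh]
      have h1 : ∀ i, Ed 𝒰 (fun z => z) b a (p i) = 0 := by
        intro i
        rw [← hfin (p i) (hp i), hp0 i, hD.zero]
      have h2 : Ed 𝒰 (fun z => z) b a h
          = ∑ i, gm 𝒰 (fun z => c z i) * Ed 𝒰 (fun z => z) b a (p i) := by
        unfold Ed
        simp only [Finset.mul_sum]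
        rw [Finset.sum_comm]
        refine Finset.sum_congr rfl fun k _ => ?_
        simp only [← mul_assoc, ← map_mul]
        rw [← Finset.sum_mul, ← map_sum]
        congr 1
        rw [gm_eq]
        filter_upwards [hS] with z hz
        rw [← hc z hz]
        simp [Finset.sum_apply]
      rw [h2]
      simp [h1])
  have h1 : ∀ᶠ z in (𝒰 : Filter E), h z = c0 := (gm_eq 𝒰).1 hc0
  have h2 : Tendsto h (𝒰 : Filter E) (𝓝 (h 0)) := hh.continuousAt.tendsto.comp hζ
  have h3 : Tendsto h (𝒰 : Filter E) (𝓝 c0) :=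
    tendsto_const_nhds.congr' (by filter_upwards [h1] with i hi using hi.symm)
  have h4 : c0 = 0 := by rw [← h0]; exact tendsto_nhds_unique h3 h2
  obtain ⟨z, hz1, hz2⟩ := (h1.and hS).exists
  exact hz2 fun _ _ => by rw [hz1, h4]

end PartA6

section PartA7
open Complex Metric Filter Topology ComplexConjugate

section Conj
variable {V : Type} [NormedAddCommGroup V] [NormedSpace ℂ V]

/-- conjugated series -/
noncomputable def conjSeries (c : V →ₛₗᵢ[starRingEnd ℂ] V) (p : FormalMultilinearSeries ℂ V ℂ) :
    FormalMultilinearSeries ℂ V ℂ := fun m =>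
  MultilinearMap.mkContinuous
    { toFun := fun v => conj (p m fun i => c (v i))
      map_update_add' := by
        intro _ v i x y
        have h1 : ∀ z : V, (fun j => c (Function.update v i z j))
            = Function.update (fun j => c (v j)) i (c z) := by
          intro z
          funext j
          by_cases h : j = i
          · subst h; simp
          · simp [h]
        simp only [h1, map_add, ContinuousMultilinearMap.map_update_add]
      map_update_smul' := by
        intro _ v i a x
        have h1 : ∀ z : V, (fun j => c (Function.update v i z j))
            = Function.update (fun j => c (v j)) i (c z) := by
          intro z
          funext j
          by_cases h : j = i
          · subst h; simp
          · simp [h]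
        simp only [h1, LinearIsometry.map_smulₛₗ, ContinuousMultilinearMap.map_update_smul]
        simp }
    ‖p m‖ (fun v => by
      simp only [MultilinearMap.coe_mk, RCLike.norm_conj]
      refine (ContinuousMultilinearMap.le_opNorm _ _).trans ?_
      simp)

lemma conj_analyticAt (c : V →ₛₗᵢ[starRingEnd ℂ] V) {f : V → ℂ} (hf : AnalyticAt ℂ f 0) :
    AnalyticAt ℂ (fun y => conj (f (c y))) 0 := by
  obtain ⟨p, R, hp⟩ := hf
  refine ⟨conjSeries c p, R, ?_, hp.r_pos, ?_⟩
  · refine hp.r_le.trans ?_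
    apply FormalMultilinearSeries.radius_le_of_le
    intro m
    exact MultilinearMap.mkContinuous_norm_le _ (norm_nonneg _) _
  · intro y hy
    have hy' : c y ∈ Metric.eball (0:V) R := by
      rw [Metric.mem_eball, edist_zero_right] at hy ⊢
      rw [enorm_eq_nnnorm] at hy ⊢
      rwa [LinearIsometry.nnnorm_map]
    have h1 := hp.hasSum hy'
    have h2 := h1.map (starRingEnd ℂ).toAddMonoidHom continuous_conj
    simp only [zero_add] at h2 ⊢
    exact h2

lemma conj_hasFDerivAt (c : V →ₛₗᵢ[starRingEnd ℂ] V) {f : V → ℂ} {y : V}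
    (hf : DifferentiableAt ℂ f (c y)) :
    ∃ L : V →L[ℂ] ℂ, HasFDerivAt (fun y => conj (f (c y))) L y ∧
      ∀ w, L w = conj (fderiv ℂ f (c y) (c w)) := by
  let L : V →L[ℂ] ℂ := LinearMap.mkContinuous
    { toFun := fun w => conj (fderiv ℂ f (c y) (c w))
      map_add' := by intro a b; simp
      map_smul' := by
        intro a b
        simp only [LinearIsometry.map_smulₛₗ, map_smul]; simp }
    ‖fderiv ℂ f (c y)‖ (fun v => by
      simp only [LinearMap.coe_mk, AddHom.coe_mk, RCLike.norm_conj]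
      refine (ContinuousLinearMap.le_opNorm _ _).trans ?_
      simp)
  have h : HasFDerivAt (fun y => conj (f (c y))) L y := by
    have h1 := hf.hasFDerivAt
    rw [hasFDerivAt_iff_isLittleO_nhds_zero] at h1 ⊢
    have ht : Tendsto (fun h : V => c h) (𝓝 0) (𝓝 0) := by
      have := c.continuous.tendsto 0
      simpa using this
    have h2 := h1.comp_tendsto ht
    have h3 : (fun h => conj (f (c (y + h))) - conj (f (c y)) - L h) =o[𝓝 0] fun h => c h := by
      refine Asymptotics.IsLittleO.of_norm_left (h2.norm_left.congr_left fun h => ?_)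
      simp only [Function.comp]
      rw [← RCLike.norm_conj]
      simp [L]
    exact h3.trans_le fun h => by simp
  exact ⟨L, h, fun w => rfl⟩

end Conj

section TLemmas
variable {N : ℕ}

/-- coordinatewise conjugation -/
noncomputable def cjV (N : ℕ) : EuclideanSpace ℂ (Fin N) →ₛₗᵢ[starRingEnd ℂ] EuclideanSpace ℂ (Fin N) where
  toFun x := WithLp.toLp 2 (fun k => conj (x k))
  map_add' x y := by ext k; simp
  map_smul' a x := by ext k; simp
  norm_map' x := by simp [EuclideanSpace.norm_eq]

lemma cjV_apply (x : EuclideanSpace ℂ (Fin N)) (k : Fin N) : cjV N x k = conj (x k) := rfl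

lemma cjV_cjV (x : EuclideanSpace ℂ (Fin N)) : cjV N (cjV N x) = x := by
  ext k; simp [cjV_apply]


lemma T5 {r : ℕ} (f : Fin r → EuclideanSpace ℂ (Fin N) → ℂ) (hf : ∀ i, AnalyticAt ℂ (f i) 0)
    (hf0 : ∀ i, f i 0 = 0) :
    ∀ᶠ x in 𝓝 (0 : EuclideanSpace ℂ (Fin N)), ∀ s, f s x ≠ 0 → fderiv ℂ (f s) x ∉
      Submodule.span ℂ (Set.range fun i : {i : Fin r // f i x = 0} => fderiv ℂ (f i.1) x) := by
  have h1 : ∀ᶠ x in 𝓝 (0 : EuclideanSpace ℂ (Fin N)), ∀ s, ∀ J : Finset (Fin r),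
      (∀ i : J, f i x = 0) → fderiv ℂ (f s) x ∈
        Submodule.span ℂ (Set.range fun i : J => fderiv ℂ (f i) x) → f s x = 0 := by
    refine Filter.eventually_all.2 fun s => Filter.eventually_all.2 fun J => ?_
    exact lemmaZ (f s) (fun i : J => f i) (hf s) (fun i => hf i) (hf0 s)
  filter_upwards [h1] with x hx s hs hmem
  classical
  refine hs (hx s (Finset.univ.filter fun i => f i x = 0) (fun i => (Finset.mem_filter.1 i.2).2) ?_)
  convert hmem using 2
  ext L
  simp

lemma T4pre {r : ℕ} (f : Fin r → EuclideanSpace ℂ (Fin N) → ℂ) (hf : ∀ i, AnalyticAt ℂ (f i) 0) :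
    ∀ᶠ x in 𝓝 (0 : EuclideanSpace ℂ (Fin N)), x ≠ 0 → innerSL ℂ x ∉
      Submodule.span ℂ (Set.range fun i : {i : Fin r // f i x = 0} => fderiv ℂ (f i.1) x) := by
  classical
  let V := EuclideanSpace ℂ (Fin N)
  let H : V × V → ℂ := fun z => ∑ k, z.1 k * z.2 k
  let P : ∀ J : Finset (Fin r), J ⊕ J → V × V → ℂ := fun J => Sum.elim (fun i z => f i z.1)
    (fun i z => conj (f i (cjV N z.2)))
  have hfst : AnalyticAt ℂ (fun z : V × V => z.1) 0 := analyticAt_fst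
  have hsnd : AnalyticAt ℂ (fun z : V × V => z.2) 0 := analyticAt_snd
  have hproj : ∀ k, Differentiable ℂ (fun x : V => x k) := fun k =>
    (EuclideanSpace.proj k : V →L[ℂ] ℂ).differentiable
  have hproja : ∀ k (x : V), AnalyticAt ℂ (fun x : V => x k) x := fun k x =>
    (EuclideanSpace.proj k : V →L[ℂ] ℂ).analyticAt x
  have hHan : AnalyticAt ℂ H 0 := by
    refine Finset.analyticAt_fun_sum _ fun k _ => AnalyticAt.fun_mul ?_ ?_
    · exact AnalyticAt.fun_comp (g := fun x : V => x k) (f := fun z : V × V => z.1) (hproja k _) hfst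
    · exact AnalyticAt.fun_comp (g := fun x : V => x k) (f := fun z : V × V => z.2) (hproja k _) hsnd
  have hPan : ∀ J i, AnalyticAt ℂ (P J i) 0 := by
    rintro J (i | i)
    · exact AnalyticAt.fun_comp (g := f i) (f := fun z : V × V => z.1) (hf i) hfst
    · exact AnalyticAt.fun_comp (g := fun y => conj (f i (cjV N y))) (f := fun z : V × V => z.2)
        (conj_analyticAt (cjV N) (hf i)) hsnd
  have h1 : ∀ᶠ z in 𝓝 (0 : V × V), ∀ J : Finset (Fin r), (∀ i, P J i z = 0) →
      fderiv ℂ H z ∈ Submodule.span ℂ (Set.range fun i => fderiv ℂ (P J i) z) → H z = 0 :=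
    Filter.eventually_all.2 fun J => lemmaZ H (P J) hHan (hPan J) (by simp [H])
  have hdiag : Tendsto (fun x : V => (x, cjV N x)) (𝓝 0) (𝓝 (0 : V × V)) := by
    have : Continuous (fun x : V => (x, cjV N x)) := continuous_id.prodMk (cjV N).continuous
    have := this.tendsto 0
    rw [map_zero] at this
    exact this
  filter_upwards [hdiag.eventually h1, Filter.eventually_all.2 fun i => (hf i).eventually_analyticAt]
    with x hx hax hx0 hmem
  let J : Finset (Fin r) := Finset.univ.filter fun i => f i x = 0
  have hJ : ∀ i : J, f i x = 0 := fun i => (Finset.mem_filter.1 i.2).2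
  have hmem' : innerSL ℂ x ∈ Submodule.span ℂ (Set.range fun i : J => fderiv ℂ (f i) x) := by
    convert hmem using 2
    ext L
    simp [J]
  obtain ⟨c, hc⟩ := (Submodule.mem_span_range_iff_exists_fun ℂ).1 hmem'
  have hHd : ∀ v w : V, fderiv ℂ H (x, cjV N x) (v, w)
      = inner ℂ x v + conj (inner ℂ x (cjV N w)) := by
    intro v w
    have h2 : HasFDerivAt H (∑ k, (x k • ((EuclideanSpace.proj k : V →L[ℂ] ℂ).comp (ContinuousLinearMap.snd ℂ V V))
        + (cjV N x) k • ((EuclideanSpace.proj k : V →L[ℂ] ℂ).comp (ContinuousLinearMap.fst ℂ V V)))) (x, cjV N x) := by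
      refine HasFDerivAt.fun_sum fun k _ => ?_
      exact HasFDerivAt.mul (𝕜 := ℂ) (x := (x, cjV N x))
        (((EuclideanSpace.proj k : V →L[ℂ] ℂ).comp (ContinuousLinearMap.fst ℂ V V)).hasFDerivAt)
        (((EuclideanSpace.proj k : V →L[ℂ] ℂ).comp (ContinuousLinearMap.snd ℂ V V)).hasFDerivAt)
    rw [h2.fderiv]
    simp only [PiLp.inner_apply, map_sum, RCLike.inner_apply]
    rw [← Finset.sum_add_distrib]
    simp only [FunLike.coe_sum, Finset.sum_apply]
    refine Finset.sum_congr rfl fun k _ => ?_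
    simp [cjV_apply]
    ring
  have hin : ∀ v, inner ℂ x v = ∑ i, c i * fderiv ℂ (f i) x v := by
    intro v
    have := congrArg (fun L : V →L[ℂ] ℂ => L v) hc
    simp at this
    exact this.symm
  have h3 := hx J (by
    rintro (i | i)
    · exact hJ i
    · simp [P, cjV_cjV, hJ i]) (by
    rw [Submodule.mem_span_range_iff_exists_fun]
    refine ⟨Sum.elim c (fun i => conj (c i)), ?_⟩
    refine ContinuousLinearMap.ext ?_
    rintro ⟨v, w⟩
    rw [hHd, Fintype.sum_sum_type]
    have e1 : ∀ i : J, fderiv ℂ (P J (Sum.inl i)) (x, cjV N x) (v, w) = fderiv ℂ (f i) x v := by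
      intro i
      have : HasFDerivAt (P J (Sum.inl i)) ((fderiv ℂ (f i) x).comp (ContinuousLinearMap.fst ℂ V V)) (x, cjV N x) :=
        HasFDerivAt.comp (x, cjV N x) (g := f i) (f := fun z : V × V => z.1)
          (hax i).differentiableAt.hasFDerivAt hasFDerivAt_fst
      rw [this.fderiv]; rfl
    have e2 : ∀ i : J, fderiv ℂ (P J (Sum.inr i)) (x, cjV N x) (v, w)
        = conj (fderiv ℂ (f i) x (cjV N w)) := by
      intro i
      have hd : DifferentiableAt ℂ (f i) (cjV N (cjV N x)) := by
        rw [cjV_cjV]; exact (hax i).differentiableAt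
      obtain ⟨L, hL, hLw⟩ := conj_hasFDerivAt (cjV N) hd
      have : HasFDerivAt (P J (Sum.inr i)) (L.comp (ContinuousLinearMap.snd ℂ V V)) (x, cjV N x) :=
        HasFDerivAt.comp (x, cjV N x) (g := fun y => conj (f i (cjV N y))) (f := fun z : V × V => z.2)
          hL hasFDerivAt_snd
      rw [this.fderiv]
      have := hLw w
      rw [cjV_cjV] at this
      exact this
    simp only [Sum.elim_inl, Sum.elim_inr, ContinuousLinearMap.add_apply, FunLike.coe_sum, Finset.sum_apply,
      ContinuousLinearMap.smul_apply, e1, e2, smul_eq_mul]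
    rw [hin, hin, map_sum]
    simp)
  apply hx0
  have h4 : inner ℂ x x = 0 := by
    rw [← h3, PiLp.inner_apply]
    simp only [H, cjV_apply, RCLike.inner_apply]
  exact inner_self_eq_zero.1 h4

end TLemmas

end PartA7

section PartB1
open Complex Metric Filter Topology

section LC
variable {V : Type} [NormedAddCommGroup V] [NormedSpace ℂ V] [FiniteDimensional ℂ V]

lemma surj_of_linInd {J : Type*} [Fintype J] (α : J → V →L[ℂ] ℂ) (h : LinearIndependent ℂ α) :
    LinearMap.range (LinearMap.pi fun j => (α j : V →ₗ[ℂ] ℂ)) = ⊤ := by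
  classical
  by_contra hne
  obtain ⟨φ, hφ0, hφ⟩ := Submodule.exists_le_ker_of_lt_top _ (lt_top_iff_ne_top.2 hne)
  apply hφ0
  rw [Fintype.linearIndependent_iff] at h
  have h1 := h (fun j => φ (Pi.single j 1)) (by
    refine ContinuousLinearMap.ext fun v => ?_
    have h2 : φ (fun j => α j v) = 0 := hφ ⟨v, rfl⟩
    have h3 : (fun j => α j v) = ∑ j, (α j v) • (Pi.single j (1:ℂ) : J → ℂ) := by
      funext k
      simp [Finset.sum_apply, Pi.single_apply]
    rw [h3, map_sum] at h2
    simp only [map_smul, smul_eq_mul] at h2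
    rw [FunLike.coe_sum, Finset.sum_apply]
    simp only [ContinuousLinearMap.smul_apply, smul_eq_mul, ContinuousLinearMap.zero_apply]
    rw [← h2]
    exact Finset.sum_congr rfl fun j _ => mul_comm _ _)
  refine LinearMap.pi_ext fun j c => ?_
  have : (Pi.single j c : J → ℂ) = c • Pi.single j (1:ℂ) := by
    funext k; simp [Pi.single_apply]
  rw [this, map_smul, h1 j]
  simp

theorem lemmaLC {κ : Type} [Fintype κ] (𝒦 : Set V) (h𝒦 : IsCompact 𝒦) (g : κ → V → ℂ)
    (hg : ∀ i, ContinuousOn (g i) 𝒦) (α : κ → V → (V →L[ℂ] ℂ)) (hα : ∀ i, ContinuousOn (α i) 𝒦)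
    (hli : ∀ x ∈ 𝒦, LinearIndependent ℂ (fun i : {i // g i x = 0} => α i.1 x)) :
    ∃ C > (0:ℝ), ∃ η > (0:ℝ), ∀ x ∈ 𝒦, ∀ w : κ → ℂ, ∃ v : V, ‖v‖ ≤ C * ‖w‖ ∧
      ∀ i, ‖g i x‖ ≤ η → α i x v = w i := by
  classical
  refine h𝒦.induction_on (p := fun S => ∃ C > (0:ℝ), ∃ η > (0:ℝ), ∀ x ∈ S, ∀ w : κ → ℂ, ∃ v : V,
    ‖v‖ ≤ C * ‖w‖ ∧ ∀ i, ‖g i x‖ ≤ η → α i x v = w i) ?_ ?_ ?_ ?_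
  · exact ⟨1, one_pos, 1, one_pos, fun x hx => absurd hx (Set.notMem_empty x)⟩
  · rintro s t hst ⟨C, hC, η, hη, h⟩
    exact ⟨C, hC, η, hη, fun x hx => h x (hst hx)⟩
  · rintro s t ⟨C, hC, η, hη, h⟩ ⟨C', hC', η', hη', h'⟩
    refine ⟨max C C', lt_max_of_lt_left hC, min η η', lt_min hη hη', ?_⟩
    rintro x (hx | hx) w
    · obtain ⟨v, hv, hv2⟩ := h x hx w
      exact ⟨v, hv.trans (by gcongr; exact le_max_left _ _),
        fun i hi => hv2 i (hi.trans (min_le_left _ _))⟩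
    · obtain ⟨v, hv, hv2⟩ := h' x hx w
      exact ⟨v, hv.trans (by gcongr; exact le_max_right _ _),
        fun i hi => hv2 i (hi.trans (min_le_right _ _))⟩
  · intro x0 hx0
    let J := {i // g i x0 = 0}
    let A : V → V →L[ℂ] (J → ℂ) := fun x => ContinuousLinearMap.pi fun j => α j.1 x
    have hsurj : LinearMap.range (A x0 : V →ₗ[ℂ] (J → ℂ)) = ⊤ :=
      surj_of_linInd (fun j : J => α j.1 x0) (hli x0 hx0)
    obtain ⟨R0, hR0⟩ := (A x0 : V →ₗ[ℂ] (J → ℂ)).exists_rightInverse_of_surjective hsurj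
    let R : (J → ℂ) →L[ℂ] V := LinearMap.toContinuousLinearMap R0
    have hAR : (A x0).comp R = 1 := by
      refine ContinuousLinearMap.ext fun w => ?_
      exact congrArg (fun L : (J → ℂ) →ₗ[ℂ] (J → ℂ) => L w) hR0
    let M : V → ((J → ℂ) →L[ℂ] (J → ℂ)) := fun x => (A x).comp R
    have hAc : ContinuousWithinAt A 𝒦 x0 := by
      have h1 : ContinuousWithinAt (fun x => fun j : J => α j.1 x) 𝒦 x0 :=
        continuousWithinAt_pi.2 fun j => hα j.1 x0 hx0
      have h2 : A = fun x => ∑ j : J, (ContinuousLinearMap.toSpanSingleton ℂ (Pi.single j (1:ℂ) : J → ℂ)).comp (α j.1 x) := by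
        funext x
        refine ContinuousLinearMap.ext fun v => ?_
        funext k
        simp [A, Finset.sum_apply, Pi.single_apply]
        rw [Finset.sum_eq_single k]
        · simp
        · intro b _ hb; rw [if_neg hb.symm]
        · simp
      rw [h2]
      refine tendsto_finset_sum _ fun j _ => ?_
      exact (ContinuousLinearMap.compL ℂ V ℂ (J → ℂ) (ContinuousLinearMap.toSpanSingleton ℂ (Pi.single j (1:ℂ) : J → ℂ))).continuous.continuousAt.comp_continuousWithinAt (hα j.1 x0 hx0)
    have hMc : ContinuousWithinAt M 𝒦 x0 :=
      ((ContinuousLinearMap.compL ℂ (J → ℂ) V (J → ℂ)).flip R).continuous.continuousAt.comp_continuousWithinAt hAc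
    have hM0 : M x0 = 1 := hAR
    have hMt : Tendsto M (𝓝[𝒦] x0) (𝓝 1) := by
      have := hMc.tendsto
      rwa [hM0] at this
    have hunit : ∀ᶠ x in 𝓝[𝒦] x0, IsUnit (M x) :=
      hMt.eventually (Units.isOpen.mem_nhds isUnit_one)
    have hinv : ∀ᶠ x in 𝓝[𝒦] x0, ‖Ring.inverse (M x)‖ < ‖(1 : (J → ℂ) →L[ℂ] (J → ℂ))‖ + 1 := by
      have h1 : Tendsto (fun x => ‖Ring.inverse (M x)‖) (𝓝[𝒦] x0)
          (𝓝 ‖(1 : (J → ℂ) →L[ℂ] (J → ℂ))‖) := by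
        have h2 := NormedRing.inverse_continuousAt (1 : ((J → ℂ) →L[ℂ] (J → ℂ))ˣ)
        have h3 := (h2.tendsto.comp (by simpa using hMt)).norm
        simpa using h3
      exact h1.eventually (gt_mem_nhds (by linarith))
    -- eta
    have hη : ∃ η > (0:ℝ), ∀ i, g i x0 ≠ 0 → 2 * η ≤ ‖g i x0‖ := by
      have : ∀ i, ∃ η > (0:ℝ), g i x0 ≠ 0 → 2 * η ≤ ‖g i x0‖ := by
        intro i
        by_cases h : g i x0 = 0
        · exact ⟨1, one_pos, fun h' => absurd h h'⟩
        · exact ⟨‖g i x0‖ / 2, by positivity, fun _ => by linarith⟩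
      choose e he he2 using this
      rcases isEmpty_or_nonempty κ with h | h
      · exact ⟨1, one_pos, fun i => h.elim i⟩
      · refine ⟨Finset.univ.inf' Finset.univ_nonempty e, ?_, fun i hi => ?_⟩
        · rw [gt_iff_lt, Finset.lt_inf'_iff]; exact fun i _ => he i
        · have := Finset.inf'_le e (Finset.mem_univ i)
          linarith [he2 i hi]
    obtain ⟨η, hη0, hη⟩ := hη
    have hgη : ∀ᶠ x in 𝓝[𝒦] x0, ∀ i, g i x0 ≠ 0 → η < ‖g i x‖ := by
      refine Filter.eventually_all.2 fun i => ?_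
      by_cases h : g i x0 = 0
      · exact Filter.Eventually.of_forall fun x h' => absurd h h'
      · have h1 : Tendsto (fun x => ‖g i x‖) (𝓝[𝒦] x0) (𝓝 ‖g i x0‖) := (hg i x0 hx0).norm
        filter_upwards [h1.eventually (lt_mem_nhds (by linarith [hη i h] : η < ‖g i x0‖))] with x hx _
        exact hx
    refine ⟨_, (hunit.and (hinv.and hgη)), ‖R‖ * (‖(1 : (J → ℂ) →L[ℂ] (J → ℂ))‖ + 1) + 1,
      by positivity, η, hη0, ?_⟩
    rintro x ⟨hx1, hx2, hx3⟩ w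
    let wJ : J → ℂ := fun j => w j.1
    have hwJ : ‖wJ‖ ≤ ‖w‖ := by
      rw [pi_norm_le_iff_of_nonneg (norm_nonneg _)]
      exact fun j => norm_le_pi_norm w j.1
    refine ⟨R (Ring.inverse (M x) wJ), ?_, ?_⟩
    · calc ‖R (Ring.inverse (M x) wJ)‖ ≤ ‖R‖ * (‖Ring.inverse (M x)‖ * ‖wJ‖) :=
            (R.le_opNorm _).trans (by gcongr; exact ContinuousLinearMap.le_opNorm _ _)
        _ ≤ ‖R‖ * ((‖(1 : (J → ℂ) →L[ℂ] (J → ℂ))‖ + 1) * ‖w‖) := by gcongr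
        _ ≤ _ := by nlinarith [norm_nonneg w]
    · intro i hi
      have hi0 : g i x0 = 0 := by
        by_contra h
        exact absurd (hx3 i h) (not_lt.2 hi)
      have h1 : M x * Ring.inverse (M x) = 1 := Ring.mul_inverse_cancel _ hx1
      have h2 := congrArg (fun L : (J → ℂ) →L[ℂ] (J → ℂ) => L wJ ⟨i, hi0⟩) h1
      exact h2

end LC

end PartB1

section PartC1
open Metric Filter Topology

section Push
variable {Q V : Type} [MetricSpace Q] [CompactSpace Q] [NormedAddCommGroup V] [NormedSpace ℝ V]

/-- the point `p0` can be pushed to higher values of `Λ` -/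
def Pushable (𝒢 : Set (Q × V)) (Λ : Q × V → ℝ) (p0 : Q × V) : Prop :=
  ∃ N ∈ 𝓝 p0, ∃ c > (0:ℝ), ∃ θ0 > (0:ℝ), ∀ u : C(Q, V), (∀ s, (s, u s) ∈ 𝒢) → ∀ σ > (0:ℝ),
    ∃ e : C(Q, V), (∀ s, ‖e s‖ ≤ 1) ∧ ∀ s, (s, u s) ∈ N → ∀ t, 0 ≤ t → t ≤ θ0 →
      (s, u s + t • e s) ∈ 𝒢 ∧ Λ (s, u s) + c * t ^ 2 - σ ≤ Λ (s, u s + t • e s)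

/-- the homotopy condition -/
def Adm (𝒢 : Set (Q × V)) (B : Set Q) (u0 : C(Q, V)) (w : C(Q, V)) : Prop :=
  (∀ s, (s, w s) ∈ 𝒢) ∧ ∀ s ∈ B, w s = u0 s

lemma homotopicWith_line (P : C(Q, V) → Prop) (u e : C(Q, V))
    (h : ∀ t : ℝ, 0 ≤ t → t ≤ 1 → P (u + t • e)) : ContinuousMap.HomotopicWith u (u + e) P := by
  refine ⟨⟨⟨⟨fun p => u p.2 + (p.1 : ℝ) • e p.2, by fun_prop⟩, ?_, ?_⟩, ?_⟩⟩
  · intro x; simp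
  · intro x; simp
  · intro t
    exact h t t.2.1 t.2.2

lemma pass_aux (𝒢 : Set (Q × V)) (Λ : Q × V → ℝ) (B : Set Q) (u : C(Q, V))
    (hu : ∀ s, (s, u s) ∈ 𝒢) (r c : Q × V → ℝ) (θ σ : ℝ) (hθ : 0 < θ) (hσ : 0 < σ) (M : ℕ)
    (A : Finset (Q × V)) (hM : A.card ≤ M)
    (hr : ∀ a ∈ A, 0 < r a) (hc : ∀ a ∈ A, 0 < c a) (hMθ : ∀ a ∈ A, M * θ ≤ r a / 2)
    (hB : ∀ s ∈ B, ∀ a ∈ A, (s, u s) ∉ ball a (2 * r a))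
    (hpush : ∀ a ∈ A, ∀ u : C(Q, V), (∀ s, (s, u s) ∈ 𝒢) → ∃ e : C(Q, V), (∀ s, ‖e s‖ ≤ 1) ∧
      ∀ s, (s, u s) ∈ ball a (2 * r a) → ∀ t, 0 ≤ t → t ≤ θ →
      (s, u s + t • e s) ∈ 𝒢 ∧ Λ (s, u s) + c a * t ^ 2 - σ ≤ Λ (s, u s + t • e s)) :
    ∃ u' : C(Q, V), ContinuousMap.HomotopicWith u u' (Adm 𝒢 B u) ∧
      (∀ s, ‖u' s - u s‖ ≤ A.card * θ) ∧ (∀ s, Λ (s, u s) - A.card * σ ≤ Λ (s, u' s)) ∧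
      ∀ s, ∀ a ∈ A, (s, u s) ∈ ball a (r a) →
        Λ (s, u s) + c a * θ ^ 2 - A.card * σ ≤ Λ (s, u' s) := by
  classical
  induction A using Finset.induction_on with
  | empty => exact ⟨u, ContinuousMap.HomotopicWith.refl _ ⟨hu, fun s _ => rfl⟩, by simp, by simp, by simp⟩
  | insert a A ha ih =>
    rw [Finset.card_insert_of_notMem ha] at hM ⊢
    obtain ⟨u1, hu1, hd1, hl1, hg1⟩ := ih (by omega) (fun b hb => hr b (by simp [hb]))
      (fun b hb => hc b (by simp [hb])) (fun b hb => hMθ b (by simp [hb]))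
      (fun s hs b hb => hB s hs b (by simp [hb])) (fun b hb => hpush b (by simp [hb]))
    have hadm1 : Adm 𝒢 B u u1 := by
      obtain ⟨H⟩ := hu1
      have := H.prop' 1
      convert this using 1
      ext s; simp
    have hra := hr a (by simp)
    have hca := hc a (by simp)
    obtain ⟨e, he1, he⟩ := hpush a (by simp) u1 hadm1.1
    let χ : C(Q, ℝ) := ⟨fun s => max 0 (min 1 (3 - 2 * dist (s, u s) a / r a)), by fun_prop⟩
    have hχ0 : ∀ s, 0 ≤ χ s := fun s => le_max_left _ _
    have hχ1 : ∀ s, χ s ≤ 1 := fun s => max_le zero_le_one (min_le_left _ _)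
    have hχin : ∀ s, (s, u s) ∈ ball a (r a) → χ s = 1 := by
      intro s hs
      have : 2 * dist (s, u s) a / r a ≤ 2 := by
        rw [div_le_iff₀ hra]
        have := mem_ball.1 hs
        linarith
      change max 0 (min 1 (3 - 2 * dist (s, u s) a / r a)) = 1
      rw [min_eq_left (by linarith), max_eq_right zero_le_one]
    have hχout : ∀ s, 3 / 2 * r a ≤ dist (s, u s) a → χ s = 0 := by
      intro s hs
      have : 3 ≤ 2 * dist (s, u s) a / r a := by
        rw [le_div_iff₀ hra]
        linarith
      change max 0 (min 1 (3 - 2 * dist (s, u s) a / r a)) = 0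
      exact max_eq_left ((min_le_right _ _).trans (by linarith))
    have hcardθ : (A.card : ℝ) * θ ≤ r a / 2 := by
      refine le_trans ?_ (hMθ a (by simp))
      have : (A.card : ℝ) ≤ M := by exact_mod_cast (by omega : A.card ≤ M)
      gcongr
    have hdist : ∀ s, dist (s, u1 s) (s, u s) ≤ A.card * θ := by
      intro s
      rw [Prod.dist_eq, dist_self, max_eq_right dist_nonneg, dist_eq_norm]
      exact hd1 s
    have hin2 : ∀ s, χ s ≠ 0 → (s, u1 s) ∈ ball a (2 * r a) := by
      intro s hs
      have h1 : dist (s, u s) a < 3 / 2 * r a := by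
        by_contra h
        exact hs (hχout s (not_lt.1 h))
      rw [mem_ball]
      calc dist (s, u1 s) a ≤ dist (s, u1 s) (s, u s) + dist (s, u s) a := dist_triangle _ _ _
        _ < 2 * r a := by linarith [hdist s]
    have hmove : ∀ s, ∀ t, 0 ≤ t → t ≤ 1 → (s, u1 s + (t * (θ * χ s)) • e s) ∈ 𝒢 ∧
        Λ (s, u1 s) + c a * (t * (θ * χ s)) ^ 2 - σ ≤ Λ (s, u1 s + (t * (θ * χ s)) • e s) := by
      intro s t ht0 ht1
      by_cases h : χ s = 0
      · simp only [h, mul_zero, zero_smul, add_zero]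
        refine ⟨hadm1.1 s, ?_⟩
        simp; linarith
      · have h0 := hχ0 s
        refine he s (hin2 s h) _ (by positivity) ?_
        have h1 := hχ1 s
        calc t * (θ * χ s) ≤ 1 * (θ * 1) := by gcongr
          _ = θ := by ring
    let e' : C(Q, V) := ⟨fun s => (θ * χ s) • e s, by fun_prop⟩
    have he' : ∀ s, e' s = (θ * χ s) • e s := fun s => rfl
    refine ⟨u1 + e', hu1.trans (homotopicWith_line _ _ _ ?_), ?_, ?_, ?_⟩
    · intro t ht0 ht1
      refine ⟨fun s => ?_, fun s hs => ?_⟩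
      · have := (hmove s t ht0 ht1).1
        simpa [he', smul_smul] using this
      · have h1 : χ s = 0 := by
          by_contra h
          have h2 := hin2 s h
          rw [hadm1.2 s hs] at h2
          exact hB s hs a (by simp) h2
        simp [he', h1, hadm1.2 s hs]
    · intro s
      have h1 : ‖e' s‖ ≤ θ := by
        rw [he', norm_smul, Real.norm_of_nonneg (mul_nonneg hθ.le (hχ0 s))]
        calc θ * χ s * ‖e s‖ ≤ θ * 1 * 1 := by
              gcongr
              · exact hχ1 s
              · exact he1 s
          _ = θ := by ring
      have h2 : (u1 + e') s - u s = (u1 s - u s) + e' s := by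
        rw [ContinuousMap.add_apply]; abel
      rw [h2]
      push_cast
      have := norm_add_le (u1 s - u s) (e' s)
      linarith [hd1 s]
    · intro s
      have h1 := (hmove s 1 zero_le_one le_rfl).2
      rw [one_mul] at h1
      have h3 : 0 ≤ c a * (θ * χ s) ^ 2 := by positivity
      have h4 := hl1 s
      rw [ContinuousMap.add_apply, he']
      push_cast
      linarith
    · intro s b hb hsb
      have h1 := (hmove s 1 zero_le_one le_rfl).2
      rw [one_mul] at h1
      rw [ContinuousMap.add_apply, he']
      push_cast
      rcases Finset.mem_insert.1 hb with rfl | hb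
      · have h4 := hl1 s
        rw [hχin s hsb, mul_one] at h1 ⊢
        linarith
      · have h3 : 0 ≤ c a * (θ * χ s) ^ 2 := by positivity
        have h4 := hg1 s b hb hsb
        linarith

theorem push_theorem (𝒢 : Set (Q × V)) (Λ : Q × V → ℝ) (hΛ : ContinuousOn Λ 𝒢) (lo hi1 hi2 hi3 : ℝ)
    (h12 : hi1 < hi2) (h23 : hi2 < hi3)
    (hK : IsCompact {p ∈ 𝒢 | lo ≤ Λ p ∧ Λ p ≤ hi2})
    (hpush : ∀ p ∈ 𝒢, lo ≤ Λ p → Λ p ≤ hi2 → Pushable 𝒢 Λ p)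
    (u : C(Q, V)) (hu : ∀ s, (s, u s) ∈ 𝒢) (hlo : ∀ s, lo ≤ Λ (s, u s)) :
    ∃ u' : C(Q, V), ContinuousMap.HomotopicWith u u' (Adm 𝒢 {s | hi3 ≤ Λ (s, u s)} u) ∧
      ∀ s, hi1 ≤ Λ (s, u' s) := by
  classical
  set K := {p ∈ 𝒢 | lo ≤ Λ p ∧ Λ p ≤ hi2} with hKdef
  have hball : ∀ p ∈ K, ∃ r > (0:ℝ), ∃ c > (0:ℝ), ∃ θ0 > (0:ℝ),
      (∀ q ∈ ball p (2 * r), q ∈ 𝒢 → Λ q < hi3) ∧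
      ∀ u : C(Q, V), (∀ s, (s, u s) ∈ 𝒢) → ∀ σ > (0:ℝ),
      ∃ e : C(Q, V), (∀ s, ‖e s‖ ≤ 1) ∧ ∀ s, (s, u s) ∈ ball p (2 * r) → ∀ t, 0 ≤ t → t ≤ θ0 →
      (s, u s + t • e s) ∈ 𝒢 ∧ Λ (s, u s) + c * t ^ 2 - σ ≤ Λ (s, u s + t • e s) := by
    rintro p ⟨hp, hp1, hp2⟩
    obtain ⟨N, hN, c, hc, θ0, hθ0, h⟩ := hpush p hp hp1 hp2
    have h1 : ∀ᶠ q in 𝓝 p, q ∈ 𝒢 → Λ q < hi3 :=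
      eventually_nhdsWithin_iff.1 ((hΛ p hp).eventually (gt_mem_nhds (hp2.trans_lt h23)))
    obtain ⟨R, hR, hball⟩ := Metric.eventually_nhds_iff_ball.1 (h1.and hN)
    refine ⟨R / 2, by positivity, c, hc, θ0, hθ0, ?_, ?_⟩
    · intro q hq
      rw [mul_div_cancel₀ R two_ne_zero] at hq
      exact (hball q hq).1
    · intro u hu σ hσ
      obtain ⟨e, he1, he⟩ := h u hu σ hσ
      refine ⟨e, he1, fun s hs => he s ?_⟩
      rw [mul_div_cancel₀ R two_ne_zero] at hs
      exact (hball _ hs).2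
  choose! r hr c hc θ0 hθ0 hlt hp using hball
  obtain ⟨A, hAK, hcov⟩ := hK.elim_nhds_subcover (fun p => ball p (r p))
    fun p hp => ball_mem_nhds p (hr p hp)
  -- constants
  have hminpos : ∀ φ : Q × V → ℝ, (∀ a ∈ A, 0 < φ a) → ∃ m > (0:ℝ), ∀ a ∈ A, m ≤ φ a := by
    intro φ hφ
    rcases A.eq_empty_or_nonempty with h | h
    · exact ⟨1, one_pos, by simp [h]⟩
    · exact ⟨A.inf' h φ, (Finset.lt_inf'_iff h).2 hφ, fun a ha => Finset.inf'_le φ ha⟩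
  obtain ⟨m1, hm1, hm1'⟩ := hminpos θ0 fun a ha => hθ0 a (hAK a ha)
  obtain ⟨m2, hm2, hm2'⟩ := hminpos r fun a ha => hr a (hAK a ha)
  obtain ⟨m3, hm3, hm3'⟩ := hminpos c fun a ha => hc a (hAK a ha)
  set M := A.card with hM
  set θ := min m1 (m2 / (2 * (M + 1))) with hθdef
  have hθ : 0 < θ := lt_min hm1 (by positivity)
  set κ := min (m3 * θ ^ 2 / 2) (hi2 - hi1) with hκdef
  have hκ : 0 < κ := lt_min (by positivity) (by linarith)
  set σ := κ / (M + 1) with hσdef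
  have hσ : 0 < σ := by positivity
  have hMσ : M * σ ≤ κ := by
    rw [hσdef, mul_div_assoc', div_le_iff₀ (by positivity)]
    nlinarith
  have hpass : ∀ (w : C(Q, V)) (ℓ : ℝ), lo ≤ ℓ → Adm 𝒢 {s | hi3 ≤ Λ (s, u s)} u w →
      (∀ s, ℓ ≤ Λ (s, w s)) → ∃ w' : C(Q, V),
        ContinuousMap.HomotopicWith w w' (Adm 𝒢 {s | hi3 ≤ Λ (s, u s)} u) ∧
        ∀ s, min (ℓ + κ) hi1 ≤ Λ (s, w' s) := by
    intro w ℓ hℓ hw hwℓ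
    obtain ⟨w', hh, -, hl, hg⟩ := pass_aux 𝒢 Λ {s | hi3 ≤ Λ (s, u s)} w hw.1 r c θ σ hθ hσ M A le_rfl
      (fun a ha => hr a (hAK a ha)) (fun a ha => hc a (hAK a ha)) (by
        intro a ha
        have h1 : θ ≤ m2 / (2 * (M + 1)) := min_le_right _ _
        calc M * θ ≤ M * (m2 / (2 * (M + 1))) := by gcongr
          _ ≤ m2 / 2 := by
            rw [mul_div_assoc', div_le_div_iff₀ (by positivity) (by positivity)]
            nlinarith
          _ ≤ r a / 2 := by linarith [hm2' a ha]) (by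
        intro s hs a ha hcon
        have h1 := hlt a (hAK a ha) _ hcon (hw.1 s)
        rw [hw.2 s hs] at h1
        exact absurd h1 (not_lt.2 hs)) (by
        intro a ha v hv
        obtain ⟨e, he1, he⟩ := hp a (hAK a ha) v hv σ hσ
        exact ⟨e, he1, fun s hs t ht0 ht1 => he s hs t ht0
          (ht1.trans ((min_le_left _ _).trans (hm1' a ha)))⟩)
    refine ⟨w', ?_, fun s => ?_⟩
    · obtain ⟨H⟩ := hh
      exact ⟨⟨H.toHomotopy, fun t => ⟨(H.prop' t).1, fun s hs => ((H.prop' t).2 s hs).trans (hw.2 s hs)⟩⟩⟩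
    · by_cases h : Λ (s, w s) ≤ hi2
      · have h1 : (s, w s) ∈ K := ⟨hw.1 s, hℓ.trans (hwℓ s), h⟩
        obtain ⟨a, ha, hsa⟩ := Set.mem_iUnion₂.1 (hcov h1)
        have h2 := hg s a ha hsa
        have h3 : κ ≤ m3 * θ ^ 2 / 2 := min_le_left _ _
        have h4 : m3 * θ ^ 2 ≤ c a * θ ^ 2 := by gcongr; exact hm3' a ha
        refine (min_le_left _ _).trans ?_
        linarith [hwℓ s]
      · have h2 := hl s
        have h3 : κ ≤ hi2 - hi1 := min_le_right _ _
        refine (min_le_right _ _).trans ?_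
        linarith
  have hiter : ∀ j : ℕ, ∃ w' : C(Q, V),
      ContinuousMap.HomotopicWith u w' (Adm 𝒢 {s | hi3 ≤ Λ (s, u s)} u) ∧
        ∀ s, min (lo + j * κ) hi1 ≤ Λ (s, w' s) := by
    intro j
    induction j with
    | zero =>
      refine ⟨u, ContinuousMap.HomotopicWith.refl _ ⟨hu, fun s _ => rfl⟩, fun s => ?_⟩
      simp only [Nat.cast_zero, zero_mul, add_zero]
      exact (min_le_left _ _).trans (hlo s)
    | succ j ih =>
      obtain ⟨w, hw, hwl⟩ := ih
      by_cases hcase : hi1 ≤ lo + j * κ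
      · refine ⟨w, hw, fun s => ?_⟩
        have := hwl s
        rw [min_eq_right hcase] at this
        exact (min_le_right _ _).trans this
      · push Not at hcase
        have hadm : Adm 𝒢 {s | hi3 ≤ Λ (s, u s)} u w := by
          obtain ⟨H⟩ := hw
          have := H.prop' 1
          convert this using 1
          ext s; simp
        obtain ⟨w', hw', hl'⟩ := hpass w (lo + j * κ) (by
          have : 0 ≤ (j:ℝ) * κ := by positivity
          linarith) hadm (fun s => by
            have := hwl s
            rwa [min_eq_left hcase.le] at this)
        refine ⟨w', hw.trans hw', fun s => ?_⟩
        have := hl' s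
        push_cast
        rwa [show lo + (j + 1) * κ = lo + j * κ + κ by ring]
  obtain ⟨j, hj⟩ := exists_nat_gt ((hi1 - lo) / κ)
  obtain ⟨w, hw, hwl⟩ := hiter j
  refine ⟨w, hw, fun s => ?_⟩
  have h1 : hi1 ≤ lo + j * κ := by
    rw [div_lt_iff₀ hκ] at hj
    linarith
  have := hwl s
  rwa [min_eq_right h1] at this

end Push

end PartC1

section PartC2
open Metric Filter Topology

section Grad

lemma grad_aux {E : Type*} [NormedAddCommGroup E] [NormedSpace ℝ E] (L : E → ℝ) (L' : E →L[ℝ] ℝ) (z0 : E)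
    (h : HasStrictFDerivAt L L' z0) (v : E) (hv : 0 < L' v) :
    ∃ c > (0:ℝ), ∃ θ0 > (0:ℝ), ∀ᶠ z in 𝓝 z0, ∀ t : ℝ, 0 ≤ t → t ≤ θ0 → L z + c * t ≤ L (z + t • v) := by
  have hvn : 0 < ‖v‖ := by
    rw [norm_pos_iff]; rintro rfl; simp at hv
  set κ := L' v / (2 * ‖v‖) with hκ
  have hκ0 : 0 < κ := by positivity
  have h1 := h.isLittleO.def hκ0
  obtain ⟨ρ, hρ, hρ'⟩ := Metric.eventually_nhds_iff_ball.1 h1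
  refine ⟨L' v / 2, by positivity, ρ / (2 * ‖v‖), by positivity, ?_⟩
  filter_upwards [ball_mem_nhds z0 (half_pos hρ)] with z hz t ht ht'
  have hz1 : dist z z0 < ρ / 2 := hz
  have htv : ‖t • v‖ ≤ ρ / 2 := by
    rw [norm_smul, Real.norm_of_nonneg ht]
    calc t * ‖v‖ ≤ ρ / (2 * ‖v‖) * ‖v‖ := by gcongr
      _ = ρ / 2 := by field_simp
  have h2 := hρ' (z + t • v, z) (by
    rw [mem_ball, Prod.dist_eq]
    apply max_lt
    · calc dist (z + t • v) z0 ≤ dist (z + t • v) z + dist z z0 := dist_triangle _ _ _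
        _ < ρ / 2 + ρ / 2 := by
          have : dist (z + t • v) z = ‖t • v‖ := by simp [dist_eq_norm]
          rw [this]; linarith
        _ = ρ := by ring
    · exact hz1.trans (by linarith))
  simp only [add_sub_cancel_left, map_smul, smul_eq_mul, norm_smul, Real.norm_of_nonneg ht] at h2
  have h3 : κ * (t * ‖v‖) = L' v / 2 * t := by rw [hκ]; field_simp
  rw [h3, Real.norm_eq_abs, abs_le] at h2
  linarith [h2.1]

variable {Q V T : Type} [MetricSpace Q] [CompactSpace Q] [NormedAddCommGroup V] [NormedSpace ℝ V]
  [TopologicalSpace T]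

lemma pushable_of_dir (τ : C(Q, T)) (G : Set (T × V)) (L : T × V → ℝ) (p0 : Q × V) (v : V)
    (c θ0 : ℝ) (hc : 0 < c) (hθ : 0 < θ0)
    (h : ∀ᶠ z in 𝓝 (τ p0.1, p0.2), z ∈ G → ∀ t : ℝ, 0 ≤ t → t ≤ θ0 →
      (z.1, z.2 + t • v) ∈ G ∧ L z + c * t ≤ L (z.1, z.2 + t • v)) :
    Pushable {p : Q × V | (τ p.1, p.2) ∈ G} (fun p => L (τ p.1, p.2)) p0 := by
  have hcont : ContinuousAt (fun p : Q × V => (τ p.1, p.2)) p0 := by fun_prop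
  set a := (1 + ‖v‖)⁻¹ with ha
  have ha0 : 0 < a := by positivity
  have ha1 : a ≤ 1 := by
    rw [ha]; apply inv_le_one_of_one_le₀; linarith [norm_nonneg v]
  refine ⟨_, hcont.eventually h, c * a, by positivity, min θ0 1, by positivity, ?_⟩
  intro u hu σ hσ
  refine ⟨ContinuousMap.const _ (a • v), ?_, ?_⟩
  · intro s
    simp only [ContinuousMap.const_apply, norm_smul, Real.norm_of_nonneg ha0.le]
    rw [ha, inv_mul_le_one₀ (by positivity)]; linarith
  · intro s hs t ht ht'
    have h1 := hs (hu s) (t * a) (by positivity) (by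
      calc t * a ≤ t * 1 := by gcongr
        _ ≤ θ0 := by rw [mul_one]; exact ht'.trans (min_le_left _ _))
    simp only [ContinuousMap.const_apply, smul_smul, Set.mem_setOf_eq]
    refine ⟨h1.1, ?_⟩
    have h2 := h1.2
    have h3 : t ≤ 1 := ht'.trans (min_le_right _ _)
    have h4 : c * a * t ^ 2 ≤ c * (t * a) := by
      have : t ^ 2 ≤ t := by nlinarith
      calc c * a * t ^ 2 ≤ c * a * t := by gcongr
        _ = _ := by ring
    dsimp only at h2
    linarith

end Grad

end PartC2

section PartD1
open Metric Filter Topology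

section Slice

lemma taylor2 {W : Type*} [NormedAddCommGroup W] [NormedSpace ℂ W] (Φ : W → ℂ) (z0 : W)
    (hΦ : AnalyticAt ℂ Φ z0) (κ : ℝ) (hκ : 0 < κ) :
    ∃ ρ > (0:ℝ), ∀ z ∈ ball z0 ρ, ∀ h : W, ‖h‖ < ρ →
      ‖Φ (z + h) - Φ z - fderiv ℂ Φ z h - (1/2 : ℂ) * fderiv ℂ (fderiv ℂ Φ) z0 h h‖ ≤ κ * ‖h‖ ^ 2 := by
  have h1 := (hΦ.fderiv.hasStrictFDerivAt).isLittleO.def hκ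
  obtain ⟨ρ1, hρ1, hb1⟩ := Metric.eventually_nhds_iff_ball.1 h1
  obtain ⟨ρ2, hρ2, hb2⟩ := Metric.eventually_nhds_iff_ball.1 hΦ.eventually_analyticAt
  refine ⟨min ρ1 ρ2 / 2, by positivity, ?_⟩
  intro z hz h hh
  set B := fderiv ℂ (fderiv ℂ Φ) z0
  have hseg : ∀ r ∈ Set.Icc (0:ℝ) 1, dist (z + (r:ℂ) • h) z0 < min ρ1 ρ2 := by
    intro r hr
    have : dist (z + (r:ℂ) • h) z ≤ ‖h‖ := by
      rw [dist_eq_norm, add_sub_cancel_left, norm_smul, Complex.norm_real, Real.norm_of_nonneg hr.1]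
      nlinarith [norm_nonneg h, hr.2]
    calc _ ≤ dist (z + (r:ℂ) • h) z + dist z z0 := dist_triangle _ _ _
      _ < min ρ1 ρ2 / 2 + min ρ1 ρ2 / 2 := by
        have := mem_ball.1 hz
        linarith
      _ = _ := by ring
  have hd : ∀ r ∈ Set.Icc (0:ℝ) 1, HasDerivWithinAt
      (fun r : ℝ => Φ (z + (r:ℂ) • h) - (r:ℂ) * fderiv ℂ Φ z h - ((r:ℂ)^2/2) * B h h)
      (fderiv ℂ Φ (z + (r:ℂ) • h) h - fderiv ℂ Φ z h - (r:ℂ) * B h h) (Set.Icc 0 1) r := by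
    intro r hr
    apply HasDerivAt.hasDerivWithinAt
    have hline : HasDerivAt (fun w : ℂ => z + w • h) h (r:ℂ) := by
      simpa using ((hasDerivAt_id (r:ℂ)).smul_const h).const_add z
    have hA : AnalyticAt ℂ Φ (z + (r:ℂ) • h) :=
      hb2 _ (mem_ball.2 ((hseg r hr).trans_le (min_le_right _ _)))
    have h3 := (hA.differentiableAt.hasFDerivAt.comp_hasDerivAt (r:ℂ) hline)
    have h4 : HasDerivAt (fun w : ℂ => w * fderiv ℂ Φ z h) (fderiv ℂ Φ z h) (r:ℂ) := by
      simpa using (hasDerivAt_id (r:ℂ)).mul_const (fderiv ℂ Φ z h)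
    have h5 : HasDerivAt (fun w : ℂ => w^2/2 * B h h) ((r:ℂ) * B h h) (r:ℂ) := by
      have := (((hasDerivAt_id (r:ℂ)).pow 2).div_const 2).mul_const (B h h)
      simp only [id] at this
      exact this.congr_deriv (by push_cast; ring)
    have h6 := (h3.sub h4).sub h5
    exact h6.comp_ofReal
  have hbd : ∀ r ∈ Set.Ico (0:ℝ) 1, ‖fderiv ℂ Φ (z + (r:ℂ) • h) h - fderiv ℂ Φ z h - (r:ℂ) * B h h‖ ≤ κ * ‖h‖^2 := by
    intro r hr
    have h3 := hb1 (z + (r:ℂ) • h, z) (by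
      rw [mem_ball, Prod.dist_eq]
      apply max_lt
      · exact (hseg r ⟨hr.1, hr.2.le⟩).trans_le (min_le_left _ _)
      · have := hseg 0 ⟨le_rfl, zero_le_one⟩
        simp only [Complex.ofReal_zero, zero_smul, add_zero] at this
        exact this.trans_le (min_le_left _ _))
    simp only [add_sub_cancel_left] at h3
    have h4 : fderiv ℂ Φ (z + (r:ℂ) • h) h - fderiv ℂ Φ z h - (r:ℂ) * B h h
        = (fderiv ℂ Φ (z + (r:ℂ) • h) - fderiv ℂ Φ z - B ((r:ℂ) • h)) h := by
      simp
    rw [h4]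
    calc _ ≤ ‖fderiv ℂ Φ (z + (r:ℂ) • h) - fderiv ℂ Φ z - B ((r:ℂ) • h)‖ * ‖h‖ :=
          ContinuousLinearMap.le_opNorm _ _
      _ ≤ (κ * ‖(r:ℂ) • h‖) * ‖h‖ := by gcongr
      _ ≤ (κ * ‖h‖) * ‖h‖ := by
        gcongr
        rw [norm_smul, Complex.norm_real, Real.norm_of_nonneg hr.1]
        nlinarith [norm_nonneg h, hr.2]
      _ = _ := by ring
  have h7 := norm_image_sub_le_of_norm_deriv_le_segment_01' hd hbd
  simp only [Complex.ofReal_one, Complex.ofReal_zero, one_smul, zero_smul, add_zero, one_mul, zero_mul] at h7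
  have e1 : Φ (z + h) - Φ z - fderiv ℂ Φ z h - (1/2 : ℂ) * B h h
      = Φ (z + h) - fderiv ℂ Φ z h - 1 ^ 2 / 2 * B h h - (Φ z - 0 - 0 ^ 2 / 2 * B h h) := by ring
  rw [e1]
  simpa using h7

/-- a basis in which a symmetric bilinear form is diagonal with nonnegative entries -/
lemma diag_basis {m : ℕ} (B : LinearMap.BilinForm ℂ (EuclideanSpace ℂ (Fin m))) (hB : LinearMap.IsSymm B) :
    ∃ b : Fin m → EuclideanSpace ℂ (Fin m), LinearIndependent ℂ b ∧
      ∀ i j, 0 ≤ (B (b i) (b j)).re ∧ (i ≠ j → B (b i) (b j) = 0) := by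
  haveI : Invertible (2:ℂ) := invertibleOfNonzero two_ne_zero
  obtain ⟨v, hv⟩ := LinearMap.BilinForm.exists_orthogonal_basis hB
  have hfr : Module.finrank ℂ (EuclideanSpace ℂ (Fin m)) = m := by simp
  let w : Module.Basis (Fin m) ℂ (EuclideanSpace ℂ (Fin m)) := v.reindex (finCongr hfr)
  have hw : ∀ i j, i ≠ j → B (w i) (w j) = 0 := by
    intro i j hij
    have := (LinearMap.isOrthoᵢ_def.1 hv) ((finCongr hfr).symm i) ((finCongr hfr).symm j)
      (by simpa using hij)
    simpa [w] using this
  let c : Fin m → ℂ := fun i => Complex.exp (-(Complex.arg (B (w i) (w i)) / 2 : ℝ) * Complex.I)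
  have hc : ∀ i, c i ≠ 0 := fun i => Complex.exp_ne_zero _
  refine ⟨fun i => c i • w i, ?_, ?_⟩
  · have := w.linearIndependent.units_smul (fun i => Units.mk0 (c i) (hc i))
    exact this
  · intro i j
    have hne : i ≠ j → B (c i • w i) (c j • w j) = 0 := by
      intro hij; simp [hw i j hij]
    refine ⟨?_, hne⟩
    by_cases hij : i = j
    · subst hij
      have h1 : B (c i • w i) (c i • w i) = (‖B (w i) (w i)‖ : ℂ) := by
        simp only [map_smul, LinearMap.smul_apply, smul_eq_mul]
        conv_lhs => rw [← Complex.norm_mul_exp_arg_mul_I (B (w i) (w i))]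
        simp only [c]
        rw [show ∀ a b d : ℂ, a * (a * (b * d)) = b * (a * a * d) from fun a b d => by ring]
        rw [← Complex.exp_add, ← Complex.exp_add]
        rw [show (-((Complex.arg (B (w i) (w i)) / 2 : ℝ) : ℂ) * Complex.I + -((Complex.arg (B (w i) (w i)) / 2 : ℝ) : ℂ) * Complex.I
          + (Complex.arg (B (w i) (w i)) : ℂ) * Complex.I) = 0 by push_cast; ring]
        simp
      rw [h1]; simp
    · rw [hne hij]; simp

end Slice

end PartD1

section PartD2
open Metric Filter Topology

section Slice

lemma slice_est {m : ℕ} (Φ : ℂ × EuclideanSpace ℂ (Fin m) → ℂ) (z0 : ℂ × EuclideanSpace ℂ (Fin m))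
    (hΦ : AnalyticAt ℂ Φ z0) (δ : ℝ) (hδ : 0 < δ) :
    ∃ ι : EuclideanSpace ℝ (Fin m) →L[ℝ] EuclideanSpace ℂ (Fin m), ∃ c > (0:ℝ), ∃ ρ > (0:ℝ),
    ∃ y : ℂ × EuclideanSpace ℂ (Fin m) → EuclideanSpace ℝ (Fin m), ContinuousOn y (closedBall z0 ρ) ∧
      ∀ z ∈ closedBall z0 ρ, ∀ e, ‖e‖ ≤ ρ →
        (Φ z).re + δ * ‖z.2‖ ^ 2 + inner ℝ (y z) e + c * ‖e‖ ^ 2 ≤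
          (Φ (z.1, z.2 + ι e)).re + δ * ‖z.2 + ι e‖ ^ 2 := by
  classical
  set B2 := fderiv ℂ (fderiv ℂ Φ) z0 with hB2
  have hsymm : ∀ v w, B2 v w = B2 w v := by
    have h1 : IsSymmSndFDerivAt ℂ Φ z0 := by
      apply ContDiffAt.isSymmSndFDerivAt (n := ⊤) hΦ.contDiffAt
      simp
    exact h1
  let B : LinearMap.BilinForm ℂ (EuclideanSpace ℂ (Fin m)) := LinearMap.mk₂ ℂ (fun v w : EuclideanSpace ℂ (Fin m) => B2 ((0:ℂ), v) ((0:ℂ), w))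
    (by
      intro a b c
      rw [← add_apply, ← map_add]; simp)
    (by
      intro a b c
      rw [← smul_apply, ← map_smul]; simp)
    (by
      intro a b c
      rw [← map_add]; simp)
    (by
      intro a b c
      rw [← map_smul]; simp)
  have hB : LinearMap.IsSymm B := ⟨fun v w => by simp [B, hsymm (0, v) (0, w)]⟩
  obtain ⟨b, hb, hbB⟩ := diag_basis B hB
  let ι : EuclideanSpace ℝ (Fin m) →L[ℝ] EuclideanSpace ℂ (Fin m) := ∑ j, (EuclideanSpace.proj j : EuclideanSpace ℝ (Fin m) →L[ℝ] ℝ).smulRight (b j)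
  have hι : ∀ e, ι e = ∑ j, ((e j : ℝ) : ℂ) • b j := by
    intro e
    simp only [ι, sum_apply, ContinuousLinearMap.smulRight_apply]
    refine Finset.sum_congr rfl fun j _ => ?_
    ext i
    simp
  have hker : LinearMap.ker (ι : EuclideanSpace ℝ (Fin m) →ₗ[ℝ] EuclideanSpace ℂ (Fin m)) = ⊥ := by
    rw [LinearMap.ker_eq_bot']
    intro e he
    have he' : ∑ j, ((e j : ℝ) : ℂ) • b j = 0 := by rw [← hι]; exact he
    have := Fintype.linearIndependent_iff.1 hb _ he'
    ext j
    simpa using this j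
  obtain ⟨K, hK, hKa⟩ := LinearMap.exists_antilipschitzWith _ hker
  have hK' : ∀ e, ‖e‖ ≤ K * ‖ι e‖ := by
    intro e
    have := hKa.le_mul_dist e 0
    simpa using this
  have hBpos : ∀ e, 0 ≤ (B (ι e) (ι e)).re := by
    intro e
    rw [hι]
    simp only [map_sum, LinearMap.sum_apply, map_smul, LinearMap.smul_apply, smul_eq_mul, Finset.mul_sum, Complex.re_sum]
    refine Finset.sum_nonneg fun i _ => Finset.sum_nonneg fun j _ => ?_
    by_cases hij : i = j
    · subst hij
      rw [← mul_assoc, ← Complex.ofReal_mul, Complex.re_ofReal_mul]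
      exact mul_nonneg (mul_self_nonneg _) (hbB _ _).1
    · first
        | rw [(hbB i j).2 hij]; simp
        | rw [(hbB j i).2 (Ne.symm hij)]; simp
  obtain ⟨ρ1, hρ1, hT⟩ := taylor2 Φ z0 hΦ (δ/2) (by positivity)
  obtain ⟨ρ2, hρ2, hb2⟩ := Metric.eventually_nhds_iff_ball.1 hΦ.eventually_analyticAt
  set ρ := min (ρ1 / (2 * (1 + ‖ι‖))) (ρ2 / 2) with hρ
  have hρ0 : 0 < ρ := by positivity
  have hρa : ρ < ρ1 := by
    refine (min_le_left _ _).trans_lt ?_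
    rw [div_lt_iff₀ (by positivity)]
    nlinarith [norm_nonneg ι]
  have hρb : ρ < ρ2 := (min_le_right _ _).trans_lt (by linarith)
  let y : ℂ × EuclideanSpace ℂ (Fin m) → EuclideanSpace ℝ (Fin m) := fun z => WithLp.toLp 2 fun j =>
    (fderiv ℂ Φ z ((0:ℂ), b j)).re + 2 * δ * (inner ℂ z.2 (b j)).re
  have hy : ∀ z e, inner ℝ (y z) e = (fderiv ℂ Φ z ((0:ℂ), ι e)).re + 2 * δ * (inner ℂ z.2 (ι e)).re := by
    intro z e
    rw [hι]
    have h1 : (((0:ℂ), ∑ j, ((e j : ℝ) : ℂ) • b j) : ℂ × EuclideanSpace ℂ (Fin m)) = ∑ j, ((e j : ℝ) : ℂ) • (((0:ℂ), b j) : ℂ × EuclideanSpace ℂ (Fin m)) := by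
      ext1
      · simp [Prod.fst_sum]
      · simp [Prod.snd_sum]
    rw [h1, map_sum, inner_sum, Complex.re_sum, Complex.re_sum, Finset.mul_sum, ← Finset.sum_add_distrib,
      PiLp.inner_apply]
    refine Finset.sum_congr rfl fun j _ => ?_
    rw [map_smul, inner_smul_right, smul_eq_mul, Complex.re_ofReal_mul, Complex.re_ofReal_mul]
    simp only [y, RCLike.inner_apply, conj_trivial]
    ring
  refine ⟨ι, δ / 2 / K ^ 2, by have : (0:ℝ) < K := hK
                               positivity, ρ, hρ0, y, ?_, ?_⟩
  · have hA : ContinuousOn (fderiv ℂ Φ) (closedBall z0 ρ) := by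
      intro z hz
      have : AnalyticAt ℂ Φ z := hb2 z (mem_ball.2 ((mem_closedBall.1 hz).trans_lt hρb))
      exact this.fderiv.continuousAt.continuousWithinAt
    apply (PiLp.continuous_toLp 2 _).comp_continuousOn
    rw [continuousOn_pi]
    intro j
    refine ContinuousOn.add ?_ ?_
    · exact Complex.continuous_re.comp_continuousOn (hA.clm_apply continuousOn_const)
    · refine continuousOn_const.mul (Complex.continuous_re.comp_continuousOn ?_)
      exact (Continuous.inner continuous_snd continuous_const).continuousOn
  · intro z hz e he
    have hιe : ‖ι e‖ < ρ1 := by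
      calc ‖ι e‖ ≤ ‖ι‖ * ‖e‖ := ι.le_opNorm e
        _ ≤ (1 + ‖ι‖) * ρ := by gcongr; linarith
        _ ≤ (1 + ‖ι‖) * (ρ1 / (2 * (1 + ‖ι‖))) := by gcongr; exact min_le_left _ _
        _ = ρ1 / 2 := by field_simp
        _ < ρ1 := by linarith
    have hn : ‖(((0:ℂ), ι e) : ℂ × EuclideanSpace ℂ (Fin m))‖ = ‖ι e‖ := by simp [Prod.norm_def]
    have h1 := hT z (mem_ball.2 ((mem_closedBall.1 hz).trans_lt hρa)) (0, ι e) (by rw [hn]; exact hιe)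
    rw [hn] at h1
    have hz' : z + (0, ι e) = (z.1, z.2 + ι e) := by ext1 <;> simp
    rw [hz'] at h1
    have h2 := (abs_le.1 ((Complex.abs_re_le_norm _).trans h1)).1
    have h3 : ((1/2 : ℂ) * B2 (0, ι e) (0, ι e)).re = 1/2 * (B (ι e) (ι e)).re := by
      have : ((1/2 : ℂ)) = ((1/2 : ℝ) : ℂ) := by norm_num
      rw [this, Complex.re_ofReal_mul]
      rfl
    simp only [Complex.sub_re] at h2
    rw [h3] at h2
    have h4 := hBpos e
    have h5 : ‖z.2 + ι e‖ ^ 2 = ‖z.2‖ ^ 2 + 2 * (inner ℂ z.2 (ι e)).re + ‖ι e‖ ^ 2 :=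
      norm_add_sq (𝕜 := ℂ) z.2 (ι e)
    have h6 : δ / 2 / K ^ 2 * ‖e‖ ^ 2 ≤ δ / 2 * ‖ι e‖ ^ 2 := by
      have hK0 : (0:ℝ) < K := hK
      have : ‖e‖ ^ 2 ≤ (K * ‖ι e‖) ^ 2 := by
        have := hK' e; gcongr
      rw [div_mul_eq_mul_div, div_le_iff₀ (by positivity)]
      nlinarith
    rw [hy, h5]
    nlinarith

end Slice

end PartD2

section PartD3
open Metric Filter Topology

section Slice

lemma gen_pos {d m : ℕ} (hdm : d < m) (y : C(closedBall (0 : Fin d → ℝ) 1, EuclideanSpace ℝ (Fin m)))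
    (σ : ℝ) (hσ : 0 < σ) :
    ∃ y' : C(closedBall (0 : Fin d → ℝ) 1, EuclideanSpace ℝ (Fin m)), ∀ s, ‖y' s - y s‖ ≤ σ ∧ y' s ≠ 0 := by
  obtain ⟨Y, hY⟩ := ContinuousMap.exists_restrict_eq isClosed_closedBall y
  obtain ⟨g, hg, hgY, -⟩ := Y.continuous.exists_contDiff_approx 1 (continuous_const (y := σ / 2))
    (fun _ => half_pos hσ)
  have hd : Dense (Set.range g)ᶜ := by
    apply ContDiff.dense_compl_range_of_finrank_lt_finrank (by simpa using hg)
    simpa using hdm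
  obtain ⟨w, hw, hw'⟩ := hd.exists_dist_lt 0 (half_pos hσ)
  refine ⟨⟨fun s => g s - w, by
    have := hg.continuous
    fun_prop⟩, ?_⟩
  intro s
  have hYs : Y s = y s := by rw [← hY]; rfl
  constructor
  · simp only [ContinuousMap.coe_mk]
    have h1 := hgY s
    rw [hYs, dist_eq_norm] at h1
    rw [dist_eq_norm, zero_sub, norm_neg] at hw'
    calc ‖g s - w - y s‖ = ‖(g s - y s) - w‖ := by congr 1; abel
      _ ≤ ‖g s - y s‖ + ‖w‖ := norm_sub_le _ _
      _ ≤ σ := by linarith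
  · simp only [ContinuousMap.coe_mk]
    intro h
    exact hw ⟨s, sub_eq_zero.1 h⟩

lemma pushable_slice {d m : ℕ} (hdm : d < m) (τ : C(closedBall (0 : Fin d → ℝ) 1, ℂ))
    (G : Set (ℂ × EuclideanSpace ℂ (Fin m))) (L : ℂ × EuclideanSpace ℂ (Fin m) → ℝ)
    (p0 : closedBall (0 : Fin d → ℝ) 1 × EuclideanSpace ℂ (Fin m))
    (hG : G ∈ 𝓝 (τ p0.1, p0.2)) (Φ : ℂ × EuclideanSpace ℂ (Fin m) → ℂ)
    (hΦ : AnalyticAt ℂ Φ (τ p0.1, p0.2)) (δ C0 : ℝ) (hδ : 0 < δ)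
    (hL : ∀ᶠ z in 𝓝 (τ p0.1, p0.2), L z = (Φ z).re + δ * ‖z.2‖ ^ 2 + C0) :
    Pushable {p | (τ p.1, p.2) ∈ G} (fun p => L (τ p.1, p.2)) p0 := by
  set z0 := (τ p0.1, p0.2) with hz0
  obtain ⟨ι, c, hc, ρ, hρ, y, hyc, hy⟩ := slice_est Φ z0 hΦ δ hδ
  obtain ⟨Y, hY⟩ := ContinuousMap.exists_restrict_eq (s := closedBall z0 ρ) isClosed_closedBall
    ⟨(closedBall z0 ρ).restrict y, hyc.restrict⟩
  have hY' : ∀ z ∈ closedBall z0 ρ, Y z = y z := by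
    intro z hz
    have := DFunLike.congr_fun hY ⟨z, hz⟩
    exact this
  obtain ⟨ρ3, hρ3, hb⟩ := Metric.eventually_nhds_iff_ball.1 (hL.and hG)
  have hcont : ContinuousAt (fun p : closedBall (0 : Fin d → ℝ) 1 × EuclideanSpace ℂ (Fin m) => (τ p.1, p.2)) p0 := by
    fun_prop
  set M := 1 + ‖ι‖ with hM
  have hM1 : 1 ≤ M := by rw [hM]; linarith [norm_nonneg ι]
  have hM0 : 0 < M := by linarith
  refine ⟨_, hcont (ball_mem_nhds z0 (ε := min ρ (ρ3 / 2)) (by positivity)), c / M ^ 2, by positivity,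
    min (min ρ (ρ3 / 2)) 1, by positivity, ?_⟩
  intro u hu σ hσ
  obtain ⟨y', hy'⟩ := gen_pos hdm (Y.comp ⟨fun s => (τ s, u s), by fun_prop⟩) σ hσ
  have hn : ∀ s, ‖y' s‖ ≠ 0 := fun s => norm_ne_zero_iff.2 (hy' s).2
  have hyn : ∀ s, ‖(‖y' s‖⁻¹ • y' s)‖ = 1 := by
    intro s
    rw [norm_smul, norm_inv, norm_norm, inv_mul_cancel₀ (hn s)]
  refine ⟨⟨fun s => M⁻¹ • ι (‖y' s‖⁻¹ • y' s), ?_⟩, ?_, ?_⟩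
  · have h1 : Continuous fun s => ‖y' s‖⁻¹ := (y'.continuous.norm).inv₀ hn
    have h2 : Continuous fun s => ‖y' s‖⁻¹ • y' s := h1.smul y'.continuous
    have h3 : Continuous fun s => ι (‖y' s‖⁻¹ • y' s) := ι.continuous.comp h2
    exact h3.const_smul M⁻¹
  · intro s
    simp only [ContinuousMap.coe_mk]
    rw [norm_smul, norm_inv, Real.norm_of_nonneg hM0.le, inv_mul_le_one₀ hM0]
    calc _ ≤ ‖ι‖ * ‖(‖y' s‖⁻¹ • y' s)‖ := ι.le_opNorm _
      _ ≤ M := by rw [hyn, mul_one, hM]; linarith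
  · intro s hs t ht ht'
    have hs' : (τ s, u s) ∈ ball z0 (min ρ (ρ3 / 2)) := hs
    rw [mem_ball, lt_min_iff] at hs'
    have ht1 : t ≤ 1 := ht'.trans (min_le_right _ _)
    have htρ : t ≤ ρ := (ht'.trans (min_le_left _ _)).trans (min_le_left _ _)
    have htρ3 : t ≤ ρ3 / 2 := (ht'.trans (min_le_left _ _)).trans (min_le_right _ _)
    simp only [ContinuousMap.coe_mk]
    set e' := (t * M⁻¹) • (‖y' s‖⁻¹ • y' s) with he'
    have htM : 0 ≤ t * M⁻¹ := by positivity
    have hte : t • M⁻¹ • ι (‖y' s‖⁻¹ • y' s) = ι e' := by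
      rw [he', ι.map_smul (t * M⁻¹), smul_smul]
    have he'n : ‖e'‖ = t * M⁻¹ := by
      rw [he', norm_smul, hyn, mul_one, Real.norm_of_nonneg htM]
    have htM' : t * M⁻¹ ≤ t := by
      have : M⁻¹ ≤ 1 := inv_le_one_of_one_le₀ hM1
      nlinarith
    rw [hte]
    have hιe : ‖ι e'‖ ≤ t := by
      calc _ ≤ ‖ι‖ * ‖e'‖ := ι.le_opNorm _
        _ ≤ M * (t * M⁻¹) := by rw [he'n]; gcongr; rw [hM]; linarith
        _ = t := by field_simp
    have h1 := hb (τ s, u s) (mem_ball.2 (by linarith [hs'.2]))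
    have h2 := hb (τ s, u s + ι e') (by
      rw [mem_ball]
      calc dist (τ s, u s + ι e') z0 ≤ dist (τ s, u s + ι e') (τ s, u s) + dist (τ s, u s) z0 := dist_triangle _ _ _
        _ < ρ3 / 2 + ρ3 / 2 := by
          have : dist (τ s, u s + ι e') (τ s, u s) = ‖ι e'‖ := by
            simp [Prod.dist_eq]
          rw [this]; linarith [hs'.2]
        _ = ρ3 := by ring)
    refine ⟨h2.2, ?_⟩
    rw [h1.1, h2.1]
    have hcb : (τ s, u s) ∈ closedBall z0 ρ := mem_closedBall.2 hs'.1.le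
    have h3 := hy (τ s, u s) hcb e' (by rw [he'n]; linarith)
    have h4 : ‖y' s - y (τ s, u s)‖ ≤ σ := by
      have := (hy' s).1
      rw [← hY' _ hcb]
      exact this
    have h5 : inner ℝ (y (τ s, u s)) e' = inner ℝ (y' s) e' - inner ℝ (y' s - y (τ s, u s)) e' := by
      rw [inner_sub_left]; ring
    have h6 : 0 ≤ inner ℝ (y' s) e' := by
      rw [he', inner_smul_right, inner_smul_right, real_inner_self_eq_norm_sq]
      positivity
    have h7 : inner ℝ (y' s - y (τ s, u s)) e' ≤ σ := by
      calc _ ≤ ‖y' s - y (τ s, u s)‖ * ‖e'‖ := real_inner_le_norm _ _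
        _ ≤ σ * 1 := by gcongr; rw [he'n]; linarith
        _ = σ := mul_one σ
    have h8 : c * ‖e'‖ ^ 2 = c / M ^ 2 * t ^ 2 := by rw [he'n]; field_simp
    rw [h8, h5] at h3
    dsimp only at h3 ⊢
    linarith

end Slice

end PartD3

section PartE1
open Metric Filter Topology

section Good

/-- the properties of the functions on a small ball that we use -/
structure GoodF {N r : ℕ} (f : Fin r → EuclideanSpace ℂ (Fin N) → ℂ) (ε₀ : ℝ) : Prop where
  pos : 0 < ε₀
  an : ∀ i x, ‖x‖ ≤ ε₀ → AnalyticAt ℂ (f i) x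
  f0 : ∀ i, f i 0 = 0
  le1 : ∀ i x, ‖x‖ ≤ ε₀ → ‖f i x‖ ≤ 1
  li : ∀ x, ‖x‖ ≤ ε₀ → x ≠ 0 → LinearIndependent ℂ (fun i : {i : Fin r // f i x = 0} => fderiv ℂ (f i.1) x)
  t4 : ∀ x, ‖x‖ ≤ ε₀ → x ≠ 0 → innerSL ℂ x ∉ Submodule.span ℂ
    (Set.range fun i : {i : Fin r // f i x = 0} => fderiv ℂ (f i.1) x)
  t5 : ∀ x, ‖x‖ ≤ ε₀ → ∀ s, f s x ≠ 0 → fderiv ℂ (f s) x ∉ Submodule.span ℂ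
    (Set.range fun i : {i : Fin r // f i x = 0} => fderiv ℂ (f i.1) x)

lemma li_option {W : Type*} [AddCommGroup W] [Module ℂ W] {r : ℕ} (g : Fin r → ℂ) (α : Fin r → W) (β : W)
    (h : LinearIndependent ℂ (fun i : {i : Fin r // g i = 0} => α i.1))
    (hβ : β ∉ Submodule.span ℂ (Set.range fun i : {i : Fin r // g i = 0} => α i.1)) :
    LinearIndependent ℂ (fun i : {i : Option (Fin r) // i.elim 0 g = 0} => i.1.elim β α) := by
  have h1 := linearIndependent_option'.2 ⟨h, hβ⟩
  let φ : {i : Option (Fin r) // i.elim 0 g = 0} → Option {i : Fin r // g i = 0} := fun i =>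
    match i with
    | ⟨none, _⟩ => none
    | ⟨some i, hi⟩ => some ⟨i, hi⟩
  have hφ : Function.Injective φ := by
    rintro ⟨_ | i, hi⟩ ⟨_ | j, hj⟩ hij
    · rfl
    · simp [φ] at hij
    · simp [φ] at hij
    · have h3 : (⟨i, hi⟩ : {i : Fin r // g i = 0}) = ⟨j, hj⟩ := Option.some.inj hij
      have h4 : i = j := congrArg Subtype.val h3
      subst h4; rfl
  have h2 := h1.comp φ hφ
  have h5 : (fun i : {i : Option (Fin r) // i.elim 0 g = 0} => i.1.elim β α) =
      (fun o : Option {i : Fin r // g i = 0} => o.casesOn' β fun i => α i.1) ∘ φ := by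
    funext i
    rcases i with ⟨_ | i, hi⟩ <;> rfl
  rw [h5]
  exact h2

variable {N r : ℕ} {f : Fin r → EuclideanSpace ℂ (Fin N) → ℂ} {ε₀ : ℝ}

lemma GoodF.exists_T4 (hf : GoodF f ε₀) (r1 r2 : ℝ) (hr1 : 0 < r1) (hr2 : r2 ≤ ε₀) :
    ∃ C > (0:ℝ), ∃ η > (0:ℝ), ∀ x, r1 ≤ ‖x‖ → ‖x‖ ≤ r2 → ∀ (w0 : ℂ) (w : Fin r → ℂ) (B : ℝ), ‖w0‖ ≤ B →
      (∀ i, ‖w i‖ ≤ B) → ∃ v : EuclideanSpace ℂ (Fin N), ‖v‖ ≤ C * B ∧ inner ℂ x v = w0 ∧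
        ∀ i, ‖f i x‖ ≤ η → fderiv ℂ (f i) x v = w i := by
  have hK : IsCompact {x : EuclideanSpace ℂ (Fin N) | r1 ≤ ‖x‖ ∧ ‖x‖ ≤ r2} := by
    apply (isCompact_closedBall (0 : EuclideanSpace ℂ (Fin N)) r2).of_isClosed_subset
    · exact (isClosed_le continuous_const continuous_norm).inter (isClosed_le continuous_norm continuous_const)
    · intro x hx; simpa using hx.2
  obtain ⟨C, hC, η, hη, h⟩ := lemmaLC (κ := Option (Fin r)) _ hK (fun i x => i.elim 0 (fun i => f i x))
    (by
      rintro (_ | i)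
      · exact continuousOn_const
      · intro x hx
        exact (hf.an i x (hx.2.trans hr2)).continuousAt.continuousWithinAt)
    (fun i x => i.elim (innerSL ℂ x) (fun i => fderiv ℂ (f i) x))
    (by
      rintro (_ | i)
      · exact (innerSL ℂ).continuous.continuousOn
      · intro x hx
        exact (hf.an i x (hx.2.trans hr2)).fderiv.continuousAt.continuousWithinAt)
    (by
      intro x hx
      have hx0 : x ≠ 0 := by
        rw [← norm_pos_iff]; exact hr1.trans_le hx.1
      exact li_option (fun i => f i x) _ _ (hf.li x (hx.2.trans hr2) hx0) (hf.t4 x (hx.2.trans hr2) hx0))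
  refine ⟨C, hC, η, hη, ?_⟩
  intro x hx1 hx2 w0 w B hw0 hw
  obtain ⟨v, hv1, hv2⟩ := h x ⟨hx1, hx2⟩ (fun i => i.elim w0 w)
  refine ⟨v, hv1.trans ?_, ?_, ?_⟩
  · gcongr
    rw [pi_norm_le_iff_of_nonneg ((norm_nonneg _).trans hw0)]
    rintro (_ | i)
    · exact hw0
    · exact hw i
  · exact hv2 none (by simpa using hη.le)
  · intro i hi
    exact hv2 (some i) hi

lemma GoodF.exists_T6 (hf : GoodF f ε₀) (s : Fin r) (r2 m : ℝ) (hm : 0 < m) (hr2 : r2 ≤ ε₀) :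
    ∃ C > (0:ℝ), ∃ η > (0:ℝ), ∀ x, m ≤ ‖f s x‖ → ‖x‖ ≤ r2 → ∀ (w0 : ℂ) (w : Fin r → ℂ) (B : ℝ), ‖w0‖ ≤ B →
      (∀ i, ‖w i‖ ≤ B) → ∃ v : EuclideanSpace ℂ (Fin N), ‖v‖ ≤ C * B ∧ fderiv ℂ (f s) x v = w0 ∧
        ∀ i, ‖f i x‖ ≤ η → fderiv ℂ (f i) x v = w i := by
  have hcont : ∀ i, ContinuousOn (f i) (closedBall 0 r2) := by
    intro i x hx
    exact (hf.an i x ((by simpa using hx : ‖x‖ ≤ r2).trans hr2)).continuousAt.continuousWithinAt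
  have hK : IsCompact {x : EuclideanSpace ℂ (Fin N) | x ∈ closedBall 0 r2 ∧ m ≤ ‖f s x‖} := by
    apply (isCompact_closedBall (0 : EuclideanSpace ℂ (Fin N)) r2).of_isClosed_subset
    · exact (hcont s).norm.preimage_isClosed_of_isClosed isClosed_closedBall isClosed_Ici
    · intro x hx; exact hx.1
  obtain ⟨C, hC, η, hη, h⟩ := lemmaLC (κ := Option (Fin r)) _ hK (fun i x => i.elim 0 (fun i => f i x))
    (by
      rintro (_ | i)
      · exact continuousOn_const
      · exact (hcont i).mono fun x hx => hx.1)
    (fun i x => i.elim (fderiv ℂ (f s) x) (fun i => fderiv ℂ (f i) x))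
    (by
      have : ∀ i, ContinuousOn (fun x => fderiv ℂ (f i) x) {x : EuclideanSpace ℂ (Fin N) | x ∈ closedBall 0 r2 ∧ m ≤ ‖f s x‖} := by
        intro i x hx
        exact (hf.an i x ((by simpa using hx.1 : ‖x‖ ≤ r2).trans hr2)).fderiv.continuousAt.continuousWithinAt
      rintro (_ | i)
      · exact this s
      · exact this i)
    (by
      intro x hx
      have hfs : f s x ≠ 0 := by
        rw [← norm_pos_iff]; exact hm.trans_le hx.2
      have hx0 : x ≠ 0 := by
        rintro rfl; exact hfs (hf.f0 s)
      have hxr : ‖x‖ ≤ ε₀ := (by simpa using hx.1 : ‖x‖ ≤ r2).trans hr2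
      exact li_option (fun i => f i x) _ _ (hf.li x hxr hx0) (hf.t5 x hxr s hfs))
  refine ⟨C, hC, η, hη, ?_⟩
  intro x hx1 hx2 w0 w B hw0 hw
  obtain ⟨v, hv1, hv2⟩ := h x ⟨by simpa using hx2, hx1⟩ (fun i => i.elim w0 w)
  refine ⟨v, hv1.trans ?_, ?_, ?_⟩
  · gcongr
    rw [pi_norm_le_iff_of_nonneg ((norm_nonneg _).trans hw0)]
    rintro (_ | i)
    · exact hw0
    · exact hw i
  · exact hv2 none (by simpa using hη.le)
  · intro i hi
    exact hv2 (some i) hi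

/-- bound on derivatives -/
lemma GoodF.exists_M (hf : GoodF f ε₀) : ∃ M > (0:ℝ), ∀ i x, ‖x‖ ≤ ε₀ → ‖fderiv ℂ (f i) x‖ ≤ M := by
  have h1 : ∀ i, ∃ M : ℝ, ∀ x ∈ closedBall (0 : EuclideanSpace ℂ (Fin N)) ε₀, ‖fderiv ℂ (f i) x‖ ≤ M := by
    intro i
    refine (isCompact_closedBall (0 : EuclideanSpace ℂ (Fin N)) ε₀).exists_bound_of_continuousOn ?_
    intro x hx
    exact (hf.an i x (by simpa using hx)).fderiv.continuousAt.continuousWithinAt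
  choose M hM using h1
  refine ⟨1 + ∑ i, |M i|, by positivity, ?_⟩
  intro i x hx
  have h2 := hM i x (by simpa using hx)
  have h3 : |M i| ≤ ∑ i, |M i| := Finset.single_le_sum (f := fun i => |M i|) (fun i _ => abs_nonneg _) (Finset.mem_univ i)
  linarith [le_abs_self (M i)]

end Good

end PartE1

section PartE2
open Metric Filter Topology

section Calc

lemma dir_push {E : Type*} [NormedAddCommGroup E] [NormedSpace ℝ E] (L : E → ℝ) (z0 v : E) (D : ℝ)
    (h : ContDiffAt ℝ 1 L z0) (hd : HasDerivAt (fun t : ℝ => L (z0 + t • v)) D 0) (hD : 0 < D) :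
    ∃ c > (0:ℝ), ∃ θ0 > (0:ℝ), ∀ᶠ z in 𝓝 z0, ∀ t : ℝ, 0 ≤ t → t ≤ θ0 → L z + c * t ≤ L (z + t • v) := by
  have h1 : HasStrictFDerivAt L (fderiv ℝ L z0) z0 := h.hasStrictFDerivAt one_ne_zero
  have hline : HasDerivAt (fun t : ℝ => z0 + t • v) v 0 := by
    simpa using ((hasDerivAt_id (0:ℝ)).smul_const v).const_add z0
  have h2 : HasDerivAt (fun t : ℝ => L (z0 + t • v)) (fderiv ℝ L z0 v) 0 := by
    apply HasFDerivAt.comp_hasDerivAt (0:ℝ) (l := L) _ hline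
    simpa using h1.hasFDerivAt
  have h3 : fderiv ℝ L z0 v = D := h2.unique hd
  exact grad_aux L _ z0 h1 v (by rw [h3]; exact hD)

lemma ev_line {E : Type*} [NormedAddCommGroup E] [NormedSpace ℝ E] (P : E → Prop) (x0 v : E)
    (h : ∀ᶠ x in 𝓝 x0, P x) : ∃ θ > (0:ℝ), ∀ᶠ x in 𝓝 x0, ∀ t : ℝ, 0 ≤ t → t ≤ θ → P (x + t • v) := by
  have h1 : Tendsto (fun p : E × ℝ => p.1 + p.2 • v) (𝓝 (x0, 0)) (𝓝 x0) := by
    have : Continuous (fun p : E × ℝ => p.1 + p.2 • v) := by fun_prop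
    simpa using this.tendsto (x0, 0)
  have h2 := h1.eventually h
  rw [nhds_prod_eq, eventually_prod_iff] at h2
  obtain ⟨pa, ha, pb, hb, hab⟩ := h2
  obtain ⟨θ, hθ, hθ'⟩ := Metric.eventually_nhds_iff_ball.1 hb
  refine ⟨θ / 2, half_pos hθ, ?_⟩
  filter_upwards [ha] with x hx t ht ht'
  exact hab hx (hθ' t (by rw [mem_ball, Real.dist_eq, sub_zero, abs_of_nonneg ht]; linarith))

variable {N : ℕ}

lemma hasDerivAt_line (f : EuclideanSpace ℂ (Fin N) → ℂ) (x v : EuclideanSpace ℂ (Fin N))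
    (hf : AnalyticAt ℂ f x) : HasDerivAt (fun t : ℝ => f (x + t • v)) (fderiv ℂ f x v) 0 := by
  have hline : HasDerivAt (fun t : ℝ => x + t • v) v 0 := by
    simpa using ((hasDerivAt_id (0:ℝ)).smul_const v).const_add x
  have h1 := (hf.differentiableAt.hasFDerivAt.restrictScalars ℝ)
  have := HasFDerivAt.comp_hasDerivAt (0:ℝ) (l := f) (l' := (fderiv ℂ f x).restrictScalars ℝ) (f := fun t : ℝ => x + t • v)
    (by simpa using h1) hline
  exact this

lemma hasDerivAt_lognorm (g : ℝ → ℂ) (g' : ℂ) (h : HasDerivAt g g' 0) (h0 : g 0 ≠ 0) :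
    HasDerivAt (fun t : ℝ => Real.log (‖g t‖ ^ 2)) (2 * inner ℝ (g 0) g' / ‖g 0‖ ^ 2) 0 := by
  exact (h.norm_sq).log (by have := norm_ne_zero_iff.2 h0; positivity)

lemma hasDerivAt_rho (x v : EuclideanSpace ℂ (Fin N)) :
    HasDerivAt (fun t : ℝ => ‖x + t • v‖ ^ 2) (2 * (inner ℂ x v).re) 0 := by
  have h1 : (fun t : ℝ => ‖x + t • v‖ ^ 2) = fun t : ℝ => ‖x‖ ^ 2 + t * (2 * (inner ℂ x v).re) + t ^ 2 * ‖v‖ ^ 2 := by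
    funext t
    have h2 := norm_add_sq (𝕜 := ℂ) x ((t:ℂ) • v)
    have h3 : (t:ℂ) • v = t • v := by
      ext i; simp
    rw [inner_smul_right, h3, norm_smul, Real.norm_eq_abs, mul_pow, sq_abs] at h2
    rw [h2]
    have h4 : RCLike.re ((t:ℂ) * inner ℂ x v) = t * (inner ℂ x v).re := Complex.re_ofReal_mul _ _
    rw [h4]; ring
  rw [h1]
  have h5 := (((hasDerivAt_id (0:ℝ)).mul_const (2 * (inner ℂ x v).re)).const_add (‖x‖ ^ 2)).add
    (((hasDerivAt_id (0:ℝ)).pow 2).mul_const (‖v‖ ^ 2))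
  simp only [id] at h5
  exact h5.congr_deriv (by simp)

lemma contDiffAt_real (f : EuclideanSpace ℂ (Fin N) → ℂ) (x : EuclideanSpace ℂ (Fin N))
    (hf : AnalyticAt ℂ f x) : ContDiffAt ℝ 1 f x :=
  (hf.restrictScalars (𝕜 := ℝ)).contDiffAt

lemma contDiffAt_lognorm {E : Type*} [NormedAddCommGroup E] [NormedSpace ℝ E] (f : E → ℂ) (x : E)
    (hf : ContDiffAt ℝ 1 f x) (h0 : f x ≠ 0) : ContDiffAt ℝ 1 (fun x => Real.log (‖f x‖ ^ 2)) x := by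
  apply ContDiffAt.log
  · exact hf.norm_sq (𝕜 := ℂ)
  · have := norm_ne_zero_iff.2 h0; positivity

lemma contDiff_rho : ContDiff ℝ 1 (fun x : EuclideanSpace ℂ (Fin N) => ‖x‖ ^ 2) :=
  contDiff_id.norm_sq (𝕜 := ℂ)

/-- bound of the logarithmic derivative -/
lemma logder_bound (a b : ℂ) (η A : ℝ) (hη : 0 < η) (ha : η < ‖a‖) (hb : ‖b‖ ≤ A) :
    -(2 * A / η) ≤ 2 * inner ℝ a b / ‖a‖ ^ 2 := by
  have h0 : 0 < ‖a‖ := hη.trans ha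
  have hA : 0 ≤ A := (norm_nonneg _).trans hb
  have h1 : |inner ℝ a b| ≤ ‖a‖ * ‖b‖ := abs_real_inner_le_norm a b
  have h2 := (abs_le.1 h1).1
  rw [le_div_iff₀ (by positivity)]
  have h3 : A / η * ‖a‖ ^ 2 ≥ ‖a‖ * A := by
    rw [ge_iff_le, div_mul_eq_mul_div, le_div_iff₀ hη]
    nlinarith [mul_nonneg hA h0.le, mul_le_mul_of_nonneg_left ha.le (mul_nonneg hA h0.le)]
  have h4 : ‖a‖ * ‖b‖ ≤ ‖a‖ * A := by gcongr
  have h5 : -(2 * A / η) * ‖a‖ ^ 2 = -2 * (A / η * ‖a‖ ^ 2) := by ring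
  rw [h5]
  linarith

lemma logder_self (a : ℂ) (h : a ≠ 0) : 2 * inner ℝ a a / ‖a‖ ^ 2 = 2 := by
  rw [real_inner_self_eq_norm_sq]
  have := norm_ne_zero_iff.2 h
  field_simp

end Calc

end PartE2

section PartE3
open Metric Filter Topology

section LS
variable {N r : ℕ} {f : Fin r → EuclideanSpace ℂ (Fin N) → ℂ} {ε₀ : ℝ}

/-- sum of logarithms -/
noncomputable def LS (f : Fin r → EuclideanSpace ℂ (Fin N) → ℂ) (S : Finset (Fin r)) (x : EuclideanSpace ℂ (Fin N)) : ℝ :=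
  ∑ i ∈ S, Real.log (‖f i x‖ ^ 2)

lemma GoodF.log_nonpos (hf : GoodF f ε₀) (i : Fin r) (x : EuclideanSpace ℂ (Fin N)) (hx : ‖x‖ ≤ ε₀) :
    Real.log (‖f i x‖ ^ 2) ≤ 0 :=
  Real.log_nonpos (sq_nonneg _) (pow_le_one₀ (norm_nonneg _) (hf.le1 i x hx))

lemma GoodF.LS_nonpos (hf : GoodF f ε₀) (S : Finset (Fin r)) (x : EuclideanSpace ℂ (Fin N)) (hx : ‖x‖ ≤ ε₀) :
    LS f S x ≤ 0 :=
  Finset.sum_nonpos fun i _ => hf.log_nonpos i x hx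

lemma GoodF.LS_le (hf : GoodF f ε₀) (S : Finset (Fin r)) (x : EuclideanSpace ℂ (Fin N)) (hx : ‖x‖ ≤ ε₀)
    (i : Fin r) (hi : i ∈ S) : LS f S x ≤ Real.log (‖f i x‖ ^ 2) := by
  classical
  unfold LS
  rw [← Finset.add_sum_erase S _ hi]
  have : ∑ j ∈ S.erase i, Real.log (‖f j x‖ ^ 2) ≤ 0 := Finset.sum_nonpos fun i _ => hf.log_nonpos i x hx
  linarith

lemma GoodF.LS_low (hf : GoodF f ε₀) (S : Finset (Fin r)) (x : EuclideanSpace ℂ (Fin N)) (hx : ‖x‖ ≤ ε₀) (A : ℝ)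
    (h0 : ∀ i ∈ S, f i x ≠ 0) (hA : A ≤ LS f S x) (i : Fin r) (hi : i ∈ S) : Real.exp A ≤ ‖f i x‖ ^ 2 := by
  have h1 := hA.trans (hf.LS_le S x hx i hi)
  rwa [Real.le_log_iff_exp_le] at h1
  have := norm_ne_zero_iff.2 (h0 i hi)
  positivity

lemma GoodF.LS_contDiffAt (hf : GoodF f ε₀) (S : Finset (Fin r)) (x : EuclideanSpace ℂ (Fin N)) (hx : ‖x‖ ≤ ε₀)
    (h0 : ∀ i ∈ S, f i x ≠ 0) : ContDiffAt ℝ 1 (LS f S) x := by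
  apply ContDiffAt.sum
  intro i hi
  exact contDiffAt_lognorm _ x (contDiffAt_real _ x (hf.an i x hx)) (h0 i hi)

lemma GoodF.LS_hasDerivAt (hf : GoodF f ε₀) (S : Finset (Fin r)) (x v : EuclideanSpace ℂ (Fin N)) (hx : ‖x‖ ≤ ε₀)
    (h0 : ∀ i ∈ S, f i x ≠ 0) : HasDerivAt (fun t : ℝ => LS f S (x + t • v))
      (∑ i ∈ S, 2 * inner ℝ (f i x) (fderiv ℂ (f i) x v) / ‖f i x‖ ^ 2) 0 := by
  unfold LS
  apply HasDerivAt.fun_sum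
  intro i hi
  have h1 := hasDerivAt_lognorm _ _ (hasDerivAt_line (f i) x v (hf.an i x hx)) (by simpa using h0 i hi)
  simpa using h1

lemma GoodF.compact (hf : GoodF f ε₀) (S : Finset (Fin r)) (ε κ : ℝ) (hε : ε ≤ ε₀) :
    IsCompact {x : EuclideanSpace ℂ (Fin N) | ‖x‖ ≤ ε ∧ ∀ i ∈ S, κ ≤ ‖f i x‖ ^ 2} := by
  apply (isCompact_closedBall (0 : EuclideanSpace ℂ (Fin N)) ε).of_isClosed_subset
  · have h1 : {x : EuclideanSpace ℂ (Fin N) | ‖x‖ ≤ ε ∧ ∀ i ∈ S, κ ≤ ‖f i x‖ ^ 2} =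
        closedBall 0 ε ∩ ⋂ i ∈ S, (closedBall 0 ε ∩ (fun x => ‖f i x‖ ^ 2) ⁻¹' Set.Ici κ) := by
      ext x
      simp only [Set.mem_setOf_eq, Set.mem_inter_iff, mem_closedBall_zero_iff, Set.mem_iInter, Set.mem_preimage, Set.mem_Ici]
      exact ⟨fun h => ⟨h.1, fun i hi => ⟨h.1, h.2 i hi⟩⟩, fun h => ⟨h.1, fun i hi => (h.2 i hi).2⟩⟩
    rw [h1]
    refine isClosed_closedBall.inter (isClosed_biInter fun i _ => ?_)
    refine ContinuousOn.preimage_isClosed_of_isClosed ?_ isClosed_closedBall isClosed_Ici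
    intro x hx
    exact ((hf.an i x ((by simpa using hx : ‖x‖ ≤ ε).trans hε)).continuousAt.norm.pow 2).continuousWithinAt
  · intro x hx; simpa using hx.1

lemma GoodF.ev_ne (hf : GoodF f ε₀) (S : Finset (Fin r)) (x : EuclideanSpace ℂ (Fin N)) (hx : ‖x‖ ≤ ε₀)
    (h0 : ∀ i ∈ S, f i x ≠ 0) : ∀ᶠ y in 𝓝 x, ∀ i ∈ S, f i y ≠ 0 := by
  rw [Filter.eventually_all_finset]
  intro i hi
  exact (hf.an i x hx).continuousAt.eventually_ne (h0 i hi)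

/-- radial pushing -/
lemma GoodF.radial_push (hf : GoodF f ε₀) {Q : Type} [MetricSpace Q] [CompactSpace Q]
    (ε : ℝ) (hε : ε ≤ ε₀) (ς : ℝ) (hς : ς = 1 ∨ ς = -1) (r1 : ℝ) (hr1 : 0 < r1)
    (u : C(Q, EuclideanSpace ℂ (Fin N))) (hu : ∀ s, ‖u s‖ ≤ ε ∧ ∀ i, f i (u s) ≠ 0) :
    ∃ κ > (0:ℝ), ∀ (lo hi1 hi2 hi3 : ℝ) (_ : hi1 < hi2) (_ : hi2 < hi3)
    (_ : ∀ x : EuclideanSpace ℂ (Fin N), ‖x‖ ≤ ε → lo ≤ ς * ‖x‖ ^ 2 → ς * ‖x‖ ^ 2 ≤ hi2 → r1 ≤ ‖x‖)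
    (_ : ∀ x : EuclideanSpace ℂ (Fin N), ‖x‖ ≤ ε → ς * ‖x‖ ^ 2 ≤ hi2 → ‖x‖ < ε ∨ ς = -1)
    (_ : ∀ s, lo ≤ ς * ‖u s‖ ^ 2),
    ∃ u' : C(Q, EuclideanSpace ℂ (Fin N)), ContinuousMap.HomotopicWith u u'
      (fun w => (∀ s, ‖w s‖ ≤ ε ∧ ∀ i, f i (w s) ≠ 0 ∧ κ ≤ ‖f i (w s)‖ ^ 2) ∧ ∀ s, hi3 ≤ ς * ‖u s‖ ^ 2 → w s = u s) ∧
      ∀ s, hi1 ≤ ς * ‖u' s‖ ^ 2 := by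
  classical
  obtain ⟨C, hC, η, hη, hT4⟩ := hf.exists_T4 r1 ε hr1 hε
  obtain ⟨M, hM, hMb⟩ := hf.exists_M
  have hςς : ς * ς = 1 := by rcases hς with h | h <;> rw [h] <;> norm_num
  set δ : ℝ := (1 + r * (2 * (M * C) / η))⁻¹ with hδ
  have hδ0 : 0 < δ := by positivity
  have hδ1 : δ * (r * (2 * (M * C) / η)) ≤ 1 := by
    rw [hδ, inv_mul_le_one₀ (by positivity)]; linarith
  set Ψ : EuclideanSpace ℂ (Fin N) → ℝ := fun x => ς * ‖x‖ ^ 2 + δ * LS f Finset.univ x with hΨ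
  have hΨc : ∀ x, ‖x‖ ≤ ε → (∀ i, f i x ≠ 0) → ContDiffAt ℝ 1 Ψ x := by
    intro x hx h0
    exact (contDiffAt_const.mul contDiff_rho.contDiffAt).add
      (contDiffAt_const.mul (hf.LS_contDiffAt _ x (hx.trans hε) fun i _ => h0 i))
  obtain ⟨c0, hc0⟩ : ∃ c0, ∀ s, c0 ≤ Ψ (u s) := by
    have hcont : Continuous fun s => Ψ (u s) := by
      rw [continuous_iff_continuousAt]
      intro s
      exact ContinuousAt.comp (g := Ψ) (hΨc _ (hu s).1 (hu s).2).continuousAt u.continuous.continuousAt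
    obtain ⟨B, hB⟩ := isCompact_univ.exists_bound_of_continuousOn hcont.continuousOn
    exact ⟨-B, fun s => (abs_le.1 (hB s trivial)).1⟩
  refine ⟨Real.exp ((c0 - ε ^ 2) / δ), Real.exp_pos _, ?_⟩
  intro lo hi1 hi2 hi3 h12 h23 hr hb hlo
  have hκ : ∀ x : EuclideanSpace ℂ (Fin N), ‖x‖ ≤ ε → (∀ i, f i x ≠ 0) → c0 ≤ Ψ x → ∀ i,
      Real.exp ((c0 - ε ^ 2) / δ) ≤ ‖f i x‖ ^ 2 := by
    intro x h1 h2 h3 i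
    apply hf.LS_low Finset.univ x (h1.trans hε) _ (fun i _ => h2 i) _ i (Finset.mem_univ i)
    rw [div_le_iff₀ hδ0]
    have h6 : ς * ‖x‖ ^ 2 ≤ ε ^ 2 := by
      have h7 : ‖x‖ ^ 2 ≤ ε ^ 2 := by gcongr
      rcases hς with h | h <;> rw [h] <;> nlinarith [sq_nonneg ‖x‖]
    simp only [hΨ] at h3
    linarith
  let G : Set (ℂ × EuclideanSpace ℂ (Fin N)) := {z | ‖z.2‖ ≤ ε ∧ (∀ i, f i z.2 ≠ 0) ∧ c0 ≤ Ψ z.2}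
  let Λ : ℂ × EuclideanSpace ℂ (Fin N) → ℝ := fun z => ς * ‖z.2‖ ^ 2
  let τ : C(Q, ℂ) := ContinuousMap.const Q 0
  have hK : IsCompact {p : Q × EuclideanSpace ℂ (Fin N) | p ∈ {p : Q × EuclideanSpace ℂ (Fin N) | (τ p.1, p.2) ∈ G} ∧
      lo ≤ Λ (τ p.1, p.2) ∧ Λ (τ p.1, p.2) ≤ hi2} := by
    set κ := Real.exp ((c0 - ε ^ 2) / δ)
    have hcomp := hf.compact Finset.univ ε κ hε
    have hne : ∀ x ∈ {x : EuclideanSpace ℂ (Fin N) | ‖x‖ ≤ ε ∧ ∀ i ∈ Finset.univ, κ ≤ ‖f i x‖ ^ 2}, ∀ i, f i x ≠ 0 := by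
      intro x hx i h0
      have := hx.2 i (Finset.mem_univ i)
      rw [h0] at this
      have hk : 0 < κ := Real.exp_pos _
      simp at this
      linarith
    have hc1 : ContinuousOn Ψ {x : EuclideanSpace ℂ (Fin N) | ‖x‖ ≤ ε ∧ ∀ i ∈ Finset.univ, κ ≤ ‖f i x‖ ^ 2} := by
      intro x hx
      exact (hΨc x hx.1 (hne x hx)).continuousAt.continuousWithinAt
    have hc2 := hcomp.of_isClosed_subset (hc1.preimage_isClosed_of_isClosed hcomp.isClosed (isClosed_Ici (a := c0)))
      Set.inter_subset_left
    have hcl : IsClosed {x : EuclideanSpace ℂ (Fin N) | lo ≤ ς * ‖x‖ ^ 2 ∧ ς * ‖x‖ ^ 2 ≤ hi2} := by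
      have hcs : Continuous fun x : EuclideanSpace ℂ (Fin N) => ς * ‖x‖ ^ 2 := by fun_prop
      exact (isClosed_le continuous_const hcs).inter (isClosed_le hcs continuous_const)
    have hc3 := (isCompact_univ (X := Q)).prod (hc2.inter_right hcl)
    convert hc3 using 1
    ext ⟨s, x⟩
    simp only [Set.mem_setOf_eq, Set.mem_prod, Set.mem_univ, true_and, Set.mem_inter_iff, Set.mem_preimage,
      Set.mem_Ici, G, Λ]
    constructor
    · rintro ⟨⟨h1, h2, h3⟩, h4, h5⟩
      refine ⟨⟨⟨h1, fun i hi => ?_⟩, h3⟩, h4, h5⟩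
      exact hκ x h1 h2 h3 i
    · rintro ⟨⟨⟨h1, h2⟩, h3⟩, h4, h5⟩
      exact ⟨⟨h1, fun i => hne x ⟨h1, h2⟩ i, h3⟩, h4, h5⟩
  have hpush : ∀ p ∈ {p : Q × EuclideanSpace ℂ (Fin N) | (τ p.1, p.2) ∈ G}, lo ≤ Λ (τ p.1, p.2) →
      Λ (τ p.1, p.2) ≤ hi2 → Pushable {p : Q × EuclideanSpace ℂ (Fin N) | (τ p.1, p.2) ∈ G} (fun p => Λ (τ p.1, p.2)) p := by
    rintro ⟨s, x⟩ hp hlo' hhi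
    obtain ⟨hp1, hp2, hp3⟩ : ‖x‖ ≤ ε ∧ (∀ i, f i x ≠ 0) ∧ c0 ≤ Ψ x := hp
    have hlo'' : lo ≤ ς * ‖x‖ ^ 2 := hlo'
    have hhi' : ς * ‖x‖ ^ 2 ≤ hi2 := hhi
    obtain ⟨v, hv1, hv2, hv3⟩ := hT4 x (hr x hp1 hlo'' hhi') hp1 (ς : ℂ) 0 1
      (by rcases hς with h | h <;> rw [h] <;> simp) (by simp)
    rw [mul_one] at hv1
    have hre : (inner ℂ x v).re = ς := by rw [hv2]; simp
    have hdΛ : HasDerivAt (fun t : ℝ => ς * ‖x + t • v‖ ^ 2) (ς * (2 * (inner ℂ x v).re)) 0 :=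
      (hasDerivAt_rho x v).const_mul ς
    have hdLS := hf.LS_hasDerivAt Finset.univ x v (hp1.trans hε) fun i _ => hp2 i
    have hdΨ : HasDerivAt (fun t : ℝ => Ψ (x + t • v)) (ς * (2 * (inner ℂ x v).re) + δ *
        (∑ i, 2 * inner ℝ (f i x) (fderiv ℂ (f i) x v) / ‖f i x‖ ^ 2)) 0 := hdΛ.add (hdLS.const_mul δ)
    have hsum : -(r * (2 * (M * C) / η)) ≤ ∑ i, 2 * inner ℝ (f i x) (fderiv ℂ (f i) x v) / ‖f i x‖ ^ 2 := by
      have : ∑ _i : Fin r, -(2 * (M * C) / η) ≤ ∑ i, 2 * inner ℝ (f i x) (fderiv ℂ (f i) x v) / ‖f i x‖ ^ 2 := by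
        refine Finset.sum_le_sum fun i _ => ?_
        by_cases hi : ‖f i x‖ ≤ η
        · rw [hv3 i hi]
          simp only [Pi.zero_apply, inner_zero_right, mul_zero, zero_div, Left.neg_nonpos_iff]
          positivity
        · push Not at hi
          refine logder_bound _ _ η _ hη hi ?_
          calc _ ≤ ‖fderiv ℂ (f i) x‖ * ‖v‖ := ContinuousLinearMap.le_opNorm _ _
            _ ≤ M * C := by gcongr; exact hMb i x (hp1.trans hε)
      simpa using this
    rw [hre, show ς * (2 * ς) = 2 by linarith] at hdΛ hdΨ
    obtain ⟨c1, hc1, θ1, hθ1, he1⟩ := dir_push _ x v _ (contDiffAt_const.mul contDiff_rho.contDiffAt) hdΛ (by norm_num)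
    obtain ⟨c2, hc2, θ2, hθ2, he2⟩ := dir_push _ x v _ (hΨc x hp1 hp2) hdΨ (by nlinarith)
    obtain ⟨θ3, hθ3, he3⟩ := ev_line _ x v (hf.ev_ne Finset.univ x (hp1.trans hε) fun i _ => hp2 i)
    obtain ⟨θ4, hθ4, he4⟩ : ∃ θ > (0:ℝ), ∀ᶠ y in 𝓝 x, ∀ t : ℝ, 0 ≤ t → t ≤ θ → (‖y + t • v‖ ≤ ε ∨ ς = -1) := by
      rcases hb x hp1 hhi' with h | h
      · obtain ⟨θ4, hθ4, he4⟩ := ev_line (fun y => ‖y‖ ≤ ε) x v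
          ((continuous_norm.continuousAt.eventually (gt_mem_nhds h)).mono fun y hy => le_of_lt hy)
        exact ⟨θ4, hθ4, he4.mono fun y hy t ht ht' => Or.inl (hy t ht ht')⟩
      · exact ⟨1, one_pos, Filter.Eventually.of_forall fun y t _ _ => Or.inr h⟩
    refine pushable_of_dir τ G Λ (s, x) v c1 (min (min θ1 θ2) (min θ3 θ4)) hc1 (by positivity) ?_
    have hsnd : Tendsto (fun z : ℂ × EuclideanSpace ℂ (Fin N) => z.2) (𝓝 (τ s, x)) (𝓝 x) :=
      continuous_snd.tendsto (τ s, x)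
    filter_upwards [hsnd.eventually (he1.and (he2.and (he3.and he4)))] with z hz hzG t ht ht'
    obtain ⟨k1, k2, k3, k4⟩ := hz
    simp only [le_min_iff] at ht'
    have j1 := k1 t ht ht'.1.1
    have j2 := k2 t ht ht'.1.2
    have j3 := k3 t ht ht'.2.1
    have j4 := k4 t ht ht'.2.2
    refine ⟨⟨?_, fun i => j3 i (Finset.mem_univ i), ?_⟩, j1⟩
    · rcases j4 with h | h
      · exact h
      · have h1 : ‖z.2‖ ≤ ε := hzG.1
        rw [h] at j1
        have h2 : ‖z.2 + t • v‖ ^ 2 ≤ ‖z.2‖ ^ 2 := by nlinarith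
        exact (pow_le_pow_iff_left₀ (norm_nonneg _) (norm_nonneg _) two_ne_zero).1 h2 |>.trans h1
    · have h1 : c0 ≤ Ψ z.2 := hzG.2.2
      show c0 ≤ Ψ (z.2 + t • v)
      have : 0 ≤ c2 * t := by positivity
      linarith
  have hΛcont : Continuous fun p : Q × EuclideanSpace ℂ (Fin N) => Λ (τ p.1, p.2) := by
    show Continuous fun p : Q × EuclideanSpace ℂ (Fin N) => ς * ‖p.2‖ ^ 2
    fun_prop
  obtain ⟨u', hu', hu''⟩ := push_theorem _ _ hΛcont.continuousOn lo hi1 hi2 hi3 h12 h23 hK hpush u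
    (fun s => ⟨(hu s).1, (hu s).2, hc0 s⟩) hlo
  refine ⟨u', ?_, hu''⟩
  obtain ⟨H⟩ := hu'
  refine ⟨⟨H.toHomotopy, fun t => ?_⟩⟩
  obtain ⟨h1, h2⟩ := H.prop' t
  exact ⟨fun s => ⟨(h1 s).1, fun i => ⟨(h1 s).2.1 i, hκ _ (h1 s).1 (h1 s).2.1 (h1 s).2.2 i⟩⟩, fun s hs => h2 s hs⟩

end LS

end PartE3

section PartE4
open Metric Filter Topology

section Aux

lemma exists_ell (g : ℝ) (hg : 0 < g) (hg1 : g ≤ 1) : ∃ ℓ : ℝ → ℝ, ContDiff ℝ 1 ℓ ∧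
    (∀ t, g ≤ t → ℓ t = -Real.log t) ∧ (∀ t, HasDerivAt ℓ (-(max t g)⁻¹) t) ∧ Antitone ℓ := by
  have hmax : ∀ t, 0 < max t g := fun t => lt_max_of_lt_right hg
  have hc : Continuous fun t : ℝ => (max t g)⁻¹ :=
    (continuous_id.max continuous_const).inv₀ fun t => (hmax t).ne'
  set ℓ : ℝ → ℝ := fun t => -∫ x in (1:ℝ)..t, (max x g)⁻¹ with hℓ
  have hd : ∀ t, HasDerivAt ℓ (-(max t g)⁻¹) t := by
    intro t
    exact (intervalIntegral.integral_hasDerivAt_right (hc.intervalIntegrable _ _)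
      hc.stronglyMeasurable.stronglyMeasurableAtFilter hc.continuousAt).neg
  refine ⟨ℓ, ?_, ?_, hd, ?_⟩
  · rw [contDiff_one_iff_deriv]
    refine ⟨fun t => (hd t).differentiableAt, ?_⟩
    have : deriv ℓ = fun t => -(max t g)⁻¹ := funext fun t => (hd t).deriv
    rw [this]
    exact hc.neg
  · intro t ht
    have h1 : ∫ x in (1:ℝ)..t, (max x g)⁻¹ = ∫ x in (1:ℝ)..t, x⁻¹ := by
      apply intervalIntegral.integral_congr
      intro x hx
      have : g ≤ x := (le_min hg1 ht).trans hx.1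
      simp [max_eq_left this]
    rw [hℓ]
    simp only
    rw [h1, integral_inv_of_pos one_pos (hg.trans_le ht), div_one]
  · apply antitone_of_deriv_nonpos
    · exact fun t => (hd t).differentiableAt
    · intro t
      rw [(hd t).deriv]
      have := hmax t
      simp only [Left.neg_nonpos_iff]
      positivity

lemma exists_b (ε : ℝ) (hε : 0 < ε) : ∃ b : ℝ → ℝ, (∀ ρ, ρ < ε ^ 2 → ContDiffAt ℝ 1 b ρ) ∧
    (∀ ρ, ρ ≤ ε ^ 2 / 4 → b ρ = ρ - ε ^ 2) ∧ (∀ ρ, ρ < ε ^ 2 → b ρ ≤ 0) ∧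
    (∀ R ρ, 0 ≤ ρ → ρ < ε ^ 2 → b ρ ≤ -R → deriv b ρ ≤ 2 - R / ε ^ 2) ∧
    (∀ A : ℝ, ∃ ρ1, 0 ≤ ρ1 ∧ ρ1 < ε ^ 2 ∧ ∀ ρ, ρ < ε ^ 2 → -A ≤ b ρ → ρ ≤ ρ1) := by
  set E := expNegInvGlue
  have hE : ContDiff ℝ 1 E := expNegInvGlue.contDiff (n := 1)
  have hE0 : ∀ x, 0 ≤ E x := expNegInvGlue.nonneg
  set b : ℝ → ℝ := fun ρ => ρ - ε ^ 2 - E (ρ - ε ^ 2 / 4) / (ε ^ 2 - ρ) with hb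
  have hEd : ∀ x, 0 ≤ deriv E x := fun x => expNegInvGlue.monotone.deriv_nonneg
  have hbE : ∀ ρ, ρ < ε ^ 2 → 0 ≤ E (ρ - ε ^ 2 / 4) / (ε ^ 2 - ρ) := by
    intro ρ hρ
    exact div_nonneg (hE0 _) (by linarith)
  refine ⟨b, ?_, ?_, ?_, ?_, ?_⟩
  · intro ρ hρ
    have h1 : ContDiffAt ℝ 1 (fun ρ : ℝ => E (ρ - ε ^ 2 / 4)) ρ :=
      (hE.comp (contDiff_id.sub contDiff_const)).contDiffAt
    exact (contDiffAt_id.sub contDiffAt_const).sub (h1.div (contDiffAt_const.sub contDiffAt_id) (sub_pos.2 hρ).ne')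
  · intro ρ hρ
    have : E (ρ - ε ^ 2 / 4) = 0 := expNegInvGlue.zero_of_nonpos (by linarith)
    simp [hb, this]
  · intro ρ hρ
    have := hbE ρ hρ
    simp only [hb]
    linarith
  · intro R ρ hρ0 hρ hR
    have hpos : 0 < ε ^ 2 - ρ := by linarith
    have h1 : HasDerivAt (fun ρ : ℝ => E (ρ - ε ^ 2 / 4)) (deriv E (ρ - ε ^ 2 / 4)) ρ := by
      exact HasDerivAt.comp_sub_const ρ (ε ^ 2 / 4) (hE.differentiable one_ne_zero (ρ - ε ^ 2 / 4)).hasDerivAt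
    have h2 : HasDerivAt b (1 - (deriv E (ρ - ε ^ 2 / 4) * (ε ^ 2 - ρ) - E (ρ - ε ^ 2 / 4) * (-1)) / (ε ^ 2 - ρ) ^ 2) ρ := by
      have h3 := ((hasDerivAt_id ρ).sub_const (ε ^ 2)).sub (h1.div ((hasDerivAt_id ρ).const_sub (ε ^ 2)) hpos.ne')
      exact h3
    rw [h2.deriv]
    have h4 : R - ε ^ 2 ≤ E (ρ - ε ^ 2 / 4) / (ε ^ 2 - ρ) := by
      simp only [hb] at hR
      linarith
    have h5 : (R - ε ^ 2) / ε ^ 2 ≤ E (ρ - ε ^ 2 / 4) / (ε ^ 2 - ρ) ^ 2 := by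
      have hq := hbE ρ hρ
      have e1 : E (ρ - ε ^ 2 / 4) / (ε ^ 2 - ρ) ^ 2 = E (ρ - ε ^ 2 / 4) / (ε ^ 2 - ρ) / (ε ^ 2 - ρ) := by
        field_simp
      rw [e1]
      calc (R - ε ^ 2) / ε ^ 2 ≤ E (ρ - ε ^ 2 / 4) / (ε ^ 2 - ρ) / ε ^ 2 := by gcongr
        _ ≤ _ := by
          apply div_le_div_of_nonneg_left hq hpos; linarith
    have h6 : 0 ≤ deriv E (ρ - ε ^ 2 / 4) * (ε ^ 2 - ρ) / (ε ^ 2 - ρ) ^ 2 := by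
      have := hEd (ρ - ε ^ 2 / 4)
      positivity
    have h7 : (R - ε ^ 2) / ε ^ 2 = R / ε ^ 2 - 1 := by
      field_simp
    rw [sub_div]
    have h8 : E (ρ - ε ^ 2 / 4) * (-1) / (ε ^ 2 - ρ) ^ 2 = -(E (ρ - ε ^ 2 / 4) / (ε ^ 2 - ρ) ^ 2) := by ring
    rw [h8]
    linarith
  · intro A
    have he : 0 < E (ε ^ 2 / 4) := expNegInvGlue.pos_of_pos (by positivity)
    refine ⟨max (ε ^ 2 / 2) (ε ^ 2 - E (ε ^ 2 / 4) / (|A| + 1)), ?_, ?_, ?_⟩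
    · exact le_max_of_le_left (by positivity)
    · apply max_lt
      · have : 0 < ε ^ 2 := by positivity
        linarith
      · have : 0 < E (ε ^ 2 / 4) / (|A| + 1) := by positivity
        linarith
    · intro ρ hρ hA
      by_contra hcon
      push Not at hcon
      rw [max_lt_iff] at hcon
      have hpos : 0 < ε ^ 2 - ρ := by linarith
      have h1 : E (ρ - ε ^ 2 / 4) / (ε ^ 2 - ρ) ≤ |A| := by
        simp only [hb] at hA
        linarith [le_abs_self A]
      rw [div_le_iff₀ hpos] at h1
      have h2 : E (ε ^ 2 / 4) ≤ E (ρ - ε ^ 2 / 4) := expNegInvGlue.monotone (by linarith)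
      have h3 : ε ^ 2 - ρ < E (ε ^ 2 / 4) / (|A| + 1) := by linarith
      rw [lt_div_iff₀ (by positivity)] at h3
      nlinarith [abs_nonneg A]

end Aux

end PartE4

section PartE5
open Metric Filter Topology

section MainA
variable {N r : ℕ} {f : Fin r → EuclideanSpace ℂ (Fin N) → ℂ} {ε₀ : ℝ}

/-- the pushing function -/
noncomputable def Lfun (f : Fin r → EuclideanSpace ℂ (Fin N) → ℂ) (s : Fin r) (S : Finset (Fin r)) (ℓ b : ℝ → ℝ) (δ : ℝ) :
    ℂ × EuclideanSpace ℂ (Fin N) → ℝ :=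
  fun z => ℓ (‖f s z.2 - z.1‖ ^ 2) + δ * (LS f S z.2 + b (‖z.2‖ ^ 2))

/-- the domain -/
def Gset (f : Fin r → EuclideanSpace ℂ (Fin N) → ℂ) (S : Finset (Fin r)) (ε : ℝ) : Set (ℂ × EuclideanSpace ℂ (Fin N)) :=
  {z | ‖z.2‖ < ε ∧ ∀ i ∈ S, f i z.2 ≠ 0}

lemma GoodF.Gset_nhds (hf : GoodF f ε₀) (S : Finset (Fin r)) (ε : ℝ) (hε : ε ≤ ε₀) (z : ℂ × EuclideanSpace ℂ (Fin N))
    (hz : z ∈ Gset f S ε) : Gset f S ε ∈ 𝓝 z := by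
  have hsnd : Tendsto (fun z : ℂ × EuclideanSpace ℂ (Fin N) => z.2) (𝓝 z) (𝓝 z.2) := continuous_snd.tendsto z
  have h1 := hsnd.eventually (hf.ev_ne S z.2 (hz.1.le.trans hε) hz.2)
  have h2 := hsnd.eventually (continuous_norm.continuousAt.eventually (gt_mem_nhds hz.1))
  filter_upwards [h1, h2] with w h1 h2
  exact ⟨h2, h1⟩

lemma sq_lt_of_norm {x : EuclideanSpace ℂ (Fin N)} {ε : ℝ} (h : ‖x‖ < ε) : ‖x‖ ^ 2 < ε ^ 2 :=
  pow_lt_pow_left₀ h (norm_nonneg _) two_ne_zero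

lemma GoodF.Lfun_contDiffAt (hf : GoodF f ε₀) (s : Fin r) (S : Finset (Fin r)) (ε : ℝ) (hε : ε ≤ ε₀) (ℓ b : ℝ → ℝ) (δ : ℝ)
    (hℓ : ContDiff ℝ 1 ℓ) (hb : ∀ ρ, ρ < ε ^ 2 → ContDiffAt ℝ 1 b ρ) (z : ℂ × EuclideanSpace ℂ (Fin N))
    (hz : z ∈ Gset f S ε) : ContDiffAt ℝ 1 (Lfun f s S ℓ b δ) z := by
  have h1 : ContDiffAt ℝ 1 (fun z : ℂ × EuclideanSpace ℂ (Fin N) => f s z.2) z :=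
    ContDiffAt.comp z (g := f s) (contDiffAt_real (f s) z.2 (hf.an s z.2 (hz.1.le.trans hε))) contDiffAt_snd
  have h2 : ContDiffAt ℝ 1 (fun z : ℂ × EuclideanSpace ℂ (Fin N) => ‖f s z.2 - z.1‖ ^ 2) z :=
    (h1.sub contDiffAt_fst).norm_sq (𝕜 := ℂ)
  have h3 : ContDiffAt ℝ 1 (fun z : ℂ × EuclideanSpace ℂ (Fin N) => LS f S z.2) z :=
    ContDiffAt.comp z (g := LS f S) (hf.LS_contDiffAt S z.2 (hz.1.le.trans hε) hz.2) contDiffAt_snd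
  have h4 : ContDiffAt ℝ 1 (fun z : ℂ × EuclideanSpace ℂ (Fin N) => ‖z.2‖ ^ 2) z :=
    contDiffAt_snd.norm_sq (𝕜 := ℂ)
  have h5 : ContDiffAt ℝ 1 (fun z : ℂ × EuclideanSpace ℂ (Fin N) => b (‖z.2‖ ^ 2)) z :=
    ContDiffAt.comp z (g := b) (hb _ (sq_lt_of_norm hz.1)) h4
  have h6 : ContDiffAt ℝ 1 (fun z : ℂ × EuclideanSpace ℂ (Fin N) => ℓ (‖f s z.2 - z.1‖ ^ 2)) z :=
    ContDiffAt.comp z (g := ℓ) hℓ.contDiffAt h2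
  exact h6.add (contDiffAt_const.mul (h3.add h5))

lemma GoodF.Lfun_hasDerivAt (hf : GoodF f ε₀) (s : Fin r) (S : Finset (Fin r)) (ε : ℝ) (hε : ε ≤ ε₀) (ℓ b : ℝ → ℝ) (δ g : ℝ)
    (hℓd : ∀ t, HasDerivAt ℓ (-(max t g)⁻¹) t) (hb : ∀ ρ, ρ < ε ^ 2 → ContDiffAt ℝ 1 b ρ)
    (t0 : ℂ) (x v : EuclideanSpace ℂ (Fin N)) (hz : (t0, x) ∈ Gset f S ε) :
    HasDerivAt (fun t : ℝ => Lfun f s S ℓ b δ (t0, x + t • v))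
      (-(max (‖f s x - t0‖ ^ 2) g)⁻¹ * (2 * inner ℝ (f s x - t0) (fderiv ℂ (f s) x v)) +
        δ * ((∑ i ∈ S, 2 * inner ℝ (f i x) (fderiv ℂ (f i) x v) / ‖f i x‖ ^ 2) +
          deriv b (‖x‖ ^ 2) * (2 * (inner ℂ x v).re))) 0 := by
  have hx : ‖x‖ ≤ ε₀ := hz.1.le.trans hε
  have e0 : x + (0:ℝ) • v = x := by simp
  have h1 : HasDerivAt (fun t : ℝ => ‖f s (x + t • v) - t0‖ ^ 2) (2 * inner ℝ (f s x - t0) (fderiv ℂ (f s) x v)) 0 := by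
    have := ((hasDerivAt_line (f s) x v (hf.an s x hx)).sub_const t0).norm_sq
    rw [e0] at this
    exact this
  have h2 : HasDerivAt (fun t : ℝ => ℓ (‖f s (x + t • v) - t0‖ ^ 2))
      (-(max (‖f s x - t0‖ ^ 2) g)⁻¹ * (2 * inner ℝ (f s x - t0) (fderiv ℂ (f s) x v))) 0 := by
    refine HasDerivAt.comp (0:ℝ) (h₂ := ℓ) ?_ h1
    rw [e0]
    exact hℓd _
  have h3 : HasDerivAt (fun t : ℝ => b (‖x + t • v‖ ^ 2)) (deriv b (‖x‖ ^ 2) * (2 * (inner ℂ x v).re)) 0 := by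
    refine HasDerivAt.comp (0:ℝ) (h₂ := b) ?_ (hasDerivAt_rho x v)
    rw [e0]
    exact ((hb _ (sq_lt_of_norm hz.1)).differentiableAt one_ne_zero).hasDerivAt
  exact h2.add (((hf.LS_hasDerivAt S x v hx hz.2).add h3).const_mul δ)

lemma GoodF.push_of_D (hf : GoodF f ε₀) {Q : Type} [MetricSpace Q] [CompactSpace Q] (τ : C(Q, ℂ)) (s : Fin r) (S : Finset (Fin r)) (ε : ℝ) (hε : ε ≤ ε₀) (ℓ b : ℝ → ℝ) (δ g : ℝ)
    (hℓ : ContDiff ℝ 1 ℓ) (hℓd : ∀ t, HasDerivAt ℓ (-(max t g)⁻¹) t) (hb : ∀ ρ, ρ < ε ^ 2 → ContDiffAt ℝ 1 b ρ)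
    (q : Q) (x v : EuclideanSpace ℂ (Fin N)) (hz : (τ q, x) ∈ Gset f S ε)
    (hD : 0 < -(max (‖f s x - τ q‖ ^ 2) g)⁻¹ * (2 * inner ℝ (f s x - τ q) (fderiv ℂ (f s) x v)) +
        δ * ((∑ i ∈ S, 2 * inner ℝ (f i x) (fderiv ℂ (f i) x v) / ‖f i x‖ ^ 2) +
          deriv b (‖x‖ ^ 2) * (2 * (inner ℂ x v).re))) :
    Pushable {p : Q × EuclideanSpace ℂ (Fin N) | (τ p.1, p.2) ∈ Gset f S ε} (fun p => Lfun f s S ℓ b δ (τ p.1, p.2)) (q, x) := by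
  have e1 : ∀ (z : ℂ × EuclideanSpace ℂ (Fin N)) (t : ℝ), z + t • ((0:ℂ), v) = (z.1, z.2 + t • v) := by
    intro z t
    ext <;> simp
  have hd := hf.Lfun_hasDerivAt s S ε hε ℓ b δ g hℓd hb (τ q) x v hz
  obtain ⟨c, hc, θ, hθ, he⟩ := dir_push (Lfun f s S ℓ b δ) (τ q, x) (0, v) _ (hf.Lfun_contDiffAt s S ε hε ℓ b δ hℓ hb _ hz)
    (by simp only [e1]; exact hd) hD
  obtain ⟨θ2, hθ2, he2⟩ := ev_line (fun z => z ∈ Gset f S ε) (τ q, x) ((0:ℂ), v) (hf.Gset_nhds S ε hε _ hz)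
  refine pushable_of_dir τ _ _ (q, x) v c (min θ θ2) hc (by positivity) ?_
  filter_upwards [he, he2] with z h1 h2 _ t ht ht'
  rw [le_min_iff] at ht'
  rw [← e1]
  exact ⟨h2 t ht ht'.2, h1 t ht ht'.1⟩

lemma log_norm_sq_eq (a w : ℂ) (ha : a ≠ 0) (hw : w ≠ 0) :
    Real.log (‖a‖ ^ 2) = (2 * Complex.log (a / w)).re + Real.log (‖w‖ ^ 2) := by
  have h1 := norm_ne_zero_iff.2 ha
  have h2 := norm_ne_zero_iff.2 hw
  have h3 : (2 * Complex.log (a / w)).re = 2 * Real.log ‖a / w‖ := by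
    rw [← Complex.log_re]; simp
  rw [h3, norm_div, Real.log_div h1 h2, Real.log_pow, Real.log_pow]
  push_cast; ring

/-- case A -/
lemma GoodF.push_A (hf : GoodF f ε₀) {d : ℕ} (hd : d < N) (τ : C(closedBall (0 : Fin d → ℝ) 1, ℂ)) (s : Fin r) (S : Finset (Fin r))
    (ε : ℝ) (hε : ε ≤ ε₀) (hε0 : 0 < ε) (ℓ b : ℝ → ℝ) (δ g : ℝ) (hδ : 0 < δ) (hg : 0 < g) (hℓl : ∀ t, g ≤ t → ℓ t = -Real.log t)
    (hb : ∀ ρ, ρ ≤ ε ^ 2 / 4 → b ρ = ρ - ε ^ 2)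
    (q : closedBall (0 : Fin d → ℝ) 1) (x : EuclideanSpace ℂ (Fin N)) (hz : (τ q, x) ∈ Gset f S ε)
    (hx : ‖x‖ < ε / 2) (hG : g < ‖f s x - τ q‖ ^ 2) :
    Pushable {p : (closedBall (0 : Fin d → ℝ) 1) × EuclideanSpace ℂ (Fin N) | (τ p.1, p.2) ∈ Gset f S ε}
      (fun p => Lfun f s S ℓ b δ (τ p.1, p.2)) (q, x) := by
  have hxε : ‖x‖ ≤ ε₀ := hz.1.le.trans hε
  set w0 := f s x - τ q with hw0
  have hw0' : w0 ≠ 0 := by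
    intro h; rw [h] at hG; simp at hG; linarith
  have hz2 : ∀ i ∈ S, f i x ≠ 0 := hz.2
  have hsndA : AnalyticAt ℂ (fun z : ℂ × EuclideanSpace ℂ (Fin N) => z.2) (τ q, x) := analyticAt_snd
  have hfA : ∀ i, AnalyticAt ℂ (fun z : ℂ × EuclideanSpace ℂ (Fin N) => f i z.2) (τ q, x) := fun i =>
    AnalyticAt.comp (g := f i) (f := fun z : ℂ × EuclideanSpace ℂ (Fin N) => z.2) (hf.an i x hxε) hsndA
  have hGA : AnalyticAt ℂ (fun z : ℂ × EuclideanSpace ℂ (Fin N) => f s z.2 - z.1) (τ q, x) := (hfA s).sub analyticAt_fst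
  refine pushable_slice hd τ (Gset f S ε) _ (q, x) (hf.Gset_nhds S ε hε _ hz)
    (fun z => -(2 * Complex.log ((f s z.2 - z.1) / w0)) + (δ:ℂ) * ∑ i ∈ S, 2 * Complex.log (f i z.2 / f i x)) ?_ δ
    (-Real.log (‖w0‖ ^ 2) + δ * ((∑ i ∈ S, Real.log (‖f i x‖ ^ 2)) - ε ^ 2)) hδ ?_
  · refine AnalyticAt.add (AnalyticAt.neg (analyticAt_const.mul (AnalyticAt.clog (hGA.div analyticAt_const hw0') ?_)))
      (analyticAt_const.mul (Finset.analyticAt_fun_sum _ fun i hi => analyticAt_const.mul (AnalyticAt.clog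
        ((hfA i).div analyticAt_const (hz2 i hi)) ?_)))
    · show (f s x - τ q) / w0 ∈ _
      rw [div_self hw0']; exact Complex.one_mem_slitPlane
    · show f i x / f i x ∈ _
      rw [div_self (hz2 i hi)]; exact Complex.one_mem_slitPlane
  · have h1 : ∀ᶠ z in 𝓝 ((τ q, x) : ℂ × EuclideanSpace ℂ (Fin N)), g < ‖f s z.2 - z.1‖ ^ 2 :=
      (hGA.continuousAt.norm.pow 2).eventually (lt_mem_nhds hG)
    have h2 : ∀ᶠ z in 𝓝 ((τ q, x) : ℂ × EuclideanSpace ℂ (Fin N)), ‖z.2‖ < ε / 2 :=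
      (hsndA.continuousAt.norm).eventually (gt_mem_nhds hx)
    filter_upwards [h1, h2, hf.Gset_nhds S ε hε _ hz] with z h1 h2 h3
    have hne : f s z.2 - z.1 ≠ 0 := by
      intro h; rw [h] at h1; simp at h1; linarith
    have h4 : ‖z.2‖ ^ 2 ≤ ε ^ 2 / 4 := by nlinarith [norm_nonneg z.2]
    unfold Lfun LS
    rw [hℓl _ h1.le, hb _ h4, log_norm_sq_eq _ w0 hne hw0',
      Finset.sum_congr rfl fun i hi => log_norm_sq_eq (f i z.2) (f i x) (h3.2 i hi) (hz2 i hi), Finset.sum_add_distrib,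
      Complex.add_re, Complex.neg_re, Complex.re_ofReal_mul, Complex.re_sum]
    ring

lemma sum_low {r : ℕ} (S : Finset (Fin r)) (T : Fin r → ℝ) (c : ℝ) (hc : 0 ≤ c) (h : ∀ i ∈ S, -c ≤ T i) :
    -(r * c) ≤ ∑ i ∈ S, T i := by
  have h1 : (S.card : ℝ) ≤ r := by
    have := Finset.card_le_univ S
    simp at this
    exact_mod_cast this
  have h2 := Finset.card_nsmul_le_sum S T (-c) h
  rw [nsmul_eq_mul] at h2
  nlinarith

lemma sum_low' {r : ℕ} (S : Finset (Fin r)) (T : Fin r → ℝ) (c : ℝ) (hc : 0 ≤ c) (h : ∀ i ∈ S, -c ≤ T i) (i0 : Fin r)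
    (hi0 : i0 ∈ S) (h0 : T i0 = 2) : 2 - r * c ≤ ∑ i ∈ S, T i := by
  classical
  rw [← Finset.add_sum_erase S _ hi0, h0]
  have := sum_low (S.erase i0) T c hc (fun i hi => h i (Finset.mem_of_mem_erase hi))
  linarith

/-- sums of log derivatives, case of prescribed zero -/
lemma GoodF.sumZ (hf : GoodF f ε₀) (S : Finset (Fin r)) (M : ℝ) (hM : ∀ i x, ‖x‖ ≤ ε₀ → ‖fderiv ℂ (f i) x‖ ≤ M) (hM0 : 0 < M)
    (x v : EuclideanSpace ℂ (Fin N)) (hx : ‖x‖ ≤ ε₀) (A η : ℝ) (hη : 0 < η) (hv : ‖v‖ ≤ A)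
    (h : ∀ i ∈ S, ‖f i x‖ ≤ η → fderiv ℂ (f i) x v = 0) :
    -(r * (2 * (M * A) / η)) ≤ ∑ i ∈ S, 2 * inner ℝ (f i x) (fderiv ℂ (f i) x v) / ‖f i x‖ ^ 2 := by
  have hA : 0 ≤ A := (norm_nonneg _).trans hv
  apply sum_low
  · positivity
  · intro i hi
    by_cases hi' : ‖f i x‖ ≤ η
    · rw [h i hi hi']
      simp only [inner_zero_right, mul_zero, zero_div, Left.neg_nonpos_iff]
      positivity
    · push Not at hi'
      refine logder_bound _ _ η _ hη hi' ?_
      calc _ ≤ ‖fderiv ℂ (f i) x‖ * ‖v‖ := ContinuousLinearMap.le_opNorm _ _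
        _ ≤ M * A := by gcongr; exact hM i x hx

/-- sums of log derivatives, case with a small value -/
lemma GoodF.sumB (hf : GoodF f ε₀) (S : Finset (Fin r)) (M : ℝ) (hM : ∀ i x, ‖x‖ ≤ ε₀ → ‖fderiv ℂ (f i) x‖ ≤ M) (hM0 : 0 < M)
    (x v : EuclideanSpace ℂ (Fin N)) (hx : ‖x‖ ≤ ε₀) (A η η2 : ℝ) (hη : 0 < η) (hη2 : η2 ≤ η) (hv : ‖v‖ ≤ A)
    (hne : ∀ i ∈ S, f i x ≠ 0)
    (h : ∀ i ∈ S, ‖f i x‖ ≤ η → ‖f i x‖ ≤ η2 → fderiv ℂ (f i) x v = f i x)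
    (h' : ∀ i ∈ S, ‖f i x‖ ≤ η → ¬ ‖f i x‖ ≤ η2 → fderiv ℂ (f i) x v = 0) (i0 : Fin r) (hi0 : i0 ∈ S) (hs : ‖f i0 x‖ ≤ η2) :
    2 - r * (2 * (M * A) / η) ≤ ∑ i ∈ S, 2 * inner ℝ (f i x) (fderiv ℂ (f i) x v) / ‖f i x‖ ^ 2 := by
  have hA : 0 ≤ A := (norm_nonneg _).trans hv
  have hc : 0 ≤ 2 * (M * A) / η := by positivity
  refine sum_low' S _ _ hc ?_ i0 hi0 ?_
  · intro i hi
    by_cases hi' : ‖f i x‖ ≤ η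
    · by_cases hi2 : ‖f i x‖ ≤ η2
      · rw [h i hi hi' hi2, logder_self _ (hne i hi)]; linarith
      · rw [h' i hi hi' hi2]
        simp only [inner_zero_right, mul_zero, zero_div, Left.neg_nonpos_iff]
        positivity
    · push Not at hi'
      refine logder_bound _ _ η _ hη hi' ?_
      calc _ ≤ ‖fderiv ℂ (f i) x‖ * ‖v‖ := ContinuousLinearMap.le_opNorm _ _
        _ ≤ M * A := by gcongr; exact hM i x hx
  · rw [h i0 hi0 (hs.trans hη2) hs, logder_self _ (hne i0 hi0)]

end MainA

end PartE5

section PartE6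
open Metric Filter Topology

section MainB
variable {N r : ℕ} {f : Fin r → EuclideanSpace ℂ (Fin N) → ℂ} {ε₀ : ℝ}

lemma GoodF.LS_ge (hf : GoodF f ε₀) (S : Finset (Fin r)) (x : EuclideanSpace ℂ (Fin N)) (η2 : ℝ) (hη2 : 0 < η2)
    (h : ∀ i ∈ S, η2 < ‖f i x‖) : -(r * |Real.log (η2 ^ 2)|) ≤ LS f S x := by
  refine sum_low S _ _ (abs_nonneg _) fun i hi => ?_
  have h1 : Real.log (η2 ^ 2) ≤ Real.log (‖f i x‖ ^ 2) :=
    Real.log_le_log (by positivity) (pow_le_pow_left₀ hη2.le (h i hi).le 2)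
  linarith [neg_abs_le (Real.log (η2 ^ 2))]

set_option maxHeartbeats 2000000 in
lemma GoodF.push_cases (hf : GoodF f ε₀) {d : ℕ} (hd : d < N) (τ : C(closedBall (0 : Fin d → ℝ) 1, ℂ)) (s : Fin r) (S : Finset (Fin r))
    (hsS : s ∉ S) (ε : ℝ) (hε : ε ≤ ε₀) (hε0 : 0 < ε)
    (C1 η : ℝ) (hC1 : 0 < C1) (hη : 0 < η) (hT4 : ∀ x, ε / 2 ≤ ‖x‖ → ‖x‖ ≤ ε → ∀ (w0 : ℂ) (w : Fin r → ℂ) (B : ℝ), ‖w0‖ ≤ B →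
      (∀ i, ‖w i‖ ≤ B) → ∃ v : EuclideanSpace ℂ (Fin N), ‖v‖ ≤ C1 * B ∧ inner ℂ x v = w0 ∧
        ∀ i, ‖f i x‖ ≤ η → fderiv ℂ (f i) x v = w i)
    (M : ℝ) (hM : 0 < M) (hMb : ∀ i x, ‖x‖ ≤ ε₀ → ‖fderiv ℂ (f i) x‖ ≤ M)
    (m : ℝ) (hm : 0 < m) (C2 η' : ℝ) (hC2 : 0 < C2) (hη' : 0 < η') (hT6 : ∀ x, m / 2 ≤ ‖f s x‖ → ‖x‖ ≤ ε →
      ∀ (w0 : ℂ) (w : Fin r → ℂ) (B : ℝ), ‖w0‖ ≤ B →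
      (∀ i, ‖w i‖ ≤ B) → ∃ v : EuclideanSpace ℂ (Fin N), ‖v‖ ≤ C2 * B ∧ fderiv ℂ (f s) x v = w0 ∧
        ∀ i, ‖f i x‖ ≤ η' → fderiv ℂ (f i) x v = w i)
    (η2 : ℝ) (hη20 : 0 < η2) (hη2η' : η2 ≤ η') (hη2η : η2 ≤ η)
    (hη2A : η2 * (r * (2 * (M * C2) / η') + 2 * (ε * C2) + r * (2 * (M * C1) / η)) < 1)
    (g1 g0 δ R : ℝ) (hg0 : 0 < g0) (hg01 : g0 ≤ g1) (hg1m : g1 ≤ m / 8)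
    (hδ : 0 < δ) (hδ1 : δ * (r * |Real.log (η2 ^ 2)| + ε ^ 2) ≤ 1 / 4) (hδ2 : δ * (r * (M * C1)) ≤ 1 / 4)
    (hR : R = ε ^ 2 * (3 + r * (M * C1 / η))) (hgl : -Real.log (g0 ^ 2) = -Real.log (g1 ^ 2) + δ * R + 1)
    (ℓ b : ℝ → ℝ) (hℓ : ContDiff ℝ 1 ℓ) (hℓl : ∀ t, g0 ^ 2 ≤ t → ℓ t = -Real.log t)
    (hℓd : ∀ t, HasDerivAt ℓ (-(max t (g0 ^ 2))⁻¹) t) (hℓa : Antitone ℓ)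
    (hb : ∀ ρ, ρ < ε ^ 2 → ContDiffAt ℝ 1 b ρ) (hbl : ∀ ρ, ρ ≤ ε ^ 2 / 4 → b ρ = ρ - ε ^ 2)
    (hbd : ∀ R ρ, 0 ≤ ρ → ρ < ε ^ 2 → b ρ ≤ -R → deriv b ρ ≤ 2 - R / ε ^ 2)
    (q : closedBall (0 : Fin d → ℝ) 1) (x : EuclideanSpace ℂ (Fin N)) (hz : (τ q, x) ∈ Gset f S ε)
    (hτm : m ≤ ‖τ q‖) (hτη : ‖τ q‖ ≤ η / 8) (hGη : ‖f s x - τ q‖ ≤ η / 2)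
    (hhi : Lfun f s S ℓ b δ (τ q, x) ≤ -Real.log (4 * g1 ^ 2) + 1 / 4) :
    Pushable {p : (closedBall (0 : Fin d → ℝ) 1) × EuclideanSpace ℂ (Fin N) | (τ p.1, p.2) ∈ Gset f S ε}
      (fun p => Lfun f s S ℓ b δ (τ p.1, p.2)) (q, x) := by
  classical
  have hxε : ‖x‖ < ε := hz.1
  have hxε₀ : ‖x‖ ≤ ε₀ := hz.1.le.trans hε
  have hne : ∀ i ∈ S, f i x ≠ 0 := hz.2
  have hg1 : 0 < g1 := hg0.trans_le hg01
  have hg2 : (0:ℝ) < g0 ^ 2 := by positivity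
  have hlog4 : -Real.log (4 * g1 ^ 2) < -Real.log (g1 ^ 2) - 1 := by
    rw [Real.log_mul (by norm_num) (by positivity), show (4:ℝ) = 2 ^ 2 by norm_num, Real.log_pow]
    have := Real.log_two_gt_d9
    push_cast
    linarith
  have hfs : ‖f s x‖ ≤ η := by
    have : ‖f s x‖ ≤ ‖f s x - τ q‖ + ‖τ q‖ := by simpa using norm_add_le (f s x - τ q) (τ q)
    linarith
  have hA1 : 0 ≤ r * (2 * (M * C2) / η') := by positivity
  have hA2 : 0 ≤ 2 * (ε * C2) := by positivity
  have hA3 : 0 ≤ r * (2 * (M * C1) / η) := by positivity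
  have hLS2 : (∀ i ∈ S, η2 < ‖f i x‖) → -(r * |Real.log (η2 ^ 2)|) ≤ LS f S x := hf.LS_ge S x η2 hη20
  have hB1 : 0 ≤ η2 * (r * (2 * (M * C2) / η')) := by positivity
  have hB2 : 0 ≤ η2 * (2 * (ε * C2)) := by positivity
  have hB3 : 0 ≤ η2 * (r * (2 * (M * C1) / η)) := by positivity
  rw [mul_add, mul_add] at hη2A
  set w : Fin r → ℂ := fun i => if i ∈ S ∧ ‖f i x‖ ≤ η2 then f i x else 0 with hw
  have hwB : ∀ i, ‖w i‖ ≤ η2 := by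
    intro i
    simp only [hw]
    split_ifs with h
    · exact h.2
    · simpa using hη20.le
  have hws : w s = 0 := by simp [hw, hsS]
  have hw1 : ∀ i ∈ S, ‖f i x‖ ≤ η2 → w i = f i x := fun i hi h => by simp [hw, hi, h]
  have hw2 : ∀ i ∈ S, ¬ ‖f i x‖ ≤ η2 → w i = 0 := fun i hi h => by simp only [hw, hi, h, and_false, if_false]
  by_cases hx2 : ‖x‖ < ε / 2
  · -- inner region
    have hρ : ‖x‖ ^ 2 < ε ^ 2 / 4 := by nlinarith [norm_nonneg x]
    by_cases hG1 : g1 < ‖f s x - τ q‖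
    · refine hf.push_A hd τ s S ε hε hε0 ℓ b δ (g0 ^ 2) hδ hg2 hℓl hbl q x hz hx2 ?_
      exact (pow_le_pow_left₀ hg0.le hg01 2).trans_lt (pow_lt_pow_left₀ hG1 hg1.le two_ne_zero)
    · push Not at hG1
      by_cases hex : ∃ i ∈ S, ‖f i x‖ ≤ η2
      · obtain ⟨i0, hi0, hs0⟩ := hex
        have hfsm : m / 2 ≤ ‖f s x‖ := by
          have : ‖τ q‖ ≤ ‖f s x‖ + ‖f s x - τ q‖ := by
            have h := norm_sub_le (f s x) (f s x - τ q)
            simpa using h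
          linarith
        obtain ⟨v, hv1, hv2, hv3⟩ := hT6 x hfsm hxε.le 0 w η2 (by simpa using hη20.le) hwB
        refine hf.push_of_D τ s S ε hε ℓ b δ (g0 ^ 2) hℓ hℓd hb q x v hz ?_
        have hsum := hf.sumB S M hMb hM x v hxε₀ (C2 * η2) η' η2 hη' hη2η' hv1 hne
          (fun i hi h h2 => by rw [hv3 i h, hw1 i hi h2]) (fun i hi h h2 => by rw [hv3 i h, hw2 i hi h2]) i0 hi0 hs0
        have hb' : deriv b (‖x‖ ^ 2) = 1 := by
          have : b =ᶠ[𝓝 (‖x‖ ^ 2)] fun ρ => ρ - ε ^ 2 := by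
            filter_upwards [gt_mem_nhds hρ] with ρ hρ using hbl ρ hρ.le
          rw [this.deriv_eq]
          simp
        have hin : -(ε * (C2 * η2)) ≤ (inner ℂ x v).re := by
          have h1 : ‖inner ℂ x v‖ ≤ ‖x‖ * ‖v‖ := norm_inner_le_norm x v
          have h2 := (abs_le.1 (Complex.abs_re_le_norm (inner ℂ x v))).1
          have h3 : ‖x‖ * ‖v‖ ≤ ε * (C2 * η2) := by gcongr
          linarith
        rw [hv2, hb']
        simp only [inner_zero_right, mul_zero, zero_add, one_mul]
        apply mul_pos hδ
        have e1 : r * (2 * (M * (C2 * η2)) / η') = η2 * (r * (2 * (M * C2) / η')) := by ring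
        rw [e1] at hsum
        have e2 : η2 * (2 * (ε * C2)) = 2 * (ε * (C2 * η2)) := by ring
        linarith
      · push Not at hex
        exfalso
        have h1 := hLS2 hex
        have h2 : ℓ (g1 ^ 2) ≤ ℓ (‖f s x - τ q‖ ^ 2) := hℓa (by gcongr)
        rw [hℓl _ (by gcongr)] at h2
        have h3 : b (‖x‖ ^ 2) = ‖x‖ ^ 2 - ε ^ 2 := hbl _ hρ.le
        have h4 : Lfun f s S ℓ b δ (τ q, x) = ℓ (‖f s x - τ q‖ ^ 2) + δ * (LS f S x + b (‖x‖ ^ 2)) := rfl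
        rw [h4, h3] at hhi
        have h5 : δ * (-(r * |Real.log (η2 ^ 2)|) - ε ^ 2) ≤ δ * (LS f S x + (‖x‖ ^ 2 - ε ^ 2)) := by
          have := sq_nonneg ‖x‖
          gcongr; linarith
        have h6 : δ * (-(r * |Real.log (η2 ^ 2)|) - ε ^ 2) = -(δ * (r * |Real.log (η2 ^ 2)| + ε ^ 2)) := by ring
        linarith
  · push Not at hx2
    by_cases hG0 : g0 / 2 < ‖f s x - τ q‖
    · obtain ⟨v, hv1, hv2, hv3⟩ := hT4 x hx2 hxε.le 0 (fun i => if i = s then -(f s x - τ q) else 0) ‖f s x - τ q‖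
        (by simp) (by
          intro i
          split_ifs
          · rw [norm_neg]
          · simp)
      refine hf.push_of_D τ s S ε hε ℓ b δ (g0 ^ 2) hℓ hℓd hb q x v hz ?_
      have hsum := hf.sumZ S M hMb hM x v hxε₀ _ η hη hv1 (fun i hi h => by
        rw [hv3 i h, if_neg (by rintro rfl; exact hsS hi)])
      rw [hv3 s hfs, if_pos rfl, hv2, inner_neg_right, real_inner_self_eq_norm_sq]
      simp only [Complex.zero_re, mul_zero, add_zero]
      have e1 : r * (2 * (M * (C1 * ‖f s x - τ q‖)) / η) ≤ r * (M * C1) := by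
        have : 2 * (M * (C1 * ‖f s x - τ q‖)) / η ≤ M * C1 := by
          rw [div_le_iff₀ hη]
          have : M * C1 * ‖f s x - τ q‖ ≤ M * C1 * (η / 2) := by gcongr
          linarith
        gcongr
      have e2 : 1 / 2 ≤ -(max (‖f s x - τ q‖ ^ 2) (g0 ^ 2))⁻¹ * (2 * -‖f s x - τ q‖ ^ 2) := by
        have h1 : 0 < max (‖f s x - τ q‖ ^ 2) (g0 ^ 2) := lt_max_of_lt_right hg2
        have h2 : max (‖f s x - τ q‖ ^ 2) (g0 ^ 2) ≤ 4 * ‖f s x - τ q‖ ^ 2 := by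
          apply max_le
          · nlinarith [sq_nonneg ‖f s x - τ q‖]
          · nlinarith
        have h3 : -(max (‖f s x - τ q‖ ^ 2) (g0 ^ 2))⁻¹ * (2 * -‖f s x - τ q‖ ^ 2) =
          2 * ‖f s x - τ q‖ ^ 2 / max (‖f s x - τ q‖ ^ 2) (g0 ^ 2) := by
          rw [div_eq_mul_inv]; ring
        rw [h3, div_le_div_iff₀ two_pos h1]
        linarith
      have e3 : -(1 / 4) ≤ δ * ∑ i ∈ S, 2 * inner ℝ (f i x) (fderiv ℂ (f i) x v) / ‖f i x‖ ^ 2 := by nlinarith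
      linarith
    · push Not at hG0
      by_cases hex : ∃ i ∈ S, ‖f i x‖ ≤ η2
      · obtain ⟨i0, hi0, hs0⟩ := hex
        obtain ⟨v, hv1, hv2, hv3⟩ := hT4 x hx2 hxε.le 0 w η2 (by simpa using hη20.le) hwB
        refine hf.push_of_D τ s S ε hε ℓ b δ (g0 ^ 2) hℓ hℓd hb q x v hz ?_
        have hsum := hf.sumB S M hMb hM x v hxε₀ (C1 * η2) η η2 hη hη2η hv1 hne
          (fun i hi h h2 => by rw [hv3 i h, hw1 i hi h2]) (fun i hi h h2 => by rw [hv3 i h, hw2 i hi h2]) i0 hi0 hs0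
        rw [hv3 s hfs, hws, hv2]
        simp only [inner_zero_right, mul_zero, zero_add, Complex.zero_re, add_zero]
        apply mul_pos hδ
        have e1 : r * (2 * (M * (C1 * η2)) / η) = η2 * (r * (2 * (M * C1) / η)) := by ring
        rw [e1] at hsum
        linarith
      · push Not at hex
        have h1 := hLS2 hex
        by_cases hbR : -R ≤ b (‖x‖ ^ 2)
        · exfalso
          have h2 : ℓ (g0 ^ 2) ≤ ℓ (‖f s x - τ q‖ ^ 2) := hℓa (by
            apply pow_le_pow_left₀ (norm_nonneg _); linarith)
          rw [hℓl _ le_rfl] at h2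
          have h4 : Lfun f s S ℓ b δ (τ q, x) = ℓ (‖f s x - τ q‖ ^ 2) + δ * (LS f S x + b (‖x‖ ^ 2)) := rfl
          rw [h4] at hhi
          have h5 : δ * (-(r * |Real.log (η2 ^ 2)|) + -R) ≤ δ * (LS f S x + b (‖x‖ ^ 2)) := by gcongr
          have h6 : δ * (-(r * |Real.log (η2 ^ 2)|) + -R) = -(δ * (r * |Real.log (η2 ^ 2)| + ε ^ 2)) + δ * ε ^ 2 - δ * R := by ring
          have h7 : 0 ≤ δ * ε ^ 2 := by positivity
          linarith
        · push Not at hbR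
          obtain ⟨v, hv1, hv2, hv3⟩ := hT4 x hx2 hxε.le (-1) 0 1 (by simp) (by simp)
          refine hf.push_of_D τ s S ε hε ℓ b δ (g0 ^ 2) hℓ hℓd hb q x v hz ?_
          have hsum := hf.sumZ S M hMb hM x v hxε₀ _ η hη hv1 (fun i hi h => by
            rw [hv3 i h]; rfl)
          have hd1 := hbd R (‖x‖ ^ 2) (sq_nonneg _) (sq_lt_of_norm hxε) hbR.le
          have hRe : R / ε ^ 2 = 3 + r * (M * C1 / η) := by rw [hR]; field_simp
          rw [hRe] at hd1
          rw [hv3 s hfs, hv2]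
          simp only [Pi.zero_apply, inner_zero_right, mul_zero, zero_add, Complex.neg_re, Complex.one_re]
          apply mul_pos hδ
          have e1 : r * (2 * (M * (C1 * 1)) / η) = 2 * (r * (M * C1 / η)) := by ring
          rw [e1] at hsum
          linarith

end MainB

end PartE6

section PartE7
open Metric Filter Topology

section MainC
variable {N r : ℕ} {f : Fin r → EuclideanSpace ℂ (Fin N) → ℂ} {ε₀ : ℝ}

lemma pos_lower {Q : Type} [TopologicalSpace Q] [CompactSpace Q] (τ : C(Q, ℂ)) (h : ∀ q, τ q ≠ 0) :
    ∃ m > (0:ℝ), ∀ q, m ≤ ‖τ q‖ := by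
  have hc : Continuous fun q => (τ q)⁻¹ := τ.continuous.inv₀ h
  obtain ⟨B, hB⟩ := isCompact_univ.exists_bound_of_continuousOn hc.continuousOn
  refine ⟨(|B| + 1)⁻¹, by positivity, fun q => ?_⟩
  have h1 := hB q trivial
  have h2 : ‖(τ q)⁻¹‖ ≤ |B| + 1 := by linarith [le_abs_self B]
  rw [norm_inv] at h2
  have h3 : 0 < ‖τ q‖ := norm_pos_iff.2 (h q)
  exact inv_le_of_inv_le₀ h3 h2

set_option maxHeartbeats 2000000 in
theorem GoodF.main_push (hf : GoodF f ε₀) {d : ℕ} (hd : d < N) (s : Fin r) (S : Finset (Fin r))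
    (hsS : s ∉ S) (ε : ℝ) (hε : ε ≤ ε₀) (hε0 : 0 < ε) : ∃ η > (0:ℝ),
    ∀ (F : C(closedBall (0 : Fin d → ℝ) 1, EuclideanSpace ℂ (Fin N))) (τ : C(closedBall (0 : Fin d → ℝ) 1, ℂ)),
      (∀ q, ‖F q‖ ≤ ε / 2 ∧ (∀ i ∈ S, f i (F q) ≠ 0) ∧ τ q ≠ 0 ∧ ‖τ q‖ ≤ η / 8 ∧ ‖f s (F q)‖ ≤ η / 8) →
      ∃ F' : C(closedBall (0 : Fin d → ℝ) 1, EuclideanSpace ℂ (Fin N)),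
        (∀ q, ‖F' q‖ < ε ∧ (∀ i ∈ S, f i (F' q) ≠ 0) ∧ f s (F' q) ≠ 0) ∧ ∀ q, f s (F q) = τ q → F' q = F q := by
  obtain ⟨C1, hC1, η, hη, hT4⟩ := hf.exists_T4 (ε / 2) ε (by positivity) hε
  obtain ⟨M, hM, hMb⟩ := hf.exists_M
  refine ⟨η, hη, fun F τ hFτ => ?_⟩
  obtain ⟨m, hm, hτm⟩ := pos_lower τ fun q => (hFτ q).2.2.1
  have hFε : ∀ q, ‖F q‖ < ε := fun q => by linarith [(hFτ q).1]
  obtain ⟨B0, hB0, hLSF⟩ : ∃ B0 : ℝ, 0 ≤ B0 ∧ ∀ q, -B0 ≤ LS f S (F q) := by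
    have hcont : Continuous fun q => LS f S (F q) := by
      rw [continuous_iff_continuousAt]
      intro q
      exact ContinuousAt.comp (g := LS f S) (hf.LS_contDiffAt S _ ((hFε q).le.trans hε) (hFτ q).2.1).continuousAt
        F.continuous.continuousAt
    obtain ⟨B, hB⟩ := isCompact_univ.exists_bound_of_continuousOn hcont.continuousOn
    refine ⟨|B|, abs_nonneg _, fun q => ?_⟩
    have h1 := (abs_le.1 (hB q trivial)).1
    linarith [le_abs_self B]
  obtain ⟨C2, hC2, η', hη', hT6⟩ := hf.exists_T6 s ε (m / 2) (by positivity) hε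
  set A : ℝ := r * (2 * (M * C2) / η') + 2 * (ε * C2) + r * (2 * (M * C1) / η) with hA
  have hA0 : 0 ≤ A := by positivity
  set η2 : ℝ := min (min η' η) (A + 1)⁻¹ with hη2
  have hη20 : 0 < η2 := by positivity
  have hη2A : η2 * A < 1 := by
    have h1 : η2 ≤ (A + 1)⁻¹ := min_le_right _ _
    calc η2 * A ≤ (A + 1)⁻¹ * A := by gcongr
      _ < 1 := by rw [inv_mul_lt_one₀ (by positivity)]; linarith
  set g1 : ℝ := min (min (m / 8) (η / 4)) 1 with hg1d
  have hg1 : 0 < g1 := by positivity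
  have hg1m : g1 ≤ m / 8 := (min_le_left _ _).trans (min_le_left _ _)
  have hg1η : g1 ≤ η / 4 := (min_le_left _ _).trans (min_le_right _ _)
  have hg11 : g1 ≤ 1 := min_le_right _ _
  set W : ℝ := 1 + B0 + ε ^ 2 + r * |Real.log (η2 ^ 2)| + r * (M * C1) with hW
  have hW1 : 0 ≤ r * |Real.log (η2 ^ 2)| := by positivity
  have hW2 : 0 ≤ r * (M * C1) := by positivity
  have hW3 : 0 ≤ ε ^ 2 := by positivity
  have hWpos : 0 < W := by positivity
  set δ : ℝ := (4 * W)⁻¹ with hδd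
  have hδ : 0 < δ := by positivity
  have hδW : ∀ y, y ≤ W → δ * y ≤ 1 / 4 := by
    intro y hy
    calc δ * y ≤ δ * W := by gcongr
      _ = 1 / 4 := by rw [hδd]; field_simp
  have hδB := hδW (B0 + ε ^ 2) (by rw [hW]; linarith)
  have hδ1 := hδW (r * |Real.log (η2 ^ 2)| + ε ^ 2) (by rw [hW]; linarith)
  have hδ2 := hδW (r * (M * C1)) (by rw [hW]; linarith)
  set R : ℝ := ε ^ 2 * (3 + r * (M * C1 / η)) with hR
  have hR0 : 0 ≤ R := by positivity
  set g0 : ℝ := g1 * Real.exp (-((δ * R + 1) / 2)) with hg0d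
  have hg0 : 0 < g0 := by positivity
  have hδR : 0 ≤ δ * R := by positivity
  have hg01 : g0 ≤ g1 := by
    rw [hg0d]
    apply mul_le_of_le_one_right hg1.le
    rw [Real.exp_le_one_iff]
    linarith
  have hgl : -Real.log (g0 ^ 2) = -Real.log (g1 ^ 2) + δ * R + 1 := by
    rw [Real.log_pow, Real.log_pow, hg0d, Real.log_mul hg1.ne' (Real.exp_pos _).ne', Real.log_exp]
    push_cast; ring
  have hg2 : 0 < g0 ^ 2 := by positivity
  obtain ⟨ℓ, hℓ, hℓl, hℓd, hℓa⟩ := exists_ell (g0 ^ 2) hg2 (pow_le_one₀ hg0.le (hg01.trans hg11))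
  obtain ⟨b, hb, hbl, hb0, hbd, hbρ⟩ := exists_b ε hε0
  set lo : ℝ := -Real.log (η ^ 2 / 16) - 1 / 4 with hlo
  set hi1 : ℝ := -Real.log (4 * g1 ^ 2) with hhi1
  have hlog4' : Real.log 4 = 2 * Real.log 2 := by
    rw [show (4:ℝ) = 2 ^ 2 by norm_num, Real.log_pow]; push_cast; ring
  have hlog2 := Real.log_two_gt_d9
  have hlog4 : hi1 = -Real.log (g1 ^ 2) - Real.log 4 := by
    rw [hhi1, Real.log_mul (by norm_num) (by positivity)]; ring
  set Λ := Lfun f s S ℓ b δ with hΛ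
  have hΛe : ∀ t x, Λ (t, x) = ℓ (‖f s x - t‖ ^ 2) + δ * (LS f S x + b (‖x‖ ^ 2)) := fun t x => rfl
  have hΛℓ : ∀ t x, (t, x) ∈ Gset f S ε → Λ (t, x) ≤ ℓ (‖f s x - t‖ ^ 2) := by
    intro t x hz
    have h1 := hf.LS_nonpos S x (hz.1.le.trans hε)
    have h2 := hb0 _ (sq_lt_of_norm hz.1)
    rw [hΛe]
    nlinarith
  have hcΛ : ∀ z ∈ Gset f S ε, ContinuousAt Λ z := fun z hz =>
    (hf.Lfun_contDiffAt s S ε hε ℓ b δ hℓ hb z hz).continuousAt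
  have hpc : Continuous fun p : (closedBall (0 : Fin d → ℝ) 1) × EuclideanSpace ℂ (Fin N) => (τ p.1, p.2) := by fun_prop
  have hΛon : ContinuousOn (fun p : (closedBall (0 : Fin d → ℝ) 1) × EuclideanSpace ℂ (Fin N) => Λ (τ p.1, p.2))
      {p | (τ p.1, p.2) ∈ Gset f S ε} := by
    intro p hp
    exact (ContinuousAt.comp (g := Λ) (f := fun p : (closedBall (0 : Fin d → ℝ) 1) × EuclideanSpace ℂ (Fin N) => (τ p.1, p.2))
      (hcΛ _ hp) hpc.continuousAt).continuousWithinAt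
  have hstart : ∀ q, -(1 / 4) ≤ δ * (LS f S (F q) + b (‖F q‖ ^ 2)) := by
    intro q
    have h1 := hLSF q
    have h2 : ‖F q‖ ^ 2 ≤ ε ^ 2 / 4 := by nlinarith [norm_nonneg (F q), (hFτ q).1]
    rw [hbl _ h2]
    have h3 : δ * (-B0 - ε ^ 2) ≤ δ * (LS f S (F q) + (‖F q‖ ^ 2 - ε ^ 2)) := by
      have := sq_nonneg ‖F q‖
      gcongr; linarith
    have h4 : δ * (-B0 - ε ^ 2) = -(δ * (B0 + ε ^ 2)) := by ring
    linarith
  have hg0η : g0 ^ 2 ≤ η ^ 2 / 16 := by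
    have : g0 ≤ η / 4 := hg01.trans hg1η
    nlinarith
  -- compactness
  have hK : IsCompact {p : (closedBall (0 : Fin d → ℝ) 1) × EuclideanSpace ℂ (Fin N) |
      p ∈ {p : (closedBall (0 : Fin d → ℝ) 1) × EuclideanSpace ℂ (Fin N) | (τ p.1, p.2) ∈ Gset f S ε} ∧
      lo ≤ Λ (τ p.1, p.2) ∧ Λ (τ p.1, p.2) ≤ hi1 + 1 / 4} := by
    obtain ⟨ρ1, hρ10, hρ1, hρ1b⟩ := hbρ ((ℓ 0 - lo) / δ)
    set κ := Real.exp (-((ℓ 0 - lo) / δ)) with hκ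
    have hκ0 : 0 < κ := Real.exp_pos _
    have hsq : √ρ1 < ε := by
      rw [Real.sqrt_lt' hε0]; exact hρ1
    have hcomp := (isCompact_univ (X := closedBall (0 : Fin d → ℝ) 1)).prod (hf.compact S (√ρ1) κ (hsq.le.trans hε))
    have hsub : (Set.univ (α := closedBall (0 : Fin d → ℝ) 1)) ×ˢ {x : EuclideanSpace ℂ (Fin N) | ‖x‖ ≤ √ρ1 ∧ ∀ i ∈ S, κ ≤ ‖f i x‖ ^ 2} ⊆
        {p : (closedBall (0 : Fin d → ℝ) 1) × EuclideanSpace ℂ (Fin N) | (τ p.1, p.2) ∈ Gset f S ε} := by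
      rintro ⟨q, x⟩ ⟨-, h1, h2⟩
      refine ⟨lt_of_le_of_lt h1 hsq, fun i hi h0 => ?_⟩
      have := h2 i hi
      simp only at h0
      rw [h0] at this
      simp at this
      linarith
    have hcl := (hΛon.mono hsub).preimage_isClosed_of_isClosed hcomp.isClosed (isClosed_Icc (a := lo) (b := hi1 + 1 / 4))
    have hc2 := hcomp.of_isClosed_subset hcl Set.inter_subset_left
    convert hc2 using 1
    ext ⟨q, x⟩
    constructor
    · rintro ⟨h1, h2, h3⟩
      refine ⟨⟨trivial, ?_⟩, h2, h3⟩
      have h1' : (τ q, x) ∈ Gset f S ε := h1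
      have h2' : lo ≤ Λ (τ q, x) := h2
      have hx0 : ‖x‖ ≤ ε₀ := h1'.1.le.trans hε
      have k1 := hf.LS_nonpos S x hx0
      have k2 := hb0 _ (sq_lt_of_norm h1'.1)
      have k3 : ℓ (‖f s x - τ q‖ ^ 2) ≤ ℓ 0 := hℓa (sq_nonneg _)
      have k4 : -((ℓ 0 - lo) / δ) ≤ LS f S x + b (‖x‖ ^ 2) := by
        rw [← neg_div, div_le_iff₀ hδ]
        rw [hΛe] at h2'
        linarith
      constructor
      · apply Real.le_sqrt_of_sq_le
        exact hρ1b _ (sq_lt_of_norm h1'.1) (by linarith)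
      · intro i hi
        exact hf.LS_low S x hx0 _ h1'.2 (by linarith) i hi
    · rintro ⟨h1, h2, h3⟩
      exact ⟨hsub h1, h2, h3⟩
  have hpush : ∀ p ∈ {p : (closedBall (0 : Fin d → ℝ) 1) × EuclideanSpace ℂ (Fin N) | (τ p.1, p.2) ∈ Gset f S ε},
      lo ≤ Λ (τ p.1, p.2) → Λ (τ p.1, p.2) ≤ hi1 + 1 / 4 →
      Pushable {p : (closedBall (0 : Fin d → ℝ) 1) × EuclideanSpace ℂ (Fin N) | (τ p.1, p.2) ∈ Gset f S ε}
        (fun p => Λ (τ p.1, p.2)) p := by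
    rintro ⟨q, x⟩ hp h1 h2
    have hp' : (τ q, x) ∈ Gset f S ε := hp
    have h1' : lo ≤ Λ (τ q, x) := h1
    refine hf.push_cases hd τ s S hsS ε hε hε0 C1 η hC1 hη hT4 M hM hMb m hm C2 η' hC2 hη' hT6 η2 hη20
      ((min_le_left _ _).trans (min_le_left _ _)) ((min_le_left _ _).trans (min_le_right _ _)) hη2A g1 g0 δ R hg0 hg01 hg1m hδ
      hδ1 hδ2 hR hgl ℓ b hℓ hℓl hℓd hℓa hb hbl hbd q x hp' (hτm q) (hFτ q).2.2.2.1 ?_ h2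
    by_contra hcon
    push Not at hcon
    have k1 := h1'.trans (hΛℓ _ _ hp')
    have k2 : η ^ 2 / 4 < ‖f s x - τ q‖ ^ 2 := by
      have := pow_lt_pow_left₀ hcon (by positivity) two_ne_zero
      linarith [show (η / 2) ^ 2 = η ^ 2 / 4 by ring]
    have k3 : ℓ (‖f s x - τ q‖ ^ 2) ≤ ℓ (η ^ 2 / 4) := hℓa k2.le
    rw [hℓl (η ^ 2 / 4) (by linarith [sq_nonneg η])] at k3
    have k4 : Real.log (η ^ 2 / 4) = Real.log (η ^ 2 / 16) + Real.log 4 := by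
      rw [← Real.log_mul (by positivity) (by norm_num)]; congr 1; ring
    rw [hlo] at k1
    linarith
  obtain ⟨F', hF', hF''⟩ := push_theorem _ _ hΛon lo hi1 (hi1 + 1 / 4) (hi1 + 1 / 2) (by linarith) (by linarith) hK hpush F
    (fun q => ⟨hFε q, (hFτ q).2.1⟩) (by
      intro q
      show lo ≤ Λ (τ q, F q)
      rw [hΛe]
      have k1 : ‖f s (F q) - τ q‖ ≤ η / 4 := by
        have := norm_sub_le (f s (F q)) (τ q)
        linarith [(hFτ q).2.2.2.1, (hFτ q).2.2.2.2]
      have k2 : ‖f s (F q) - τ q‖ ^ 2 ≤ η ^ 2 / 16 := by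
        have := pow_le_pow_left₀ (norm_nonneg _) k1 2
        linarith [show (η / 4) ^ 2 = η ^ 2 / 16 by ring]
      have k3 := hℓa k2
      rw [hℓl (η ^ 2 / 16) hg0η] at k3
      have := hstart q
      rw [hlo]
      linarith)
  obtain ⟨H⟩ := hF'
  have hadm := H.prop' 1
  have hH1 : ∀ q, (H.toHomotopy.curry 1) q = F' q := by intro q; simp
  refine ⟨F', fun q => ?_, fun q hq => ?_⟩
  · have h1 : (τ q, F' q) ∈ Gset f S ε := by
      have := hadm.1 q
      simpa using this
    refine ⟨h1.1, h1.2, fun h0 => ?_⟩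
    have h2 : hi1 ≤ Λ (τ q, F' q) := hF'' q
    have k1 := h2.trans (hΛℓ _ _ h1)
    have k2 : m ≤ ‖f s (F' q) - τ q‖ := by rw [h0]; simpa using hτm q
    have k3 : 4 * g1 ^ 2 < ‖f s (F' q) - τ q‖ ^ 2 := by
      have h3 : 2 * g1 < ‖f s (F' q) - τ q‖ := by linarith
      have := pow_lt_pow_left₀ h3 (by positivity) two_ne_zero
      linarith [show (2 * g1) ^ 2 = 4 * g1 ^ 2 by ring]
    have k4 : g0 ^ 2 ≤ 4 * g1 ^ 2 := by nlinarith
    rw [hℓl _ (k4.trans k3.le), hhi1] at k1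
    have k5 := Real.log_lt_log (by positivity) k3
    linarith
  · have := hadm.2 q (by
      show hi1 + 1 / 2 ≤ Λ (τ q, F q)
      rw [hΛe, hq]
      have k1 := hstart q
      have k2 : ℓ (g0 ^ 2) ≤ ℓ (‖τ q - τ q‖ ^ 2) := hℓa (by simpa using hg2.le)
      rw [hℓl _ le_rfl] at k2
      linarith)
    simpa using this

end MainC

end PartE7

section PartE8
open Metric Filter Topology

section Geo

/-- inclusion of the sphere in the ball -/
def sphIncl {d : ℕ} (y : sphere (0 : Fin d → ℝ) 1) : closedBall (0 : Fin d → ℝ) 1 := ⟨y.1, sphere_subset_closedBall y.2⟩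

lemma sphIncl_closedEmb {d : ℕ} : IsClosedEmbedding (sphIncl (d := d)) := by
  apply Continuous.isClosedEmbedding
  · unfold sphIncl; fun_prop
  · intro a b h
    apply Subtype.ext
    exact congrArg (fun z : closedBall (0 : Fin d → ℝ) 1 => z.1) h

/-- collar lemma -/
lemma collar {d : ℕ} {T : Type*} [TopologicalSpace T] (P : T → Prop) (F : C(closedBall (0 : Fin d → ℝ) 1, T))
    (H : C(unitInterval × sphere (0 : Fin d → ℝ) 1, T)) (h0 : ∀ y, H (0, y) = F (sphIncl y))
    (hF : ∀ q, P (F q)) (hH : ∀ p, P (H p)) :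
    ∃ F' : C(closedBall (0 : Fin d → ℝ) 1, T), (∀ q, P (F' q)) ∧ ∀ y, F' (sphIncl y) = H (1, y) := by
  classical
  by_cases hne : Nonempty (sphere (0 : Fin d → ℝ) 1)
  swap
  · exact ⟨F, hF, fun y => absurd ⟨y⟩ hne⟩
  obtain ⟨y0⟩ := hne
  let pr : (Fin d → ℝ) → sphere (0 : Fin d → ℝ) 1 := fun x => if hx : x = 0 then y0 else
    ⟨‖x‖⁻¹ • x, by rw [mem_sphere_zero_iff_norm, norm_smul, norm_inv, norm_norm, inv_mul_cancel₀ (norm_ne_zero_iff.2 hx)]⟩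
  have hpr : ContinuousOn pr {x | x ≠ 0} := by
    rw [IsInducing.subtypeVal.continuousOn_iff]
    have : ContinuousOn (fun x : Fin d → ℝ => ‖x‖⁻¹ • x) {x | x ≠ 0} := by
      exact ContinuousOn.smul (continuous_norm.continuousOn.inv₀ fun x hx => norm_ne_zero_iff.2 hx) continuousOn_id
    refine this.congr fun x hx => ?_
    simp only [Function.comp, pr]
    rw [dif_neg hx]
  let dbl : (Fin d → ℝ) → closedBall (0 : Fin d → ℝ) 1 := fun x => ⟨(max 1 (2 * ‖x‖))⁻¹ • (2:ℝ) • x, by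
    rw [mem_closedBall_zero_iff, norm_smul, norm_inv, norm_smul, Real.norm_eq_abs, abs_of_pos (by positivity)]
    rw [inv_mul_le_one₀ (by positivity)]
    simp⟩
  have hdbl : Continuous dbl := by
    apply Continuous.subtype_mk
    have h1 : Continuous fun x : Fin d → ℝ => (max 1 (2 * ‖x‖))⁻¹ :=
      Continuous.inv₀ (by fun_prop) fun x => by positivity
    have h2 : Continuous fun x : Fin d → ℝ => (2:ℝ) • x := by fun_prop
    exact h1.smul h2
  let F' : closedBall (0 : Fin d → ℝ) 1 → T := fun x => if 2 * ‖x.1‖ ≤ 1 then F (dbl x.1) else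
    H (Set.projIcc 0 1 zero_le_one (2 * ‖x.1‖ - 1), pr x.1)
  have hF' : Continuous F' := by
    refine continuous_if_le (by fun_prop) continuous_const ?_ ?_ ?_
    · exact (F.continuous.comp (hdbl.comp continuous_subtype_val)).continuousOn
    · refine H.continuous.comp_continuousOn (ContinuousOn.prodMk ?_ ?_)
      · exact (continuous_projIcc.comp (by fun_prop)).continuousOn
      · refine hpr.comp continuous_subtype_val.continuousOn ?_
        intro x hx h
        have hx' : 1 ≤ 2 * ‖x.1‖ := hx
        rw [h] at hx'
        norm_num at hx'
    · intro x hx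
      have hx0 : x.1 ≠ 0 := by
        intro h; rw [h] at hx; norm_num at hx
      have e1 : Set.projIcc (0:ℝ) 1 zero_le_one (2 * ‖x.1‖ - 1) = 0 := by
        rw [hx]; simp
      rw [e1, h0]
      congr 1
      apply Subtype.ext
      simp only [dbl, sphIncl, pr]
      rw [dif_neg hx0, hx]
      have : ‖x.1‖⁻¹ = 2 := by
        have : ‖x.1‖ = 2⁻¹ := by linarith
        rw [this, inv_inv]
      simp [this]
  refine ⟨⟨F', hF'⟩, fun q => ?_, fun y => ?_⟩
  · simp only [ContinuousMap.coe_mk, F']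
    split_ifs
    · exact hF _
    · exact hH _
  · have hy : ‖y.1‖ = 1 := by simp
    have hy0 : y.1 ≠ 0 := by
      intro h; rw [h] at hy; simp at hy
    simp only [ContinuousMap.coe_mk, F', sphIncl]
    rw [if_neg (by rw [hy]; norm_num), hy]
    have e1 : Set.projIcc (0:ℝ) 1 zero_le_one (2 * 1 - 1) = 1 := by
      rw [show (2:ℝ) * 1 - 1 = 1 by norm_num]; simp
    rw [e1]
    congr 2
    apply Subtype.ext
    simp only [pr]
    rw [dif_neg hy0]
    show ‖y.1‖⁻¹ • y.1 = y.1
    rw [hy]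
    simp

variable {N r : ℕ} {f : Fin r → EuclideanSpace ℂ (Fin N) → ℂ} {ε₀ : ℝ}

lemma rescale {Q : Type} [TopologicalSpace Q] (τ : C(Q, ℂ)) (hτ : ∀ q, τ q ≠ 0) (c : ℝ) (hc : 0 < c) :
    ∃ τ' : C(Q, ℂ), (∀ q, τ' q ≠ 0) ∧ (∀ q, ‖τ' q‖ ≤ c) ∧ ∀ q, ‖τ q‖ ≤ c → τ' q = τ q := by
  have hm : ∀ q, 0 < max 1 (‖τ q‖ / c) := fun q => lt_max_of_lt_left one_pos
  refine ⟨⟨fun q => ((max 1 (‖τ q‖ / c))⁻¹ : ℝ) * τ q, ?_⟩, fun q => ?_, fun q => ?_, fun q h => ?_⟩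
  · refine Continuous.mul (Complex.continuous_ofReal.comp (Continuous.inv₀ (by fun_prop) fun q => (hm q).ne')) τ.continuous
  · have := (hm q).ne'
    simp only [ContinuousMap.coe_mk]
    refine mul_ne_zero ?_ (hτ q)
    exact Complex.ofReal_ne_zero.2 (inv_ne_zero this)
  · simp only [ContinuousMap.coe_mk, norm_mul, Complex.norm_real, norm_inv, Real.norm_eq_abs, abs_of_pos (hm q)]
    rw [inv_mul_le_iff₀ (hm q)]
    calc ‖τ q‖ = ‖τ q‖ / c * c := by field_simp
      _ ≤ _ := by gcongr; exact le_max_right _ _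
  · simp only [ContinuousMap.coe_mk]
    rw [max_eq_left ((div_le_one hc).2 h)]
    simp

lemma GoodF.small (hf : GoodF f ε₀) (s : Fin r) (c : ℝ) (hc : 0 < c) : ∃ ρ > (0:ℝ), ∀ x, ‖x‖ ≤ ρ → ‖f s x‖ ≤ c := by
  have h1 := (hf.an s 0 (by simpa using hf.pos.le)).continuousAt
  rw [Metric.continuousAt_iff] at h1
  obtain ⟨ρ, hρ, h⟩ := h1 c hc
  refine ⟨ρ / 2, by positivity, fun x hx => ?_⟩
  have := h (x := x) (by rw [dist_zero_right]; linarith)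
  rw [hf.f0 s, dist_zero_right] at this
  exact this.le

/-- filling in the ball -/
lemma GoodF.fill_ball (hf : GoodF f ε₀) {d : ℕ} (hd : d < N) (S : Finset (Fin r)) : ∀ ε, 0 < ε → ε ≤ ε₀ →
    ∃ ε' > (0:ℝ), ε' ≤ ε ∧ ∀ a : C(sphere (0 : Fin d → ℝ) 1, EuclideanSpace ℂ (Fin N)), (∀ y, ‖a y‖ ≤ ε') →
      (∀ i ∈ S, ∃ τ : C(closedBall (0 : Fin d → ℝ) 1, ℂ), (∀ q, τ q ≠ 0) ∧ ∀ y, τ (sphIncl y) = f i (a y)) →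
      ∃ F : C(closedBall (0 : Fin d → ℝ) 1, EuclideanSpace ℂ (Fin N)), (∀ q, ‖F q‖ ≤ ε ∧ ∀ i ∈ S, f i (F q) ≠ 0) ∧
        ∀ y, F (sphIncl y) = a y := by
  classical
  induction S using Finset.induction_on with
  | empty =>
    intro ε hε hε₀
    refine ⟨ε, hε, le_rfl, fun a ha _ => ?_⟩
    have inst := Metric.instTietzeExtensionClosedBall.{0} ℂ (0 : EuclideanSpace ℂ (Fin N)) hε
    obtain ⟨F, hF1, hF2⟩ := a.exists_extension_forall_mem sphIncl_closedEmb (t := closedBall 0 ε) (fun y => by simpa using ha y)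
    refine ⟨F, fun q => ⟨by simpa using hF1 q, by simp⟩, fun y => ?_⟩
    have := congrArg (fun g => g y) hF2
    simpa using this
  | insert s S hs ih =>
    intro ε hε hε₀
    obtain ⟨η, hη, hmain⟩ := hf.main_push hd s S hs ε hε₀ hε
    obtain ⟨ρ, hρ, hρs⟩ := hf.small s (η / 8) (by positivity)
    obtain ⟨ε', hε', hε'le, h⟩ := ih (min (ε / 2) ρ) (by positivity) ((min_le_left _ _).trans (by linarith))
    have hle : min (ε / 2) ρ ≤ ε / 2 := min_le_left _ _
    refine ⟨ε', hε', by linarith, fun a ha hτ => ?_⟩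
    obtain ⟨F, hF1, hF2⟩ := h a ha fun i hi => hτ i (by simp [hi])
    obtain ⟨τ, hτ0, hτa⟩ := hτ s (by simp)
    obtain ⟨τ', h1, h2, h3⟩ := rescale τ hτ0 (η / 8) (by positivity)
    obtain ⟨F', hF'1, hF'2⟩ := hmain F τ' (fun q => ⟨(hF1 q).1.trans hle, (hF1 q).2, h1 q, h2 q,
      hρs _ ((hF1 q).1.trans (min_le_right _ _))⟩)
    refine ⟨F', fun q => ⟨(hF'1 q).1.le, fun i hi => ?_⟩, fun y => ?_⟩
    · rcases Finset.mem_insert.1 hi with rfl | hi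
      · exact (hF'1 q).2.2
      · exact (hF'1 q).2.1 i hi
    · rw [hF'2 _ ?_, hF2]
      rw [h3, hτa, hF2]
      rw [hτa]
      exact hρs _ ((ha y).trans (hε'le.trans (min_le_right _ _)))

end Geo

end PartE8

section PartE9
open Metric Filter Topology

section Sph
variable {N r : ℕ} {f : Fin r → EuclideanSpace ℂ (Fin N) → ℂ} {ε₀ : ℝ}

lemma le_of_sq_le_aux {a b : ℝ} (hb : 0 ≤ b) (h : a ^ 2 ≤ b ^ 2) : a ≤ b :=
  (le_abs_self a).trans (abs_le_of_sq_le_sq h hb)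

/-- pushing a filling of the ball to the sphere -/
lemma GoodF.to_sphere (hf : GoodF f ε₀) {Q : Type} [MetricSpace Q] [CompactSpace Q] (hr : 0 < r) (ε : ℝ) (hε0 : 0 < ε)
    (hε : ε ≤ ε₀) (u : C(Q, EuclideanSpace ℂ (Fin N))) (hu : ∀ s, ‖u s‖ ≤ ε ∧ ∀ i, f i (u s) ≠ 0) :
    ∃ F : C(Q, EuclideanSpace ℂ (Fin N)), (∀ q, ‖F q‖ = ε ∧ ∀ i, f i (F q) ≠ 0) ∧ ∀ q, ‖u q‖ = ε → F q = u q := by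
  have hu0 : ∀ s, u s ≠ 0 := by
    intro s h
    apply (hu s).2 ⟨0, hr⟩
    rw [h, hf.f0]
  obtain ⟨r1, hr1, hr1u⟩ : ∃ m > (0:ℝ), ∀ q, m ≤ ‖u q‖ := by
    obtain ⟨m, hm, h⟩ := pos_lower ⟨fun q => ((‖u q‖ : ℝ) : ℂ), by fun_prop⟩ (fun q => by simpa using hu0 q)
    exact ⟨m, hm, fun q => by simpa using h q⟩
  obtain ⟨κ, hκ, hpush⟩ := hf.radial_push ε hε 1 (Or.inl rfl) r1 hr1 u hu
  obtain ⟨δ, hδ, hδf⟩ : ∃ δ > (0:ℝ), ∀ i x y, ‖x‖ ≤ ε → ‖y‖ ≤ ε → ‖x - y‖ < δ → ‖f i x - f i y‖ < Real.sqrt κ := by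
    have h1 : ∀ i, ∃ δ > (0:ℝ), ∀ x y, ‖x‖ ≤ ε → ‖y‖ ≤ ε → ‖x - y‖ < δ → ‖f i x - f i y‖ < Real.sqrt κ := by
      intro i
      have h2 : UniformContinuousOn (f i) (closedBall 0 ε) := by
        apply (isCompact_closedBall _ _).uniformContinuousOn_of_continuous
        intro x hx
        exact (hf.an i x (le_trans (by simpa using hx) hε)).continuousAt.continuousWithinAt
      rw [Metric.uniformContinuousOn_iff] at h2
      obtain ⟨δ, hδ, h⟩ := h2 (Real.sqrt κ) (Real.sqrt_pos.2 hκ)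
      refine ⟨δ, hδ, fun x y hx hy hxy => ?_⟩
      rw [← dist_eq_norm]
      exact h x (by simpa using hx) y (by simpa using hy) (by rwa [dist_eq_norm])
    choose δ hδ h using h1
    have hne : (Finset.univ : Finset (Fin r)).Nonempty := ⟨⟨0, hr⟩, Finset.mem_univ _⟩
    refine ⟨Finset.univ.inf' hne δ, ?_, fun i x y hx hy hxy => h i x y hx hy (hxy.trans_le (Finset.inf'_le _ (Finset.mem_univ i)))⟩
    rw [gt_iff_lt, Finset.lt_inf'_iff]
    exact fun i _ => hδ i
  obtain ⟨b, hb0, hbε, hbδ⟩ : ∃ b, 0 < b ∧ b < ε ∧ ε - b < δ := by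
    refine ⟨max (ε - δ / 2) (ε / 2), ?_, ?_, ?_⟩
    · exact lt_max_of_lt_right (by positivity)
    · apply max_lt <;> linarith
    · have := le_max_left (ε - δ / 2) (ε / 2); linarith
  have hbb : b ^ 2 < ε ^ 2 := by gcongr
  obtain ⟨u', ⟨H⟩, hu'⟩ := hpush (r1 ^ 2) (b ^ 2) ((b ^ 2 + ε ^ 2) / 2) (ε ^ 2) (by linarith) (by linarith)
    (fun x _ h2 _ => by rw [one_mul] at h2; exact le_of_sq_le_aux (norm_nonneg _) h2)
    (fun x h1 h2 => Or.inl (by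
      rw [one_mul] at h2
      exact lt_of_pow_lt_pow_left₀ 2 hε0.le (by linarith)))
    (fun s => by rw [one_mul]; have := hr1u s; gcongr)
  have h1 : (∀ s, ‖u' s‖ ≤ ε ∧ ∀ i, f i (u' s) ≠ 0 ∧ κ ≤ ‖f i (u' s)‖ ^ 2) ∧
      ∀ s, ε ^ 2 ≤ 1 * ‖u s‖ ^ 2 → u' s = u s := by
    have := H.prop' 1
    simpa using this
  have hlow : ∀ s, b ≤ ‖u' s‖ := by
    intro s
    have := hu' s
    rw [one_mul] at this
    exact le_of_sq_le_aux (norm_nonneg _) this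
  have hpos : ∀ s, 0 < ‖u' s‖ := fun s => hb0.trans_le (hlow s)
  have hnorm : ∀ s, ‖(((ε / ‖u' s‖ : ℝ) : ℂ)) • u' s‖ = ε := by
    intro s
    rw [norm_smul, Complex.norm_real, Real.norm_eq_abs, abs_of_pos (div_pos hε0 (hpos s))]
    field_simp [(hpos s).ne']
  refine ⟨⟨fun s => (((ε / ‖u' s‖ : ℝ) : ℂ)) • u' s, ?_⟩, fun s => ⟨hnorm s, fun i h0 => ?_⟩, fun s hs => ?_⟩
  · have h2 : Continuous fun s => ((ε / ‖u' s‖ : ℝ) : ℂ) :=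
      Complex.continuous_ofReal.comp (continuous_const.div (by fun_prop) fun s => (hpos s).ne')
    exact h2.smul u'.continuous
  · simp only [ContinuousMap.coe_mk] at h0
    have h3 := hδf i (u' s) ((((ε / ‖u' s‖ : ℝ) : ℂ)) • u' s) (h1.1 s).1 (hnorm s).le (by
      have e : u' s - (((ε / ‖u' s‖ : ℝ) : ℂ)) • u' s = (((1 - ε / ‖u' s‖ : ℝ)) : ℂ) • u' s := by
        rw [Complex.ofReal_sub, sub_smul]; simp
      rw [e, norm_smul, Complex.norm_real, Real.norm_eq_abs]
      have h4 : 1 ≤ ε / ‖u' s‖ := (one_le_div (hpos s)).2 (h1.1 s).1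
      rw [abs_of_nonpos (by linarith)]
      have h5 : -(1 - ε / ‖u' s‖) * ‖u' s‖ = ε - ‖u' s‖ := by
        field_simp [(hpos s).ne']
        ring
      rw [h5]
      have := hlow s
      linarith)
    rw [h0, sub_zero] at h3
    have h4 := ((h1.1 s).2 i).2
    have h5 : Real.sqrt κ ≤ ‖f i (u' s)‖ := Real.sqrt_le_iff.2 ⟨norm_nonneg _, h4⟩
    linarith
  · have h2 := h1.2 s (by rw [hs, one_mul])
    simp only [ContinuousMap.coe_mk]
    rw [h2, hs, div_self hε0.ne']
    simp

/-- filling in the sphere -/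
lemma GoodF.fill_sphere (hf : GoodF f ε₀) {d : ℕ} (hd : d < N) (hr : 0 < r) (ε : ℝ) (hε0 : 0 < ε)
    (hε : ε ≤ ε₀) (a : C(sphere (0 : Fin d → ℝ) 1, EuclideanSpace ℂ (Fin N)))
    (ha : ∀ y, ‖a y‖ = ε ∧ ∀ i, f i (a y) ≠ 0)
    (hτ : ∀ i, ∃ τ : C(closedBall (0 : Fin d → ℝ) 1, ℂ), (∀ q, τ q ≠ 0) ∧ ∀ y, τ (sphIncl y) = f i (a y)) :
    ∃ F : C(closedBall (0 : Fin d → ℝ) 1, EuclideanSpace ℂ (Fin N)), (∀ q, ‖F q‖ = ε ∧ ∀ i, f i (F q) ≠ 0) ∧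
        ∀ y, F (sphIncl y) = a y := by
  obtain ⟨ε', hε', hle, hfill⟩ := hf.fill_ball hd Finset.univ ε hε0 hε
  obtain ⟨κ, hκ, hpush⟩ := hf.radial_push ε hε (-1) (Or.inr rfl) (ε' / 2) (by positivity) a
    (fun s => ⟨(ha s).1.le, (ha s).2⟩)
  have hp : 0 < ε' ^ 2 := by positivity
  obtain ⟨u', ⟨H⟩, hu'⟩ := hpush (- ε ^ 2) (- ε' ^ 2) (- (ε' ^ 2 / 2)) (- (ε' ^ 2 / 4)) (by linarith) (by linarith)
    (fun x _ _ h2 => by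
      apply le_of_sq_le_aux (norm_nonneg _)
      rw [div_pow]
      linarith)
    (fun x h1 h2 => Or.inr rfl)
    (fun s => by rw [(ha s).1]; linarith)
  have hH : ∀ p : unitInterval × sphere (0 : Fin d → ℝ) 1, ‖H.toHomotopy p‖ ≤ ε ∧ ∀ i, f i (H.toHomotopy p) ≠ 0 := by
    rintro ⟨t, y⟩
    have := (H.prop' t).1 y
    exact ⟨this.1, fun i => (this.2 i).1⟩
  have hu'ε : ∀ y, ‖u' y‖ ≤ ε' := by
    intro y
    have := hu' y
    exact le_of_sq_le_aux hε'.le (by linarith)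
  obtain ⟨F, hF, hFu⟩ := hfill u' hu'ε (by
    intro i _
    obtain ⟨τ, hτ0, hτa⟩ := hτ i
    have hc : Continuous fun p : unitInterval × sphere (0 : Fin d → ℝ) 1 => f i (H.toHomotopy p) := by
      rw [continuous_iff_continuousAt]
      intro p
      exact ContinuousAt.comp (g := f i) (hf.an i _ ((hH p).1.trans hε)).continuousAt
        H.toHomotopy.continuous.continuousAt
    obtain ⟨τ', h1, h2⟩ := collar (fun z => z ≠ 0) τ ⟨_, hc⟩ (fun y => by
      rw [hτa]
      show f i (H.toHomotopy (0, y)) = _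
      rw [H.toHomotopy.apply_zero]) hτ0 (fun p => (hH p).2 i)
    refine ⟨τ', h1, fun y => ?_⟩
    rw [h2]
    show f i (H.toHomotopy (1, y)) = _
    rw [H.toHomotopy.apply_one])
  obtain ⟨F2, hF2, hF2a⟩ := collar (fun x => ‖x‖ ≤ ε ∧ ∀ i, f i x ≠ 0) F H.toHomotopy.symm.toContinuousMap
    (fun y => by
      rw [hFu]
      exact H.toHomotopy.symm.apply_zero y)
    (fun q => ⟨(hF q).1, fun i => (hF q).2 i (Finset.mem_univ i)⟩)
    (by
      rintro ⟨t, y⟩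
      show ‖H.toHomotopy.symm (t, y)‖ ≤ ε ∧ ∀ i, f i (H.toHomotopy.symm (t, y)) ≠ 0
      rw [ContinuousMap.Homotopy.symm_apply]
      exact hH _)
  have hF2a' : ∀ y, F2 (sphIncl y) = a y := by
    intro y
    rw [hF2a]
    exact H.toHomotopy.symm.apply_one y
  obtain ⟨G, hG, hG2⟩ := hf.to_sphere hr ε hε0 hε F2 hF2
  refine ⟨G, hG, fun y => ?_⟩
  rw [hG2 _ (by rw [hF2a', (ha y).1]), hF2a']

end Sph

end PartE9

section PartF1
open Metric Filter Topology

section Cub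

/-- affine clamp from the real line to the unit interval -/
noncomputable def toI (x : ℝ) : unitInterval := Set.projIcc 0 1 zero_le_one ((x + 1) / 2)

lemma toI_cont : Continuous toI := by
  unfold toI
  exact continuous_projIcc.comp (by fun_prop)

lemma toI_of (t : unitInterval) : toI (2 * t.1 - 1) = t := by
  unfold toI
  rw [show (2 * t.1 - 1 + 1) / 2 = t.1 by ring]
  exact Set.projIcc_val zero_le_one t

lemma toI_one : toI 1 = 1 := by
  have := toI_of 1
  rwa [show (2:ℝ) * ((1 : unitInterval) : ℝ) - 1 = 1 by norm_num] at this

lemma toI_neg_one : toI (-1) = 0 := by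
  have := toI_of 0
  rwa [show (2:ℝ) * ((0 : unitInterval) : ℝ) - 1 = -1 by norm_num] at this

lemma abs_coord (t : unitInterval) : |2 * t.1 - 1| ≤ 1 := by
  have h1 := t.2.1
  have h2 := t.2.2
  rw [abs_le]; constructor <;> linarith

lemma abs_eq_coord (t : unitInterval) (h : t = 0 ∨ t = 1) : |2 * t.1 - 1| = 1 := by
  rcases h with rfl | rfl <;> norm_num

lemma toI_abs (x : ℝ) (h : |x| = 1) : toI x = 0 ∨ toI x = 1 := by
  rcases abs_eq (zero_le_one) |>.1 h with rfl | rfl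
  · right; exact toI_one
  · left; exact toI_neg_one

lemma exists_coord {d : ℕ} (y : Fin d → ℝ) (h : ‖y‖ = 1) : ∃ j, |y j| = 1 := by
  by_contra hne
  push Not at hne
  have h1 : ‖y‖ < 1 := by
    rw [pi_norm_lt_iff one_pos]
    intro j
    exact lt_of_le_of_ne ((norm_le_pi_norm y j).trans h.le) (hne j)
  linarith

lemma norm_eq_one {d : ℕ} (y : Fin d → ℝ) (h : ∀ j, |y j| ≤ 1) (j : Fin d) (hj : |y j| = 1) : ‖y‖ = 1 := by
  apply le_antisymm
  · exact (pi_norm_le_iff_of_nonneg zero_le_one).2 h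
  · rw [← hj]; exact norm_le_pi_norm y j

lemma boundary_preconn {k : ℕ} (hk : 2 ≤ k) : IsPreconnected (Cube.boundary (Fin k)) := by
  have h1 : IsPreconnected (sphere (0 : Fin k → ℝ) 1) := by
    apply isPreconnected_sphere
    rw [rank_fin_fun]
    exact_mod_cast hk
  have h2 : Cube.boundary (Fin k) = (fun y : Fin k → ℝ => fun i => toI (y i)) '' sphere (0 : Fin k → ℝ) 1 := by
    ext s
    constructor
    · rintro ⟨i, hi⟩
      refine ⟨fun j => 2 * (s j).1 - 1, ?_, ?_⟩
      · rw [mem_sphere_zero_iff_norm]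
        exact norm_eq_one _ (fun j => abs_coord _) i (abs_eq_coord _ hi)
      · funext j
        exact toI_of _
    · rintro ⟨y, hy, rfl⟩
      rw [mem_sphere_zero_iff_norm] at hy
      obtain ⟨j, hj⟩ := exists_coord y hy
      exact ⟨j, toI_abs _ hj⟩
  rw [h2]
  apply h1.image
  apply Continuous.continuousOn
  exact continuous_pi fun i => toI_cont.comp (continuous_apply i)

lemma exists_log {k : ℕ} (hk : 2 ≤ k) (g : C(Fin k → unitInterval, ℂ)) (hg : ∀ s, g s ≠ 0) (z : ℂ)
    (hz : ∀ s ∈ Cube.boundary (Fin k), g s = z) :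
    ∃ (l : C(Fin k → unitInterval, ℂ)) (l0 : ℂ), (∀ s, Complex.exp (l s) = g s) ∧ ∀ s ∈ Cube.boundary (Fin k), l s = l0 := by
  let cov := Complex.isCoveringMap_exp
  let H : C(unitInterval × (Fin k → unitInterval), {z : ℂ // z ≠ 0}) :=
    ⟨fun p => ⟨g (fun i => p.1 * p.2 i), hg _⟩, by
      apply Continuous.subtype_mk
      apply g.continuous.comp
      fun_prop⟩
  have hH0 : ∀ a : Fin k → unitInterval, H (0, a) = (⟨Complex.exp (ContinuousMap.const (Fin k → unitInterval) (Complex.log (g 0)) a),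
      Complex.exp_ne_zero _⟩ : {z : ℂ // z ≠ 0}) := by
    intro a
    apply Subtype.ext
    simp only [H, ContinuousMap.coe_mk, ContinuousMap.const_apply]
    rw [Complex.exp_log (hg _)]
    congr 1
    funext i
    simp
  let L := cov.liftHomotopy H (ContinuousMap.const _ (Complex.log (g 0))) hH0
  have hL : ∀ p, Complex.exp (L p) = g (fun i => p.1 * p.2 i) := by
    intro p
    have := congrFun (cov.liftHomotopy_lifts H (ContinuousMap.const _ (Complex.log (g 0))) hH0) p
    exact congrArg Subtype.val this
  let l : C(Fin k → unitInterval, ℂ) := ⟨fun s => L (1, s), by fun_prop⟩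
  have hl : ∀ s, Complex.exp (l s) = g s := by
    intro s
    refine (hL (1, s)).trans ?_
    simp
  have h0 : (fun _ => 0 : Fin k → unitInterval) ∈ Cube.boundary (Fin k) := ⟨⟨0, by omega⟩, Or.inl rfl⟩
  refine ⟨l, l (fun _ => 0), hl, fun s hs => ?_⟩
  refine cov.constOn_of_comp (boundary_preconn hk) l.continuous.continuousOn ?_ hs h0
  intro a ha b hb
  apply Subtype.ext
  show Complex.exp (l a) = Complex.exp (l b)
  rw [hl, hl, hz a ha, hz b hb]

variable {N r : ℕ} {f : Fin r → EuclideanSpace ℂ (Fin N) → ℂ} {ε₀ : ℝ}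

lemma GoodF.null (hf : GoodF f ε₀) {k : ℕ} (hk : 2 ≤ k) (hd : k + 1 < N) (hr : 0 < r) (ε : ℝ) (hε0 : 0 < ε)
    (hε : ε ≤ ε₀) (g : C(Fin k → unitInterval, EuclideanSpace ℂ (Fin N))) (x0 : EuclideanSpace ℂ (Fin N))
    (hg : ∀ s, ‖g s‖ = ε ∧ ∀ i, f i (g s) ≠ 0) (hg0 : ∀ s ∈ Cube.boundary (Fin k), g s = x0) :
    ∃ H : C(unitInterval × (Fin k → unitInterval), EuclideanSpace ℂ (Fin N)),
      (∀ p, ‖H p‖ = ε ∧ ∀ i, f i (H p) ≠ 0) ∧ (∀ s, H (0, s) = g s) ∧ (∀ s, H (1, s) = x0) ∧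
      ∀ t, ∀ s ∈ Cube.boundary (Fin k), H (t, s) = x0 := by
  classical
  have hb0 : (fun _ => 0 : Fin k → unitInterval) ∈ Cube.boundary (Fin k) := ⟨⟨0, by omega⟩, Or.inl rfl⟩
  have hx0 : ‖x0‖ = ε ∧ ∀ i, f i x0 ≠ 0 := by
    rw [← hg0 _ hb0]; exact hg _
  let σ : (Fin (k + 1) → ℝ) → Fin k → unitInterval := fun y i => toI (y i.succ)
  have hσ : Continuous σ := continuous_pi fun i => toI_cont.comp (continuous_apply _)
  have hside : ∀ y : Fin (k + 1) → ℝ, ‖y‖ = 1 → y 0 = 1 ∨ y 0 = -1 ∨ σ y ∈ Cube.boundary (Fin k) := by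
    intro y hy
    obtain ⟨j, hj⟩ := exists_coord y hy
    induction j using Fin.cases with
    | zero =>
      rcases abs_eq (zero_le_one) |>.1 hj with h | h
      · exact Or.inl h
      · exact Or.inr (Or.inl h)
    | succ j => exact Or.inr (Or.inr ⟨j, toI_abs _ hj⟩)
  let a : sphere (0 : Fin (k + 1) → ℝ) 1 → EuclideanSpace ℂ (Fin N) := fun y => if y.1 0 ≤ 0 then g (σ y.1) else x0
  have ha : Continuous a := by
    refine continuous_if_le ((continuous_apply 0).comp continuous_subtype_val) continuous_const ?_ continuousOn_const ?_
    · exact (g.continuous.comp (hσ.comp continuous_subtype_val)).continuousOn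
    · intro y hy
      apply hg0
      have hy1 : ‖y.1‖ = 1 := by simp
      rcases hside y.1 hy1 with h | h | h
      · rw [hy] at h; norm_num at h
      · rw [hy] at h; norm_num at h
      · exact h
  have haσ : ∀ y, σ y.1 ∈ Cube.boundary (Fin k) → a y = x0 := by
    intro y hy
    simp only [a]
    split_ifs
    · exact hg0 _ hy
    · rfl
  obtain ⟨F, hF, hFa⟩ := hf.fill_sphere hd hr ε hε0 hε ⟨a, ha⟩ (by
    intro y
    simp only [ContinuousMap.coe_mk, a]
    split_ifs
    · exact hg _
    · exact hx0) (by
    intro i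
    have hc : Continuous fun s => f i (g s) := by
      rw [continuous_iff_continuousAt]
      intro s
      exact ContinuousAt.comp (g := f i) (hf.an i _ ((hg s).1.le.trans hε)).continuousAt g.continuous.continuousAt
    obtain ⟨l, l0, hl, hl0⟩ := exists_log hk ⟨_, hc⟩ (fun s => (hg s).2 i) (f i x0)
      (fun s hs => by show f i (g s) = _; rw [hg0 s hs])
    have hl0' : Complex.exp l0 = f i x0 := by
      rw [← hl0 _ hb0, hl]
      show f i (g _) = _
      rw [hg0 _ hb0]
    refine ⟨⟨fun q => Complex.exp (l0 + (((1 - q.1 0) / 2 : ℝ) : ℂ) * (l (σ q.1) - l0)), ?_⟩, fun q => Complex.exp_ne_zero _, ?_⟩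
    · have h1 : Continuous fun q : closedBall (0 : Fin (k + 1) → ℝ) 1 => l (σ q.1) :=
        l.continuous.comp (hσ.comp continuous_subtype_val)
      have h2 : Continuous fun q : closedBall (0 : Fin (k + 1) → ℝ) 1 => (((1 - q.1 0) / 2 : ℝ) : ℂ) :=
        Complex.continuous_ofReal.comp
          ((continuous_const.sub ((continuous_apply (0 : Fin (k + 1))).comp continuous_subtype_val)).div_const 2)
      exact Complex.continuous_exp.comp (continuous_const.add (h2.mul (h1.sub continuous_const)))
    · intro y
      have hy1 : ‖y.1‖ = 1 := by simp
      show Complex.exp (l0 + (((1 - y.1 0) / 2 : ℝ) : ℂ) * (l (σ y.1) - l0)) = f i (a y)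
      rcases hside y.1 hy1 with h | h | h
      · have : a y = x0 := by simp only [a]; rw [if_neg (by rw [h]; norm_num)]
        rw [this, h]
        simp [hl0']
      · have : a y = g (σ y.1) := by simp only [a]; rw [if_pos (by rw [h]; norm_num)]
        rw [this, h]
        have e := hl (σ y.1)
        rw [show (((1 - (-1:ℝ)) / 2 : ℝ) : ℂ) = 1 by norm_num, one_mul, add_sub_cancel]
        exact e
      · rw [haσ y h, hl0 _ h]
        simp [hl0'])
  let θ : unitInterval × (Fin k → unitInterval) → Fin (k + 1) → ℝ := fun p =>
    Fin.cons (2 * p.1.1 - 1) (fun i => 2 * (p.2 i).1 - 1)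
  have hθc : Continuous θ := by
    apply continuous_pi
    intro j
    induction j using Fin.cases with
    | zero => simp only [θ, Fin.cons_zero]; fun_prop
    | succ j => simp only [θ, Fin.cons_succ]; fun_prop
  have hθ1 : ∀ p j, |θ p j| ≤ 1 := by
    intro p j
    induction j using Fin.cases with
    | zero => simp only [θ, Fin.cons_zero]; exact abs_coord _
    | succ j => simp only [θ, Fin.cons_succ]; exact abs_coord _
  have hθσ : ∀ p, σ (θ p) = p.2 := by
    intro p
    funext i
    simp only [σ, θ, Fin.cons_succ]
    exact toI_of _
  have hθb : ∀ p, θ p ∈ closedBall (0 : Fin (k + 1) → ℝ) 1 := by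
    intro p
    rw [mem_closedBall_zero_iff]
    exact (pi_norm_le_iff_of_nonneg zero_le_one).2 (hθ1 p)
  have key : ∀ p (h : θ p ∈ sphere (0 : Fin (k + 1) → ℝ) 1), F ⟨θ p, hθb p⟩ = a ⟨θ p, h⟩ := by
    intro p h
    exact hFa ⟨θ p, h⟩
  refine ⟨⟨fun p => F ⟨θ p, hθb p⟩, F.continuous.comp (hθc.subtype_mk _)⟩, fun p => hF _, fun s => ?_, fun s => ?_, fun t s hs => ?_⟩
  · have e0 : θ (0, s) 0 = -1 := by simp [θ]
    have h : θ (0, s) ∈ sphere (0 : Fin (k + 1) → ℝ) 1 := by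
      rw [mem_sphere_zero_iff_norm]
      exact norm_eq_one _ (hθ1 _) 0 (by rw [e0]; norm_num)
    refine (key _ h).trans ?_
    simp only [a]
    rw [if_pos (by rw [e0]; norm_num), hθσ]
  · have e0 : θ (1, s) 0 = 1 := by simp [θ]; norm_num
    have h : θ (1, s) ∈ sphere (0 : Fin (k + 1) → ℝ) 1 := by
      rw [mem_sphere_zero_iff_norm]
      exact norm_eq_one _ (hθ1 _) 0 (by rw [e0]; norm_num)
    refine (key _ h).trans ?_
    simp only [a]
    rw [if_neg (by rw [e0]; norm_num)]
  · obtain ⟨j, hj⟩ := id hs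
    have h : θ (t, s) ∈ sphere (0 : Fin (k + 1) → ℝ) 1 := by
      rw [mem_sphere_zero_iff_norm]
      refine norm_eq_one _ (hθ1 _) j.succ ?_
      simp only [θ, Fin.cons_succ]
      exact abs_eq_coord _ hj
    refine (key _ h).trans (haσ _ ?_)
    show σ (θ (t, s)) ∈ _
    rw [hθσ]
    exact hs

end Cub

end PartF1

section PartF2
open Metric Filter Topology

section Fin

lemma exists_good (n r : ℕ)
    (f : Fin r → EuclideanSpace ℂ (Fin (n + 1)) → ℂ)
    (Ω : Set (EuclideanSpace ℂ (Fin (n + 1))))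
    (hΩ : IsOpen Ω) (h0Ω : (0 : EuclideanSpace ℂ (Fin (n + 1))) ∈ Ω)
    (hf : ∀ i, ∀ x ∈ Ω, AnalyticAt ℂ (f i) x)
    (hf0 : ∀ i, f i 0 = 0)
    (X : Set (EuclideanSpace ℂ (Fin (n + 1))))
    (hX : ∀ x, x ∈ X ↔ x ∈ Ω ∧ ∃ i, f i x = 0)
    (hINNC : ∀ p ∈ X, p ≠ 0 →
      LinearIndependent ℂ (fun i : {i : Fin r // f i p = 0} => fderiv ℂ (f i.1) p)) :
    ∃ ε₀ > (0 : ℝ), Metric.closedBall (0 : EuclideanSpace ℂ (Fin (n + 1))) ε₀ ⊆ Ω ∧ GoodF f ε₀ := by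
  have han : ∀ i, AnalyticAt ℂ (f i) 0 := fun i => hf i 0 h0Ω
  have h1 := T5 f han hf0
  have h2 := T4pre f han
  have h3 : ∀ᶠ x in 𝓝 (0 : EuclideanSpace ℂ (Fin (n + 1))), x ∈ Ω := hΩ.mem_nhds h0Ω
  have h4 : ∀ᶠ x in 𝓝 (0 : EuclideanSpace ℂ (Fin (n + 1))), ∀ i, ‖f i x‖ < 1 := by
    rw [eventually_all]
    intro i
    have := (han i).continuousAt.norm
    apply this.eventually_lt_const
    simp [hf0]
  have h5 := h1.and (h2.and (h3.and h4))
  obtain ⟨ε, hε, h⟩ := Metric.nhds_basis_closedBall.eventually_iff.1 h5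
  have h' : ∀ x, ‖x‖ ≤ ε → _ := fun x hx => h (x := x) (by simpa using hx)
  refine ⟨ε, hε, fun x hx => (h hx).2.2.1, ⟨hε, fun i x hx => hf i x (h' x hx).2.2.1, hf0,
    fun i x hx => ((h' x hx).2.2.2 i).le, fun x hx hx0 => ?_, fun x hx => (h' x hx).2.1, fun x hx => (h' x hx).1⟩⟩
  by_cases hxX : x ∈ X
  · exact hINNC x hxX hx0
  · have : IsEmpty {i : Fin r // f i x = 0} := ⟨fun i => hxX ((hX x).2 ⟨(h' x hx).2.2.1, i.1, i.2⟩)⟩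
    exact linearIndependent_empty_type

end Fin

end PartF2

theorem stmt4 (n r : ℕ) (hn : 2 ≤ n) (hr : 1 ≤ r)
    (f : Fin r → EuclideanSpace ℂ (Fin (n + 1)) → ℂ)
    (Ω : Set (EuclideanSpace ℂ (Fin (n + 1))))
    (hΩ : IsOpen Ω) (h0Ω : (0 : EuclideanSpace ℂ (Fin (n + 1))) ∈ Ω)
    (hf : ∀ i, ∀ x ∈ Ω, AnalyticAt ℂ (f i) x)
    (hf0 : ∀ i, f i 0 = 0)
    (D : Fin r → Set (EuclideanSpace ℂ (Fin (n + 1))))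
    (hD : ∀ i, D i = {x ∈ Ω | f i x = 0})
    (X : Set (EuclideanSpace ℂ (Fin (n + 1))))
    (hX : X = ⋃ i, D i)
    (hirr : ∃ ε₁ > (0 : ℝ), ∀ ε, 0 < ε → ε < ε₁ →
      ∀ i, IsConnected (D i ∩ Metric.sphere (0 : EuclideanSpace ℂ (Fin (n + 1))) ε))
    (hINNC : ∀ p ∈ X, p ≠ 0 →
      LinearIndependent ℂ (fun i : {i : Fin r // f i p = 0} => fderiv ℂ (f i.1) p)) :
    ∃ ε₀ > (0 : ℝ), Metric.closedBall (0 : EuclideanSpace ℂ (Fin (n + 1))) ε₀ ⊆ Ω ∧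
      ∀ ε, 0 < ε → ε < ε₀ →
        ∀ (E : Type) [TopologicalSpace E]
          (p : E → ↥(Metric.sphere (0 : EuclideanSpace ℂ (Fin (n + 1))) ε \ X)),
          IsCoveringMap p → PathConnectedSpace E → SimplyConnectedSpace E →
            ∀ (e : E) (k : ℕ), 1 ≤ k → k ≤ n - 1 →
              Subsingleton (HomotopyGroup (Fin k) E e) := by
  have hX' : ∀ x, x ∈ X ↔ x ∈ Ω ∧ ∃ i, f i x = 0 := by
    intro x
    rw [hX, Set.mem_iUnion]
    simp only [hD, Set.mem_ofPred_eq]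
    exact exists_and_left
  obtain ⟨ε₀, hε₀, hsub, hg⟩ := exists_good n r f Ω hΩ h0Ω hf hf0 X hX' hINNC
  refine ⟨ε₀, hε₀, hsub, ?_⟩
  intro ε hε hεε E _ p cov hpc hsc e k hk1 hk2
  rcases Nat.lt_or_ge 1 k with hk | hk
  swap
  · obtain rfl : k = 1 := by omega
    have : Subsingleton (FundamentalGroup E e) := by
      unfold FundamentalGroup
      infer_instance
    exact (HomotopyGroup.pi1EquivFundamentalGroup (X := E) (x := e)).subsingleton
  have hne : ∀ x : EuclideanSpace ℂ (Fin (n + 1)), ‖x‖ = ε → (x ∉ X ↔ ∀ i, f i x ≠ 0) := by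
    intro x hx
    rw [hX']
    have : x ∈ Ω := hsub (by simpa [hx] using hεε.le)
    simp [this]
  have hmem : ∀ x : EuclideanSpace ℂ (Fin (n + 1)),
      x ∈ Metric.sphere (0 : EuclideanSpace ℂ (Fin (n + 1))) ε \ X ↔ ‖x‖ = ε ∧ ∀ i, f i x ≠ 0 := by
    intro x
    rw [Set.mem_sdiff, mem_sphere_zero_iff_norm]
    exact and_congr_right (hne x)
  have key : ∀ γ : GenLoop (Fin k) E e, GenLoop.Homotopic γ GenLoop.const := by
    intro γ
    have hb0 : (fun _ => 0 : Fin k → unitInterval) ∈ Cube.boundary (Fin k) := ⟨⟨0, by omega⟩, Or.inl rfl⟩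
    refine (cov.homotopicRel_iff_comp (f₀ := γ.1) (f₁ := (GenLoop.const : GenLoop (Fin k) E e).1)
      ⟨_, hb0, (γ.2 _ hb0).trans rfl⟩).2 ?_
    obtain ⟨H, hH, hH0, hH1, hHb⟩ := hg.null (k := k) hk (by omega) (by omega) ε hε hεε.le
      ⟨fun s => (p (γ.1 s)).1, continuous_subtype_val.comp (cov.continuous.comp γ.1.continuous)⟩ (p e).1
      (fun s => (hmem _).1 (p (γ.1 s)).2) (fun s hs => by
        show (p (γ.1 s)).1 = _
        rw [γ.2 s hs])
    refine ⟨⟨⟨⟨fun q => ⟨H q, (hmem _).2 (hH q)⟩, H.continuous.subtype_mk _⟩, fun s => ?_, fun s => ?_⟩, fun t s hs => ?_⟩⟩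
    · exact Subtype.ext (hH0 s)
    · exact Subtype.ext (hH1 s)
    · apply Subtype.ext
      show H (t, s) = (p (γ.1 s)).1
      rw [γ.2 s hs]
      exact hHb t s hs
  constructor
  intro a b
  induction a using Quotient.inductionOn with | _ a => ?_
  induction b using Quotient.inductionOn with | _ b => ?_
  exact Quotient.sound ((key a).trans (key b).symm)
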